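/- Let G = G_1 ∗ ⋯ ∗ G_n be a free product (the factors need not be freely indecomposable), and suppose for each i there is a real constant ℓ_i ≥ 1 such that for every finitely generated subgroup K of G_i and every injective endomorphism f of K, the fixed subgroup Fix(f) is finitely generated with rk(Fix(f)) ≤ ℓ_i·rk(K). Set ℓ = max_i ℓ_i. Then for every finitely generated subgroup H of G and every injective endomorphism φ of H, the fixed subgroup Fix(φ) is finitely generated and rk(Fix(φ)) ≤ (1/4)·ℓ·(rk(H) + 1)². -/

import Mathlib

/-- The fixed subgroup of an endomorphism. -/
def fixedSubgroup {G : Type*} [Group G] (φ : G →* G) : Subgroup G where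
  carrier := {g | φ g = g}
  one_mem' := by simp
  mul_mem' := by
    intro a b ha hb
    simp only [Set.mem_setOf_eq, map_mul] at *
    rw [ha, hb]
  inv_mem' := by
    intro a ha
    simp only [Set.mem_setOf_eq, map_inv] at *
    rw [ha]

/-- A tree with vertex set `V` and oriented edge set `E`, equipped with an action of `Γ` that is
free on edges. The tree property is encoded by a potential `pot` whose coboundary is the identity:
the difference of the potentials of two vertices is the signed sum of the edges of the geodesic
joining them. -/
structure EdgeTree (Γ V E : Type*) [Group Γ] [MulAction Γ V] [MulAction Γ E] where
  src : E → V
  tgt : E → V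
  src_smul : ∀ (g : Γ) (e : E), src (g • e) = g • src e
  tgt_smul : ∀ (g : Γ) (e : E), tgt (g • e) = g • tgt e
  free : ∀ (g : Γ) (e : E), g • e = e → g = 1
  pot : V → E →₀ ℤ
  pot_edge : ∀ e, pot (tgt e) - pot (src e) = Finsupp.single e 1
  conn : ∀ v w, Relation.EqvGen (fun a b => ∃ e, a = src e ∧ b = tgt e) v w

namespace EdgeTree

variable {Γ V E : Type*} [Group Γ] [MulAction Γ V] [MulAction Γ E] (T : EdgeTree Γ V E)

/-- A function on vertices that agrees at the endpoints of every edge is constant. -/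
theorem eq_of_edges {A : Type*} (f : V → A) (h : ∀ e, f (T.tgt e) = f (T.src e)) (v w : V) :
    f v = f w := by
  have := T.conn v w
  induction this with
  | rel x y hxy => obtain ⟨e, rfl, rfl⟩ := hxy; exact (h e).symm
  | refl => rfl
  | symm _ _ _ ih => exact ih.symm
  | trans _ _ _ _ _ ih1 ih2 => exact ih1.trans ih2

theorem forall_of_edges (P : V → Prop) (v : V) (hv : P v)
    (h : ∀ e, P (T.tgt e) ↔ P (T.src e)) (w : V) : P w :=
  (T.eq_of_edges P (fun e => propext (h e)) v w).mp hv

/-- The signed sum of the edges of the geodesic from `v` to `w`. -/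
noncomputable def geod (v w : V) : E →₀ ℤ := T.pot w - T.pot v

@[simp] theorem geod_self (v : V) : T.geod v v = 0 := sub_self _

theorem geod_add (u v w : V) : T.geod u v + T.geod v w = T.geod u w := by
  simp [geod]

theorem geod_add_apply (u v w : V) (e : E) : T.geod u v e + T.geod v w e = T.geod u w e := by
  rw [← T.geod_add u v w, Finsupp.add_apply]

theorem neg_geod (v w : V) : - T.geod v w = T.geod w v := by simp [geod]

@[simp] theorem geod_edge (e : E) : T.geod (T.src e) (T.tgt e) = Finsupp.single e 1 :=
  T.pot_edge e

theorem geod_edge_self (e : E) : T.geod (T.src e) (T.tgt e) e = 1 := by simp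

theorem geod_edge_ne {e e' : E} (h : e ≠ e') : T.geod (T.src e) (T.tgt e) e' = 0 := by
  simp [h]

theorem geod_smul (g : Γ) (v w : V) (e : E) : T.geod (g • v) (g • w) (g • e) = T.geod v w e := by
  have := T.eq_of_edges (fun w => T.geod (g • v) (g • w) (g • e) - T.geod v w e) (fun e' => by
    have h1 := T.geod_add_apply (g • v) (g • T.src e') (g • T.tgt e') (g • e)
    have h2 := T.geod_add_apply v (T.src e') (T.tgt e') e
    have h3 : T.geod (g • T.src e') (g • T.tgt e') (g • e) = T.geod (T.src e') (T.tgt e') e := by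
      rw [← T.src_smul, ← T.tgt_smul, T.geod_edge, T.geod_edge]
      by_cases h : e' = e
      · rw [h, Finsupp.single_eq_same, Finsupp.single_eq_same]
      · rw [Finsupp.single_eq_of_ne (Ne.symm h), Finsupp.single_eq_of_ne]
        exact fun h' => h (MulAction.injective g h'.symm)
    lia) w v
  simpa [sub_eq_zero] using this

theorem geod_smul_apply (g : Γ) (v w : V) (e : E) :
    T.geod (g • v) (g • w) e = T.geod v w (g⁻¹ • e) := by
  rw [← T.geod_smul g v w (g⁻¹ • e), smul_inv_smul]

/-- The linear extension of the coboundary of a function on vertices. -/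
noncomputable def cobd {A : Type*} [AddCommGroup A] (f : V → A) : (E →₀ ℤ) →+ A :=
  Finsupp.liftAddHom (fun e => zmultiplesHom A (f (T.tgt e) - f (T.src e)))

theorem cobd_single {A : Type*} [AddCommGroup A] (f : V → A) (e : E) (n : ℤ) :
    T.cobd f (Finsupp.single e n) = n • (f (T.tgt e) - f (T.src e)) := by
  simp [cobd]

theorem cobd_apply {A : Type*} [AddCommGroup A] (f : V → A) (c : E →₀ ℤ) :
    T.cobd f c = c.sum (fun e n => n • (f (T.tgt e) - f (T.src e))) := by
  simp only [cobd, Finsupp.liftAddHom_apply]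
  rfl

theorem cobd_geod {A : Type*} [AddCommGroup A] (f : V → A) (v w : V) :
    T.cobd f (T.geod v w) = f w - f v := by
  have := T.eq_of_edges (fun w => T.cobd f (T.geod v w) - f w) (fun e => by
    rw [← T.geod_add v (T.src e) (T.tgt e), map_add, T.geod_edge, T.cobd_single, one_smul]
    abel) w v
  simp only [geod_self, map_zero, zero_sub] at this
  rw [sub_eq_iff_eq_add] at this
  rw [this]; abel

theorem sum_geod {A : Type*} [AddCommGroup A] (f : V → A) (v w : V) :
    (T.geod v w).sum (fun e n => n • (f (T.tgt e) - f (T.src e))) = f w - f v := by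
  rw [← T.cobd_apply, T.cobd_geod]

/-- The side of the edge `e` on which `v` lies: `0` for the side of the source, `1` for the side of
the target. -/
noncomputable def side (e : E) (v : V) : ℤ := T.geod (T.src e) v e

theorem geod_apply (v w : V) (e : E) : T.geod v w e = T.side e w - T.side e v := by
  have := T.geod_add_apply (T.src e) v w e
  simp only [side]; lia

@[simp] theorem side_src (e : E) : T.side e (T.src e) = 0 := by simp [side]

@[simp] theorem side_tgt (e : E) : T.side e (T.tgt e) = 1 := by simp [side]

theorem side_smul (g : Γ) (e : E) (v : V) : T.side (g • e) (g • v) = T.side e v := by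
  simp [side, T.src_smul, T.geod_smul]

theorem side_smul_left (g : Γ) (e : E) (v : V) : T.side (g • e) v = T.side e (g⁻¹ • v) := by
  rw [← T.side_smul g e, smul_inv_smul]

theorem side_tgt_eq_src {e e' : E} (h : e ≠ e') :
    T.side e (T.tgt e') = T.side e (T.src e') := by
  have := T.geod_apply (T.src e') (T.tgt e') e
  rw [T.geod_edge_ne h.symm] at this
  lia

theorem side_eq_zero_or_one (e : E) (v : V) : T.side e v = 0 ∨ T.side e v = 1 := by
  refine T.forall_of_edges (fun v => T.side e v = 0 ∨ T.side e v = 1) (T.src e) (by simp) ?_ v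
  intro e'
  by_cases h : e = e'
  · subst h; simp
  · simp only [T.side_tgt_eq_src h]

theorem src_ne_tgt (e : E) : T.src e ≠ T.tgt e := fun h => by
  have := T.side_src e
  rw [h, T.side_tgt] at this
  exact one_ne_zero this

/-- `v` is an endpoint of `e`. -/
def Inc (e : E) (v : V) : Prop := T.src e = v ∨ T.tgt e = v

theorem Inc.side_eq {T : EdgeTree Γ V E} {e e' : E} {v : V} (hv : T.Inc e' v) (h : e ≠ e') :
    T.side e v = T.side e (T.src e') := by
  rcases hv with rfl | rfl
  · rfl
  · exact T.side_tgt_eq_src h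

theorem inc_smul {g : Γ} {e : E} {v : V} : T.Inc (g • e) (g • v) ↔ T.Inc e v := by
  simp [Inc, T.src_smul, T.tgt_smul]

/-- Two distinct edges `e`, `e'`: the side of `e` not containing `e'` lies on the same side of `e'`
as `e`. -/
theorem side_eq_of_side_ne {e e' : E} (h : e ≠ e') {v : V}
    (hv : T.side e v ≠ T.side e (T.src e')) : T.side e' v = T.side e' (T.src e) := by
  refine T.forall_of_edges (fun v => T.side e v ≠ T.side e (T.src e') →
    T.side e' v = T.side e' (T.src e)) (T.src e) (fun _ => rfl) ?_ v hv
  intro e''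
  by_cases h1 : e'' = e'
  · subst h1
    simp [T.side_tgt_eq_src h]
  · by_cases h2 : e'' = e
    · subst h2
      simp [T.side_tgt_eq_src (Ne.symm h)]
    · rw [T.side_tgt_eq_src (Ne.symm h1), T.side_tgt_eq_src (Ne.symm h2)]

theorem exists_first_edge {v w : V} (h : v ≠ w) :
    ∃ e, T.Inc e v ∧ T.side e v ≠ T.side e w := by
  have key := T.forall_of_edges (fun w => w = v ∨ ∃ e, T.Inc e v ∧ T.side e v ≠ T.side e w) v
    (Or.inl rfl) (fun e' => ?_) w
  · exact key.resolve_left (Ne.symm h)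
  constructor
  · rintro (h1 | ⟨e, he, hs⟩)
    · exact Or.inr ⟨e', Or.inr h1, by rw [← h1]; simp⟩
    · by_cases h2 : e = e'
      · subst h2
        rcases he with he | he
        · exact Or.inl he
        · rw [he] at hs; exact absurd rfl hs
      · exact Or.inr ⟨e, he, by rwa [T.side_tgt_eq_src h2] at hs⟩
  · rintro (h1 | ⟨e, he, hs⟩)
    · exact Or.inr ⟨e', Or.inl h1, by rw [← h1]; simp⟩
    · by_cases h2 : e = e'
      · subst h2
        rcases he with he | he
        · rw [he] at hs; exact absurd rfl hs
        · exact Or.inl he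
      · exact Or.inr ⟨e, he, by rwa [T.side_tgt_eq_src h2]⟩

theorem first_edge_unique {v w : V} {e e' : E} (he : T.Inc e v) (hs : T.side e v ≠ T.side e w)
    (he' : T.Inc e' v) (hs' : T.side e' v ≠ T.side e' w) : e = e' := by
  by_contra h
  have h1 : T.side e w ≠ T.side e (T.src e') := by rw [← he'.side_eq h]; exact hs.symm
  have h2 := T.side_eq_of_side_ne h h1
  rw [← he.side_eq (Ne.symm h)] at h2
  exact hs' h2.symm

theorem eq_of_geod_eq_zero {v w : V} (h : T.geod v w = 0) : v = w := by
  by_contra hne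
  obtain ⟨e, -, hs⟩ := T.exists_first_edge hne
  have := T.geod_apply v w e
  rw [h] at this
  simp at this
  lia

theorem mem_support_geod {v w : V} {e : E} :
    e ∈ (T.geod v w).support ↔ T.side e v ≠ T.side e w := by
  rw [Finsupp.mem_support_iff, T.geod_apply, sub_ne_zero, ne_comm]

theorem eq_one_of_smul_eq (T : EdgeTree Γ V E) {g : Γ} {v w : V} (hne : v ≠ w)
    (hv : g • v = v) (hw : g • w = w) : g = 1 := by
  obtain ⟨e, he, hs⟩ := T.exists_first_edge hne
  refine T.free g e (T.first_edge_unique (v := v) (w := w) ?_ ?_ he hs)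
  · rw [← hv]; exact T.inc_smul.mpr he
  · rw [← hv, ← hw, T.side_smul, T.side_smul]; exact hs

/-- The other endpoint of an edge. -/
theorem exists_other_end {e : E} {v : V} (he : T.Inc e v) :
    ∃ u, T.Inc e u ∧ T.side e u ≠ T.side e v := by
  rcases he with rfl | rfl
  · exact ⟨T.tgt e, Or.inr rfl, by simp⟩
  · exact ⟨T.src e, Or.inl rfl, by simp⟩

theorem side_eq_of_inc {e e' : E} {u v : V} (hu : T.Inc e u) (hv : T.Inc e v) (h : e' ≠ e) :
    T.side e' u = T.side e' v := by
  rw [hu.side_eq h, hv.side_eq h]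

theorem side_eq_of_ne_of_ne {e : E} {u v w : V} (h1 : T.side e u ≠ T.side e v)
    (h2 : T.side e w ≠ T.side e v) : T.side e u = T.side e w := by
  rcases T.side_eq_zero_or_one e u with h | h <;> rcases T.side_eq_zero_or_one e v with h' | h' <;>
    rcases T.side_eq_zero_or_one e w with h'' | h'' <;> lia

/-- Crossing the first edge from `v` towards `w` removes exactly this edge from the geodesic. -/
theorem mem_support_geod_other_end {e e' : E} {u v w : V} (hv : T.Inc e v) (hu : T.Inc e u)
    (huv : T.side e u ≠ T.side e v) (hs : T.side e v ≠ T.side e w) :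
    e' ∈ (T.geod u w).support ↔ e' ∈ (T.geod v w).support ∧ e' ≠ e := by
  rw [T.mem_support_geod, T.mem_support_geod]
  by_cases h : e' = e
  · subst h
    simp [T.side_eq_of_ne_of_ne huv (w := w) hs.symm]
  · simp [h, T.side_eq_of_inc hu hv h]

theorem card_support_geod_other_end {e : E} {u v w : V} (hv : T.Inc e v) (hu : T.Inc e u)
    (huv : T.side e u ≠ T.side e v) (hs : T.side e v ≠ T.side e w) :
    (T.geod u w).support.card + 1 = (T.geod v w).support.card := by
  classical
  have : (T.geod u w).support = (T.geod v w).support.erase e := by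
    ext e'
    rw [T.mem_support_geod_other_end hv hu huv hs, Finset.mem_erase, and_comm]
  rw [this, Finset.card_erase_add_one (T.mem_support_geod.mpr hs)]

theorem card_support_geod_smul (g : Γ) (v w : V) :
    (T.geod (g • v) (g • w)).support.card = (T.geod v w).support.card := by
  refine Finset.card_bij' (fun e _ => g⁻¹ • e) (fun e _ => g • e) ?_ ?_ ?_ ?_
  · intro e he; rw [Finsupp.mem_support_iff] at *; rwa [← T.geod_smul_apply]
  · intro e he; rw [Finsupp.mem_support_iff] at *; rwa [T.geod_smul]
  · intro e _; simp
  · intro e _; simp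

/-- If `e` separates `x` from both its endpoint `u` and `z`, the geodesic from `u` to `z` is part
of the geodesic from `x` to `z`. -/
theorem support_geod_subset {e : E} {u x z : V} (hu : T.Inc e u) (hux : T.side e x ≠ T.side e u)
    (hz : T.side e z = T.side e u) :
    (T.geod u z).support ⊆ (T.geod x z).support := by
  intro e' he'
  rw [T.mem_support_geod] at *
  by_cases h : e' = e
  · subst h; rw [hz]; exact hux
  · -- `e'` lies on the side of `u`
    intro hxz
    have h1 : T.side e' z ≠ T.side e' (T.src e) := by
      rw [← hu.side_eq h]; exact he'.symm
    have h2 := T.side_eq_of_side_ne h h1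
    have h3 : T.side e' x ≠ T.side e' (T.src e) := by rw [hxz]; exact h1
    have h4 := T.side_eq_of_side_ne h h3
    rw [hz] at h2
    exact hux (h4.trans h2.symm)

end EdgeTree

/-- There are at most `k` orbits. -/
def OrbitBound (Γ E : Type*) [Group Γ] [MulAction Γ E] (k : ℕ) : Prop :=
  ∀ (m : ℕ) (r : Fin m → E), (∀ i j (g : Γ), g • r i = r j → i = j) → m ≤ k

theorem OrbitBound.exists_reps {Γ E : Type*} [Group Γ] [MulAction Γ E] {k : ℕ}
    (h : OrbitBound Γ E k) : ∃ (m : ℕ) (r : Fin m → E), m ≤ k ∧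
      (∀ i j (g : Γ), g • r i = r j → i = j) ∧ ∀ e, ∃ i, ∃ g : Γ, g • r i = e := by
  classical
  let P : ℕ → Prop := fun m => ∃ r : Fin m → E, ∀ i j (g : Γ), g • r i = r j → i = j
  have hP0 : P 0 := ⟨Fin.elim0, fun i => i.elim0⟩
  obtain ⟨r, hr⟩ : P (Nat.findGreatest P k) := Nat.findGreatest_spec (Nat.zero_le k) hP0
  refine ⟨_, r, Nat.findGreatest_le k, hr, fun e => ?_⟩
  by_contra hne
  push Not at hne
  have hP : P (Nat.findGreatest P k + 1) := by
    refine ⟨Fin.cons e r, fun i j g => ?_⟩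
    refine Fin.cases ?_ (fun i => ?_) i <;> refine Fin.cases ?_ (fun j => ?_) j
    · simp
    · simp only [Fin.cons_zero, Fin.cons_succ]
      intro hg
      exact absurd (by rw [← hg, inv_smul_smul]) (hne j g⁻¹)
    · simp only [Fin.cons_zero, Fin.cons_succ]
      intro hg
      exact absurd hg (hne i g)
    · simp only [Fin.cons_succ]
      intro hg
      rw [hr i j g hg]
  obtain ⟨r', hr'⟩ := hP
  have := Nat.le_findGreatest (P := P) (h _ r' hr') ⟨r', hr'⟩
  lia

theorem exists_equivariant_choice {Q X Z : Type*} [Group Q] [MulAction Q X] [MulAction Q Z]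
    (P : X → Z → Prop) (hP : ∀ (q : Q) x z, P x z → P (q • x) (q • z)) (A : Set X)
    (hA : ∀ (q : Q) x, x ∈ A → q • x ∈ A) (hfree : ∀ (q : Q), ∀ x ∈ A, q • x = x → q = 1)
    (hex : ∀ x ∈ A, ∃ z, P x z) (z₀ : X → Z) :
    ∃ s : X → Z, (∀ x ∈ A, P x (s x)) ∧ (∀ (q : Q), ∀ x ∈ A, s (q • x) = q • s x) ∧
      ∀ x ∉ A, s x = z₀ x := by
  classical
  let rep : X → X := fun x => (Quotient.mk (MulAction.orbitRel Q X) x).out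
  have hrep : ∀ x, ∃ q : Q, q • rep x = x := fun x => by
    have : (MulAction.orbitRel Q X).r x (rep x) :=
      (MulAction.orbitRel Q X).symm (Quotient.exact (Quotient.out_eq _))
    exact this
  have hrep' : ∀ (q : Q) x, rep (q • x) = rep x := fun q x => by
    simp only [rep]
    congr 1
    exact Quotient.sound ⟨q, rfl⟩
  choose c hc using hrep
  have hrepA : ∀ x ∈ A, rep x ∈ A := fun x hx => by
    have := hA (c x)⁻¹ x hx
    rwa [inv_smul_eq_iff.mpr (hc x).symm] at this
  have hex' : ∀ x, ∃ z, x ∈ A → P x z := fun x => by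
    by_cases hx : x ∈ A
    · exact (hex x hx).imp fun z hz _ => hz
    · exact ⟨z₀ x, fun h => absurd h hx⟩
  choose z hz using hex'
  refine ⟨fun x => if x ∈ A then c x • z (rep x) else z₀ x, ?_, ?_, ?_⟩
  · intro x hx
    simp only [hx, if_true]
    have := hP (c x) _ _ (hz _ (hrepA x hx))
    rwa [hc] at this
  · intro q x hx
    simp only [hx, hA q x hx, if_true, hrep', smul_smul]
    congr 1
    have h1 : c (q • x) • rep x = q • x := by
      have := hc (q • x); rwa [hrep'] at this
    have h2 : ((q * c x)⁻¹ * c (q • x)) • rep x = rep x := by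
      rw [mul_smul, h1, mul_inv_rev, mul_smul, inv_smul_smul, inv_smul_eq_iff, hc]
    have := hfree _ _ (hrepA x hx) h2
    exact (inv_mul_eq_one.mp this).symm
  · intro x hx
    simp [hx]

/-- An equivariant retraction of a tree onto a set of vertices, given by collapsing a forest. -/
structure TreeRetraction {Γ V E Q Y : Type*} [Group Γ] [MulAction Γ V] [MulAction Γ E]
    [Group Q] [MulAction Q Y] (T : EdgeTree Γ V E) (j : Q →* Γ) (i : Y → V) where
  forest : Set E
  ret : V → Y
  smul_mem : ∀ (q : Q) e, j q • e ∈ forest ↔ e ∈ forest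
  ret_smul : ∀ (q : Q) x, ret (j q • x) = q • ret x
  ret_apply : ∀ y, ret (i y) = y
  ret_forest : ∀ e ∈ forest, ret (T.src e) = ret (T.tgt e)
  geod_ret : ∀ x, ∀ e ∉ forest, T.geod x (i (ret x)) e = 0

theorem exists_treeRetraction {Γ V E Q Y : Type*} [Group Γ] [MulAction Γ V] [MulAction Γ E]
    [Group Q] [MulAction Q Y] [Nonempty Y] (T : EdgeTree Γ V E) (j : Q →* Γ) (i : Y → V)
    (hi : Function.Injective i) (hij : ∀ (q : Q) y, i (q • y) = j q • i y)
    (hfree : ∀ (q : Q) x, x ∉ Set.range i → j q • x = x → q = 1) :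
    Nonempty (TreeRetraction T j i) := by
  classical
  let n : V → ℕ := fun x => ⨅ y, (T.geod x (i y)).support.card
  have hn : ∀ x, ∃ y, (T.geod x (i y)).support.card = n x := fun x =>
    ciInf_mem (fun y => (T.geod x (i y)).support.card)
  have hnle : ∀ x y, n x ≤ (T.geod x (i y)).support.card := fun x y =>
    ciInf_le (OrderBot.bddBelow _) y
  have hn0 : ∀ x, n x = 0 → x ∈ Set.range i := fun x hx => by
    obtain ⟨y, hy⟩ := hn x
    rw [hx, Finset.card_eq_zero, Finsupp.support_eq_empty] at hy
    exact ⟨y, (T.eq_of_geod_eq_zero hy).symm⟩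
  have hnle' : ∀ (q : Q) x, n (j q • x) ≤ n x := fun q x => by
    obtain ⟨y, hy⟩ := hn x
    rw [← hy, ← T.card_support_geod_smul (j q), ← hij]
    exact hnle _ _
  have hnsmul : ∀ (q : Q) x, n (j q • x) = n x := fun q x => by
    refine le_antisymm (hnle' q x) ?_
    have := hnle' q⁻¹ (j q • x)
    rwa [map_inv, inv_smul_smul] at this
  let : MulAction Q V := MulAction.compHom V j
  let : MulAction Q E := MulAction.compHom E j
  have hV : ∀ (q : Q) (x : V), q • x = j q • x := fun _ _ => rfl
  have hE : ∀ (q : Q) (x : E), q • x = j q • x := fun _ _ => rfl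
  have hrange : ∀ (q : Q) x, q • x ∈ Set.range i → x ∈ Set.range i := by
    rintro q x ⟨y, hy⟩
    refine ⟨q⁻¹ • y, ?_⟩
    rw [hij, hy, hV, map_inv, inv_smul_smul]
  by_cases hVr : ∀ x, x ∈ Set.range i
  · choose r hr using hVr
    have hri : ∀ y, r (i y) = y := fun y => hi (hr _)
    refine ⟨⟨∅, r, by simp, fun q x => hi ?_, hri, by simp, fun x e _ => by simp [hr]⟩⟩
    rw [hr, hij, hr]
  push Not at hVr
  have hEne : Nonempty E := by
    obtain ⟨x, hx⟩ := hVr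
    obtain ⟨y⟩ := ‹Nonempty Y›
    obtain ⟨e, -⟩ := T.exists_first_edge (v := x) (w := i y) (fun h => hx ⟨y, h.symm⟩)
    exact ⟨e⟩
  obtain ⟨e₀⟩ := hEne
  obtain ⟨s, hs1, hs2, hs3⟩ := exists_equivariant_choice (Q := Q)
    (fun (x : V) (z : E × V) => T.Inc z.1 x ∧ T.Inc z.1 z.2 ∧ n z.2 < n x)
    (by
      rintro q x ⟨e, u⟩ ⟨h1, h2, h3⟩
      refine ⟨T.inc_smul.mpr h1, T.inc_smul.mpr h2, ?_⟩
      change n (j q • u) < n (j q • x)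
      rwa [hnsmul, hnsmul])
    (Set.range i)ᶜ (fun q x hx h => hx (hrange q x h)) (fun q x hx h => hfree q x hx h)
    (by
      intro x hx
      obtain ⟨y, hy⟩ := hn x
      obtain ⟨e, he, hsep⟩ := T.exists_first_edge (v := x) (w := i y) (fun h => hx ⟨y, h.symm⟩)
      obtain ⟨u, hu, hux⟩ := T.exists_other_end he
      refine ⟨(e, u), he, hu, ?_⟩
      have := T.card_support_geod_other_end he hu hux hsep
      have := hnle u y
      lia)
    (fun x => (e₀, x))
  let step : V → V := fun x => (s x).2
  have step_mem : ∀ x ∈ Set.range i, step x = x := fun x hx => by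
    simp only [step]
    rw [hs3 x (by simpa using hx)]
  have step_lt : ∀ x ∉ Set.range i, n (step x) < n x := fun x hx => (hs1 x hx).2.2
  have step_smul : ∀ (q : Q) x, step (j q • x) = j q • step x := fun q x => by
    by_cases hx : x ∈ Set.range i
    · rw [step_mem x hx, step_mem]
      obtain ⟨y, rfl⟩ := hx
      exact ⟨q • y, hij q y⟩
    · have := hs2 q x hx
      simp only [step, ← hV, this]
      rfl
  have iter_mem : ∀ k x, n x ≤ k → step^[k] x ∈ Set.range i := by
    intro k
    induction k with
    | zero => intro x hx; exact hn0 x (by simpa using hx)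
    | succ k ih =>
      intro x hx
      rw [Function.iterate_succ_apply]
      apply ih
      by_cases hxr : x ∈ Set.range i
      · rw [step_mem x hxr]
        obtain ⟨y, rfl⟩ := hxr
        have := hnle (i y) y
        simp at this
        lia
      · have := step_lt x hxr
        lia
  have iter_const : ∀ k x, n x ≤ k → step^[k + 1] x = step^[k] x := by
    intro k x hx
    rw [Function.iterate_succ_apply']
    exact step_mem _ (iter_mem k x hx)
  have iter_const' : ∀ x k, n x ≤ k → step^[k] x = step^[n x] x := by
    intro x k hk
    induction k, hk using Nat.le_induction with
    | base => rfl
    | succ k hk ih => rw [iter_const k x hk, ih]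
  have iter_step : ∀ x, step^[n (step x)] (step x) = step^[n x] x := by
    intro x
    by_cases hx : x ∈ Set.range i
    · rw [step_mem x hx]
    · obtain ⟨k, hk⟩ := Nat.exists_eq_add_of_lt (step_lt x hx)
      rw [hk, Function.iterate_succ_apply, iter_const' (step x) _ (Nat.le_add_right _ _)]
  choose r hr using fun x => iter_mem (n x) x le_rfl
  have hr_step : ∀ x, r (step x) = r x := fun x => hi (by rw [hr, hr, iter_step])
  refine ⟨⟨{e | ∃ x ∉ Set.range i, e = (s x).1}, r, ?_, ?_, ?_, ?_, ?_⟩⟩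
  · have key : ∀ (q : Q) e, e ∈ {e | ∃ x ∉ Set.range i, e = (s x).1} →
        j q • e ∈ {e | ∃ x ∉ Set.range i, e = (s x).1} := by
      rintro q e ⟨x, hx, rfl⟩
      refine ⟨q • x, fun h => hx (hrange q x h), ?_⟩
      rw [hs2 q x hx]
      rfl
    intro q e
    refine ⟨fun h => ?_, key q e⟩
    have := key q⁻¹ _ h
    rwa [map_inv, inv_smul_smul] at this
  · intro q x
    apply hi
    rw [hr, hij, hr, hnsmul]
    generalize n x = k
    induction k with
    | zero => rfl
    | succ k ih => rw [Function.iterate_succ_apply', Function.iterate_succ_apply', ih, step_smul]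
  · intro y
    apply hi
    rw [hr]
    exact Function.iterate_fixed (step_mem _ ⟨y, rfl⟩) _
  · rintro e ⟨x, hx, rfl⟩
    obtain ⟨h1, h2, h3⟩ := hs1 x hx
    have h4 := hr_step x
    simp only [step] at h4
    rcases h1 with h1 | h1 <;> rcases h2 with h2 | h2
    · exact absurd (h1 ▸ h2 ▸ h3) (lt_irrefl _)
    · rw [h1, h2, h4]
    · rw [h1, h2, h4]
    · exact absurd (h1 ▸ h2 ▸ h3) (lt_irrefl _)
  · intro x e he
    rw [hr]
    generalize n x = k
    induction k with
    | zero => simp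
    | succ k ih =>
      rw [Function.iterate_succ_apply', ← T.geod_add_apply x (step^[k] x), ih, zero_add]
      generalize step^[k] x = u
      by_cases hu : u ∈ Set.range i
      · rw [step_mem u hu]; simp
      · obtain ⟨h1, h2, -⟩ := hs1 u hu
        rw [T.geod_apply, sub_eq_zero]
        refine T.side_eq_of_inc h2 h1 ?_
        rintro rfl
        exact he ⟨u, hu, rfl⟩

namespace TreeRetraction

variable {Γ V E Q Y : Type*} [Group Γ] [MulAction Γ V] [MulAction Γ E]
    [Group Q] [MulAction Q Y] {T : EdgeTree Γ V E} {j : Q →* Γ} {i : Y → V}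
    (R : TreeRetraction T j i)

/-- The edges of the retracted tree are the edges that are not collapsed. -/
abbrev Edge : Type _ := {e : E // e ∉ R.forest}

instance : MulAction Q R.Edge where
  smul q e := ⟨j q • e.1, fun h => e.2 ((R.smul_mem q e.1).mp h)⟩
  one_smul e := Subtype.ext (by change j 1 • e.1 = e.1; simp)
  mul_smul q q' e := Subtype.ext (by change j (q * q') • e.1 = j q • j q' • e.1; simp [mul_smul])

theorem coe_smul (q : Q) (e : R.Edge) : (q • e).1 = j q • e.1 := rfl

theorem geod_ret_ret (v w : V) {e : E} (he : e ∉ R.forest) :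
    T.geod (i (R.ret v)) (i (R.ret w)) e = T.geod v w e := by
  have h1 := T.geod_add_apply v (i (R.ret v)) (i (R.ret w)) e
  have h2 := T.geod_add_apply v w (i (R.ret w)) e
  have h3 := R.geod_ret v e he
  have h4 := R.geod_ret w e he
  lia

/-- The retracted tree. -/
noncomputable def tree (hj : Function.Injective j) : EdgeTree Q Y R.Edge where
  src e := R.ret (T.src e.1)
  tgt e := R.ret (T.tgt e.1)
  src_smul q e := by rw [R.coe_smul, T.src_smul, R.ret_smul]
  tgt_smul q e := by rw [R.coe_smul, T.tgt_smul, R.ret_smul]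
  free q e h := by
    have : j q • e.1 = e.1 := by rw [← R.coe_smul, h]
    exact hj (by rw [T.free _ _ this, map_one])
  pot y := (T.pot (i y)).subtypeDomain (fun e => e ∉ R.forest)
  pot_edge e := by
    ext e'
    have := R.geod_ret_ret (T.src e.1) (T.tgt e.1) e'.2
    rw [T.geod_edge] at this
    refine Eq.trans this ?_
    by_cases h : e' = e
    · rw [h, Finsupp.single_eq_same, Finsupp.single_eq_same]
    · rw [Finsupp.single_eq_of_ne h, Finsupp.single_eq_of_ne fun h' => h (Subtype.ext h')]
  conn y y' := by
    have key : ∀ v w, Relation.EqvGen (fun a b => ∃ e : R.Edge, a = R.ret (T.src e.1) ∧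
        b = R.ret (T.tgt e.1)) (R.ret v) (R.ret w) := by
      intro v w
      have := T.conn v w
      induction this with
      | rel x y hxy =>
        obtain ⟨e, rfl, rfl⟩ := hxy
        by_cases he : e ∈ R.forest
        · rw [R.ret_forest e he]; exact .refl _
        · exact .rel _ _ ⟨⟨e, he⟩, rfl, rfl⟩
      | refl => exact .refl _
      | symm _ _ _ ih => exact ih.symm
      | trans _ _ _ _ _ ih1 ih2 => exact ih1.trans _ _ _ ih2
    have := key (i y) (i y')
    rwa [R.ret_apply, R.ret_apply] at this

end TreeRetraction

section Contraction

open ContinuousLinearMap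

variable {X Y : Type*} [NormedAddCommGroup X] [InnerProductSpace ℝ X] [CompleteSpace X]
  [NormedAddCommGroup Y] [InnerProductSpace ℝ Y] [CompleteSpace Y]

theorem norm_sq_one_sub_adjoint_comp_le (W : X →L[ℝ] Y) (hW : ‖W‖ ≤ 1) (v : X) :
    ‖(1 - adjoint W ∘L W : X →L[ℝ] X) v‖ ^ 2 ≤ ‖v‖ ^ 2 - ‖W v‖ ^ 2 := by
  have h1 : inner ℝ v (adjoint W (W v)) = ‖W v‖ ^ 2 := by
    rw [adjoint_inner_right, real_inner_self_eq_norm_sq]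
  have h2 : ‖adjoint W (W v)‖ ≤ ‖W v‖ := by
    refine (le_opNorm _ _).trans ?_
    rw [LinearIsometryEquiv.norm_map]
    exact mul_le_of_le_one_left (norm_nonneg _) hW
  have h3 : ‖adjoint W (W v)‖ ^ 2 ≤ ‖W v‖ ^ 2 := by gcongr
  change ‖v - adjoint W (W v)‖ ^ 2 ≤ _
  rw [norm_sub_sq_real, h1]
  linarith

theorem norm_one_sub_adjoint_comp_pow_le (W : X →L[ℝ] Y) (hW : ‖W‖ ≤ 1) (n : ℕ) (v : X) :
    ‖((1 - adjoint W ∘L W : X →L[ℝ] X) ^ n) v‖ ≤ ‖v‖ := by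
  induction n with
  | zero => simp
  | succ n ih =>
    rw [pow_succ']
    refine le_trans ?_ ih
    change ‖(1 - adjoint W ∘L W : X →L[ℝ] X) (((1 - adjoint W ∘L W : X →L[ℝ] X) ^ n) v)‖ ≤ _
    generalize ((1 - adjoint W ∘L W : X →L[ℝ] X) ^ n) v = u
    refine (sq_le_sq₀ (norm_nonneg _) (norm_nonneg _)).mp ?_
    have := norm_sq_one_sub_adjoint_comp_le W hW u
    nlinarith [sq_nonneg ‖W u‖]

theorem tendsto_map_one_sub_adjoint_comp_pow (W : X →L[ℝ] Y) (hW : ‖W‖ ≤ 1) (u : X) :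
    Filter.Tendsto (fun n : ℕ => ‖W (((1 - adjoint W ∘L W : X →L[ℝ] X) ^ n) u)‖) Filter.atTop
      (nhds 0) := by
  set c : X →L[ℝ] X := 1 - adjoint W ∘L W with hc
  have hsum : Summable (fun n : ℕ => ‖W ((c ^ n) u)‖ ^ 2) := by
    refine summable_of_sum_range_le (c := ‖u‖ ^ 2) (fun n => by positivity) fun n => ?_
    have : ∀ n : ℕ, ∑ i ∈ Finset.range n, ‖W ((c ^ i) u)‖ ^ 2 ≤ ‖u‖ ^ 2 - ‖(c ^ n) u‖ ^ 2 := by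
      intro n
      induction n with
      | zero => simp
      | succ n ih =>
        rw [Finset.sum_range_succ]
        have := norm_sq_one_sub_adjoint_comp_le W hW ((c ^ n) u)
        have h2 : (c ^ (n + 1)) u = c ((c ^ n) u) := by rw [pow_succ']; rfl
        rw [h2]
        linarith
    have := this n
    nlinarith [sq_nonneg ‖(c ^ n) u‖]
  have h := hsum.tendsto_atTop_zero
  have h2 := h.sqrt
  simpa [Real.sqrt_sq] using h2

theorem comp_one_sub_adjoint_comp_pow (W : X →L[ℝ] Y) (n : ℕ) :
    W ∘L ((1 - adjoint W ∘L W : X →L[ℝ] X) ^ n) =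
      ((1 - W ∘L adjoint W : Y →L[ℝ] Y) ^ n) ∘L W := by
  induction n with
  | zero => ext; simp
  | succ n ih =>
    ext v
    have := DFunLike.congr_fun ih ((1 - adjoint W ∘L W : X →L[ℝ] X) v)
    rw [pow_succ, pow_succ]
    simp only [coe_comp, Function.comp_apply] at this
    change W (((1 - adjoint W ∘L W : X →L[ℝ] X) ^ n) ((1 - adjoint W ∘L W : X →L[ℝ] X) v)) =
      ((1 - W ∘L adjoint W : Y →L[ℝ] Y) ^ n) ((1 - W ∘L adjoint W : Y →L[ℝ] Y) (W v))
    rw [this]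
    congr 1
    simp

theorem tendsto_one_sub_comp_adjoint_pow (W : X →L[ℝ] Y) (hW : ‖W‖ ≤ 1) (z : Y)
    (hz : z ∈ closure (Set.range W)) :
    Filter.Tendsto (fun n : ℕ => ‖((1 - W ∘L adjoint W : Y →L[ℝ] Y) ^ n) z‖) Filter.atTop
      (nhds 0) := by
  rw [Metric.tendsto_atTop]
  intro ε hε
  obtain ⟨_, ⟨u, rfl⟩, hu⟩ := Metric.mem_closure_iff.mp hz (ε / 2) (half_pos hε)
  obtain ⟨N, hN⟩ := Metric.tendsto_atTop.mp (tendsto_map_one_sub_adjoint_comp_pow W hW u) (ε / 2)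
    (half_pos hε)
  refine ⟨N, fun n hn => ?_⟩
  have h1 := hN n hn
  rw [Real.dist_eq, sub_zero, abs_norm] at h1 ⊢
  have h2 := DFunLike.congr_fun (comp_one_sub_adjoint_comp_pow W n) u
  simp only [coe_comp, Function.comp_apply] at h2
  rw [h2] at h1
  have h3 := norm_one_sub_adjoint_comp_pow_le (adjoint W)
    (by rw [LinearIsometryEquiv.norm_map]; exact hW) n (z - W u)
  rw [adjoint_adjoint, map_sub] at h3
  rw [dist_eq_norm] at hu
  have h4 := norm_sub_norm_le (((1 - W ∘L adjoint W : Y →L[ℝ] Y) ^ n) z)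
    (((1 - W ∘L adjoint W : Y →L[ℝ] Y) ^ n) (W u))
  linarith

theorem geom_sum_comp_adjoint_comp (W : X →L[ℝ] Y) (n : ℕ) (v : X) :
    ((∑ t ∈ Finset.range n, (1 - adjoint W ∘L W : X →L[ℝ] X) ^ t) ∘L adjoint W) (W v) =
      v - ((1 - adjoint W ∘L W : X →L[ℝ] X) ^ n) v := by
  have := DFunLike.congr_fun (geom_sum_mul_neg (1 - adjoint W ∘L W : X →L[ℝ] X) n) v
  rw [sub_sub_cancel] at this
  exact this

theorem comp_geom_sum_comp_adjoint (W : X →L[ℝ] Y) (n : ℕ) (v : Y) :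
    W (((∑ t ∈ Finset.range n, (1 - adjoint W ∘L W : X →L[ℝ] X) ^ t) ∘L adjoint W) v) =
      v - ((1 - W ∘L adjoint W : Y →L[ℝ] Y) ^ n) v := by
  have := DFunLike.congr_fun (geom_sum_mul_neg (1 - W ∘L adjoint W : Y →L[ℝ] Y) n) v
  rw [sub_sub_cancel] at this
  refine Eq.trans ?_ this
  change W ((∑ t ∈ Finset.range n, (1 - adjoint W ∘L W : X →L[ℝ] X) ^ t) (adjoint W v)) =
    (∑ t ∈ Finset.range n, (1 - W ∘L adjoint W : Y →L[ℝ] Y) ^ t) (W (adjoint W v))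
  rw [sum_apply, sum_apply, map_sum]
  exact Finset.sum_congr rfl fun t _ =>
    DFunLike.congr_fun (comp_one_sub_adjoint_comp_pow W t) (adjoint W v)

theorem inner_one_sub_adjoint_comp_pow (W : X →L[ℝ] Y) (n : ℕ) (v : X) :
    inner ℝ v (((1 - adjoint W ∘L W : X →L[ℝ] X) ^ (2 * n)) v) =
      ‖((1 - adjoint W ∘L W : X →L[ℝ] X) ^ n) v‖ ^ 2 := by
  have hs : adjoint (1 - adjoint W ∘L W : X →L[ℝ] X) = 1 - adjoint W ∘L W := by
    rw [map_sub, adjoint_comp, adjoint_adjoint, ← star_eq_adjoint, star_one]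
  generalize (1 - adjoint W ∘L W : X →L[ℝ] X) = x at hs
  have hxn : adjoint (x ^ n) = x ^ n := by
    rw [← star_eq_adjoint, star_pow, star_eq_adjoint, hs]
  rw [two_mul, pow_add, ← real_inner_self_eq_norm_sq]
  change inner ℝ v ((x ^ n) ((x ^ n) v)) = _
  rw [← adjoint_inner_left, hxn]

theorem inner_one_sub_comp_adjoint_pow (W : X →L[ℝ] Y) (n : ℕ) (v : Y) :
    inner ℝ v (((1 - W ∘L adjoint W : Y →L[ℝ] Y) ^ (2 * n)) v) =
      ‖((1 - W ∘L adjoint W : Y →L[ℝ] Y) ^ n) v‖ ^ 2 := by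
  have := inner_one_sub_adjoint_comp_pow (adjoint W) n v
  rwa [adjoint_adjoint] at this

end Contraction

/-- Square-summable real functions. -/
abbrev L2 (α : Type*) := lp (fun _ : α => ℝ) 2

namespace L2

open ContinuousLinearMap

variable {α β : Type*}

/-- The Dirac function. -/
noncomputable def dirac (a : α) : L2 α := by
  classical exact lp.single 2 a 1

theorem dirac_self (a : α) : dirac a a = 1 := by
  simp [dirac]

theorem dirac_ne {a b : α} (h : b ≠ a) : dirac a b = 0 := by
  simp [dirac, h]

@[simp] theorem inner_dirac_left (a : α) (f : L2 α) : inner ℝ (dirac a) f = f a := by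
  classical
  rw [dirac, lp.inner_single_left]
  simp

@[simp] theorem inner_dirac_right (a : α) (f : L2 α) : inner ℝ f (dirac a) = f a := by
  rw [real_inner_comm, inner_dirac_left]

theorem sum_sq_le (f : L2 α) (s : Finset α) : ∑ a ∈ s, (f a) ^ 2 ≤ ‖f‖ ^ 2 := by
  have := lp.sum_rpow_le_norm_rpow (p := 2) (by norm_num) f s
  simpa using this

theorem exists_of_sum_sq_le {f : α → ℝ} {C : ℝ} (hC : 0 ≤ C)
    (h : ∀ s : Finset α, ∑ a ∈ s, (f a) ^ 2 ≤ C ^ 2) :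
    ∃ hf : Memℓp f 2, ‖(⟨f, hf⟩ : L2 α)‖ ≤ C := by
  have hf : Memℓp f 2 := memℓp_gen' (C := C ^ 2) (fun s => by simpa using h s)
  exact ⟨hf, lp.norm_le_of_forall_sum_le (by norm_num) hC (fun s => by simpa using h s)⟩

open Classical in
theorem sum_sq_comp_le (p : Set α) (g : α → β) (hg : Set.InjOn g p) (u : L2 β) (s : Finset α) :
    ∑ a ∈ s, (if a ∈ p then u (g a) else 0) ^ 2 ≤ ‖u‖ ^ 2 := by
  have h1 : ∑ a ∈ s, (if a ∈ p then u (g a) else 0) ^ 2 = ∑ a ∈ s with a ∈ p, u (g a) ^ 2 := by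
    rw [Finset.sum_filter]
    exact Finset.sum_congr rfl fun a _ => by split_ifs <;> simp
  rw [h1, ← Finset.sum_image (f := fun b => u b ^ 2) (g := g)]
  · exact sum_sq_le u _
  · intro a ha b hb hab
    simp only [Finset.coe_filter, Set.mem_ofPred_eq] at ha hb
    exact hg ha.2 hb.2 hab

open Classical in
/-- Composition with a partially defined injective map. -/
noncomputable def compL (p : Set α) (g : α → β) (hg : Set.InjOn g p) : L2 β →L[ℝ] L2 α :=
  LinearMap.mkContinuous
    { toFun := fun u => ⟨fun a => if a ∈ p then u (g a) else 0,
        (exists_of_sum_sq_le (norm_nonneg u) (sum_sq_comp_le p g hg u)).choose⟩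
      map_add' := fun u v => by
        ext a
        change (if a ∈ p then (u + v) (g a) else 0) =
          (if a ∈ p then u (g a) else 0) + (if a ∈ p then v (g a) else 0)
        by_cases h : a ∈ p <;> simp [h]
      map_smul' := fun c u => by
        ext a
        by_cases h : a ∈ p <;> simp [h] } 1 (fun u => by
    rw [one_mul]
    exact (exists_of_sum_sq_le (norm_nonneg u) (sum_sq_comp_le p g hg u)).choose_spec)

open Classical in
theorem compL_apply (p : Set α) (g : α → β) (hg : Set.InjOn g p) (u : L2 β) (a : α) :
    compL p g hg u a = if a ∈ p then u (g a) else 0 := rfl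

theorem norm_compL_le (p : Set α) (g : α → β) (hg : Set.InjOn g p) (u : L2 β) :
    ‖compL p g hg u‖ ≤ ‖u‖ :=
  (exists_of_sum_sq_le (norm_nonneg u) (sum_sq_comp_le p g hg u)).choose_spec

section Translation

variable {H : Type*} [Group H] [MulAction H α] [MulAction H β]

/-- The translation action on square-summable functions. -/
noncomputable def trans (α : Type*) [MulAction H α] (h : H) : L2 α →L[ℝ] L2 α :=
  compL Set.univ (fun a => h⁻¹ • a) ((MulAction.injective h⁻¹).injOn)

@[simp] theorem trans_apply (h : H) (u : L2 α) (a : α) : trans α h u a = u (h⁻¹ • a) := by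
  classical
  rw [trans, compL_apply, if_pos (Set.mem_univ a)]

@[simp] theorem trans_dirac (h : H) (a : α) : trans α h (dirac a) = dirac (h • a) := by
  ext b
  rw [trans_apply]
  by_cases hb : b = h • a
  · rw [hb, inv_smul_smul, dirac_self, dirac_self]
  · rw [dirac_ne hb, dirac_ne]
    rintro rfl
    exact hb (smul_inv_smul h b).symm

theorem inner_trans (h : H) (u v : L2 α) : inner ℝ (trans α h u) v = inner ℝ u (trans α h⁻¹ v) := by
  rw [lp.inner_eq_tsum, lp.inner_eq_tsum, ← (MulAction.toPerm h).tsum_eq]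
  simp

theorem adjoint_trans (h : H) : adjoint (trans α h) = trans α h⁻¹ := by
  symm
  rw [eq_adjoint_iff]
  intro u v
  rw [inner_trans, inv_inv]

variable (H) in
/-- Operators commuting with translations. -/
def Equivariant (A : L2 β →L[ℝ] L2 α) : Prop := ∀ (h : H) u, A (trans β h u) = trans α h (A u)

theorem Equivariant.adjoint {A : L2 β →L[ℝ] L2 α} (hA : Equivariant H A) :
    Equivariant H (adjoint A) := by
  intro h u
  have h1 : A ∘L trans β h⁻¹ = trans α h⁻¹ ∘L A := by ext1 v; exact hA h⁻¹ v
  have h2 := congrArg ContinuousLinearMap.adjoint h1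
  rw [adjoint_comp, adjoint_comp, adjoint_trans, adjoint_trans, inv_inv] at h2
  exact (DFunLike.congr_fun h2 u).symm

theorem Equivariant.comp {γ : Type*} [MulAction H γ] {A : L2 β →L[ℝ] L2 α} {B : L2 γ →L[ℝ] L2 β}
    (hA : Equivariant H A) (hB : Equivariant H B) : Equivariant H (A ∘L B) := by
  intro h u
  simp only [coe_comp, Function.comp_apply, hB h, hA h]

theorem Equivariant.one : Equivariant H (1 : L2 α →L[ℝ] L2 α) := fun _ _ => rfl

theorem Equivariant.add {A B : L2 β →L[ℝ] L2 α} (hA : Equivariant H A) (hB : Equivariant H B) :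
    Equivariant H (A + B) := by
  intro h u
  simp only [add_apply, hA h, hB h, map_add]

theorem Equivariant.smul {A : L2 β →L[ℝ] L2 α} (hA : Equivariant H A) (c : ℝ) :
    Equivariant H (c • A) := by
  intro h u
  simp only [smul_apply, hA h, map_smul]

theorem Equivariant.zero : Equivariant H (0 : L2 β →L[ℝ] L2 α) := fun _ _ => by simp

theorem Equivariant.sum {ι : Type*} (s : Finset ι) {A : ι → L2 β →L[ℝ] L2 α}
    (hA : ∀ i ∈ s, Equivariant H (A i)) : Equivariant H (∑ i ∈ s, A i) := by
  classical
  induction s using Finset.induction_on with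
  | empty => exact Equivariant.zero
  | insert i s hi ih =>
    rw [Finset.sum_insert hi]
    exact (hA i (Finset.mem_insert_self _ _)).add
      (ih fun j hj => hA j (Finset.mem_insert_of_mem hj))

theorem Equivariant.pow {A : L2 α →L[ℝ] L2 α} (hA : Equivariant H A) (n : ℕ) :
    Equivariant H (A ^ n) := by
  induction n with
  | zero => exact Equivariant.one
  | succ n ih => rw [pow_succ]; exact ih.comp hA

theorem Equivariant.sub {A B : L2 β →L[ℝ] L2 α} (hA : Equivariant H A) (hB : Equivariant H B) :
    Equivariant H (A - B) := by
  have := hA.add (hB.smul (-1))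
  rwa [neg_one_smul, ← sub_eq_add_neg] at this

/-- Families of representatives of a free action. -/
structure FreeBasis (H : Type*) {α : Type*} [Group H] [MulAction H α] {m : ℕ} (s : Fin m → α) :
    Prop where
  free : ∀ (h : H) (a : α), h • a = a → h = 1
  inj : ∀ i j (h : H), h • s i = s j → i = j
  surj : ∀ a, ∃ i, ∃ h : H, h • s i = a

/-- The parametrization of a free action by representatives. -/
noncomputable def FreeBasis.equiv {m : ℕ} {s : Fin m → α} (hs : FreeBasis H s) : Fin m × H ≃ α :=
  Equiv.ofBijective (fun x => x.2 • s x.1) (by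
    constructor
    · rintro ⟨i, h⟩ ⟨i', h'⟩ hh
      simp only at hh
      have h1 : (h'⁻¹ * h) • s i = s i' := by rw [mul_smul, hh, inv_smul_smul]
      obtain rfl := hs.inj _ _ _ h1
      rw [inv_mul_eq_one.mp (hs.free _ _ h1)]
    · intro a
      obtain ⟨i, h, rfl⟩ := hs.surj a
      exact ⟨(i, h), rfl⟩)

theorem FreeBasis.equiv_apply {m : ℕ} {s : Fin m → α} (hs : FreeBasis H s) (x : Fin m × H) :
    hs.equiv x = x.2 • s x.1 := rfl

theorem FreeBasis.hasSum_inner {m : ℕ} {s : Fin m → α} (hs : FreeBasis H s) (u v : L2 α) :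
    inner ℝ u v = ∑ i, ∑' h : H, u (h • s i) * v (h • s i) ∧
    ∀ i, Summable fun h : H => u (h • s i) * v (h • s i) := by
  have h1 : HasSum (fun a => v a * u a) (inner ℝ u v) := lp.hasSum_inner u v
  rw [← hs.equiv.hasSum_iff] at h1
  have h2 : Summable (fun x : Fin m × H => u (x.2 • s x.1) * v (x.2 • s x.1)) := by
    simpa only [Function.comp_def, hs.equiv_apply, mul_comm] using h1.summable
  refine ⟨?_, fun i => h2.prod_factor i⟩
  rw [← h1.tsum_eq, ← tsum_fintype (L := .unconditional (Fin m)), ← h2.tsum_prod]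
  simp only [Function.comp_def, hs.equiv_apply, mul_comm]

theorem trace_comm {m k : ℕ} {s : Fin m → α} {r : Fin k → β} (hs : FreeBasis H s)
    (hr : FreeBasis H r) {A : L2 β →L[ℝ] L2 α} {B : L2 α →L[ℝ] L2 β} (hA : Equivariant H A)
    (hB : Equivariant H B) :
    ∑ i, A (B (dirac (s i))) (s i) = ∑ j, B (A (dirac (r j))) (r j) := by
  have h1 : ∀ i, A (B (dirac (s i))) (s i) =
      ∑ j, ∑' h : H, A (dirac (h • r j)) (s i) * B (dirac (s i)) (h • r j) := by
    intro i
    rw [← inner_dirac_left, ← adjoint_inner_left, (hr.hasSum_inner _ _).1]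
    refine Finset.sum_congr rfl fun j _ => tsum_congr fun h => ?_
    rw [← inner_dirac_right (h • r j) (adjoint A _), adjoint_inner_left, inner_dirac_left]
  have h2 : ∀ j, B (A (dirac (r j))) (r j) =
      ∑ i, ∑' h : H, B (dirac (h • s i)) (r j) * A (dirac (r j)) (h • s i) := by
    intro j
    rw [← inner_dirac_left, ← adjoint_inner_left, (hs.hasSum_inner _ _).1]
    refine Finset.sum_congr rfl fun i _ => tsum_congr fun h => ?_
    rw [← inner_dirac_right (h • s i) (adjoint B _), adjoint_inner_left, inner_dirac_left]
  simp only [h1, h2]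
  rw [Finset.sum_comm]
  refine Finset.sum_congr rfl fun j _ => Finset.sum_congr rfl fun i _ => ?_
  rw [← (Equiv.inv H).tsum_eq]
  refine tsum_congr fun h => ?_
  rw [Equiv.inv_apply, ← trans_dirac, ← trans_dirac, hA, hB, trans_apply, trans_apply, inv_inv,
    mul_comm]

/-- The von Neumann dimension inequality, for contractions. -/
theorem sub_sum_norm_sq_le {m k : ℕ} {s : Fin m → α} {r : Fin k → β} (hs : FreeBasis H s)
    (hr : FreeBasis H r) {W : L2 β →L[ℝ] L2 α} (hW : Equivariant H W) (n : ℕ) :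
    (m : ℝ) - ∑ i, ‖((1 - W ∘L ContinuousLinearMap.adjoint W : L2 α →L[ℝ] L2 α) ^ n)
      (dirac (s i))‖ ^ 2 ≤ k := by
  have hce : Equivariant H (1 - ContinuousLinearMap.adjoint W ∘L W : L2 β →L[ℝ] L2 β) :=
    Equivariant.one.sub (hW.adjoint.comp hW)
  have hXe : Equivariant H ((∑ t ∈ Finset.range (2 * n),
      (1 - ContinuousLinearMap.adjoint W ∘L W : L2 β →L[ℝ] L2 β) ^ t) ∘L
      ContinuousLinearMap.adjoint W) := (Equivariant.sum _ fun t _ => hce.pow t).comp hW.adjoint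
  have := trace_comm hs hr hW hXe
  simp only [geom_sum_comp_adjoint_comp, comp_geom_sum_comp_adjoint, lp.coeFn_sub, Pi.sub_apply,
    dirac_self, Finset.sum_sub_distrib, Finset.sum_const, Finset.card_univ,
    Fintype.card_fin, nsmul_eq_mul, mul_one] at this
  simp only [← inner_dirac_left, inner_one_sub_adjoint_comp_pow,
    inner_one_sub_comp_adjoint_pow] at this
  rw [this, sub_le_self_iff]
  exact Finset.sum_nonneg fun j _ => sq_nonneg _

/-- The von Neumann dimension inequality: an equivariant operator from a free module of rank `k`
whose image is dense in a free module of rank `m` forces `m ≤ k`. -/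
theorem card_le_of_dense {m k : ℕ} {s : Fin m → α} {r : Fin k → β} (hs : FreeBasis H s)
    (hr : FreeBasis H r) {A : L2 β →L[ℝ] L2 α} (hA : Equivariant H A)
    (hdense : ∀ i, dirac (s i) ∈ closure (Set.range A)) : m ≤ k := by
  obtain ⟨W, hW, hWn, hd⟩ : ∃ W : L2 β →L[ℝ] L2 α, Equivariant H W ∧ ‖W‖ ≤ 1 ∧
      ∀ i, dirac (s i) ∈ closure (Set.range W) := by
    have hpos : 0 < 1 + ‖A‖ := by positivity
    refine ⟨(1 + ‖A‖)⁻¹ • A, hA.smul _, ?_, fun i => ?_⟩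
    · rw [norm_smul, norm_inv, Real.norm_of_nonneg hpos.le, inv_mul_le_iff₀ hpos]
      linarith
    · convert hdense i using 2
      ext z
      constructor
      · rintro ⟨u, rfl⟩
        exact ⟨(1 + ‖A‖)⁻¹ • u, by simp⟩
      · rintro ⟨u, rfl⟩
        exact ⟨(1 + ‖A‖) • u, by simp [smul_smul, hpos.ne']⟩
  have lim : Filter.Tendsto (fun n : ℕ => (m : ℝ) - ∑ i,
      ‖((1 - W ∘L ContinuousLinearMap.adjoint W : L2 α →L[ℝ] L2 α) ^ n) (dirac (s i))‖ ^ 2)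
      Filter.atTop (nhds ((m : ℝ) - ∑ i : Fin m, (0 : ℝ) ^ 2)) :=
    tendsto_const_nhds.sub (tendsto_finsetSum _ fun i _ =>
      (tendsto_one_sub_comp_adjoint_pow W hWn _ (hd i)).pow 2)
  have := le_of_tendsto' lim (sub_sum_norm_sq_le hs hr hW)
  simp at this
  exact_mod_cast this

end Translation

end L2

section Chains

variable {Γ V E : Type*} [Group Γ] [MulAction Γ V] [MulAction Γ E] (T : EdgeTree Γ V E)

/-- Naturality of geodesics under an equivariant map of the vertices: the geodesic between the
images is the sum of the images of the edges. -/
theorem EdgeTree.sum_geod_map (f : V → V) (v w : V) (e : E) :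
    (T.geod v w).sum (fun e' n => n * T.geod (f (T.src e')) (f (T.tgt e')) e) =
      T.geod (f v) (f w) e := by
  have := T.sum_geod (fun v => T.pot (f v) e) v w
  simp only [smul_eq_mul] at this
  simpa only [EdgeTree.geod, Finsupp.sub_apply] using this

open L2 in
/-- The `ℓ²` operator attached to finitely many chains of edges. -/
noncomputable def chainOp {m : ℕ} (T : EdgeTree Γ V E) (b : Fin m → E →₀ ℤ) :
    L2 E →L[ℝ] L2 (Σ _ : Fin m, Γ) :=
  ∑ a, ∑ e ∈ (b a).support, (b a e : ℝ) • compL {x | x.1 = a} (fun x => x.2 • e) (by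
    rintro ⟨a1, h1⟩ ha1 ⟨a2, h2⟩ ha2 h
    simp only [Set.mem_ofPred_eq] at ha1 ha2 h
    subst ha1 ha2
    have : (h2⁻¹ * h1) • e = e := by rw [mul_smul, h, inv_smul_smul]
    rw [inv_mul_eq_one.mp (T.free _ _ this)])

theorem L2.sum_apply_apply {ι α β : Type*} (s : Finset ι) (f : ι → L2 α →L[ℝ] L2 β) (u : L2 α)
    (x : β) : (∑ i ∈ s, f i) u x = ∑ i ∈ s, f i u x := by
  rw [_root_.sum_apply, lp.coeFn_sum, Finset.sum_apply]

open L2 in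
theorem chainOp_apply {m : ℕ} (b : Fin m → E →₀ ℤ) (u : L2 E) (a : Fin m) (h : Γ) :
    chainOp T b u ⟨a, h⟩ = ∑ e ∈ (b a).support, (b a e : ℝ) * u (h • e) := by
  classical
  rw [chainOp]
  refine (sum_apply_apply _ _ _ _).trans ((Finset.sum_eq_single a ?_ ?_).trans ?_)
  · intro a' _ ha'
    refine (sum_apply_apply _ _ _ _).trans (Finset.sum_eq_zero fun e _ => ?_)
    refine (congrArg ((b a' e : ℝ) * ·) ((compL_apply _ _ _ u _).trans (if_neg ?_))).trans
      (mul_zero _)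
    exact Ne.symm ha'
  · simp
  · refine (sum_apply_apply _ _ _ _).trans (Finset.sum_congr rfl fun e _ => ?_)
    exact congrArg ((b a e : ℝ) * ·) ((compL_apply _ _ _ u _).trans (if_pos rfl))

open L2 in
theorem chainOp_dirac {m : ℕ} (b : Fin m → E →₀ ℤ) (e : E) (a : Fin m) (h : Γ) :
    chainOp T b (dirac e) ⟨a, h⟩ = b a (h⁻¹ • e) := by
  rw [chainOp_apply, Finset.sum_eq_single (h⁻¹ • e)]
  · rw [smul_inv_smul, dirac_self, mul_one]
  · intro e' _ he'
    rw [dirac_ne, mul_zero]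
    rintro rfl
    simp at he'
  · intro h0
    rw [Finsupp.notMem_support_iff.mp h0]
    simp

open L2 in
theorem chainOp_equivariant {m : ℕ} (b : Fin m → E →₀ ℤ) :
    Equivariant Γ (chainOp T b) := by
  intro g u
  ext ⟨a, h⟩
  rw [trans_apply, chainOp_apply]
  have : g⁻¹ • (⟨a, h⟩ : Σ _ : Fin m, Γ) = ⟨a, g⁻¹ * h⟩ := rfl
  rw [this, chainOp_apply]
  simp [mul_smul]

theorem freeBasis_sigma (m : ℕ) :
    L2.FreeBasis Γ (fun a : Fin m => (⟨a, 1⟩ : Σ _ : Fin m, Γ)) where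
  free := by
    rintro h ⟨a, x⟩ hx
    have : h * x = x := by simpa using hx
    simpa using this
  inj := by
    rintro a a' h hx
    exact congrArg Sigma.fst hx
  surj := by
    rintro ⟨a, x⟩
    exact ⟨a, x, by simp⟩

end Chains

section Periodic

variable {H V E Q Y : Type*} [Group H] [MulAction H V] [MulAction H E]
    [Group Q] [MulAction Q Y] {T : EdgeTree H V E} {j : Q →* H} {i : Y → V}

open L2 in
theorem card_le_of_fixed_ends {k : ℕ} (hk : OrbitBound H E k) (ψ : H →* H)
    (hψ : Function.Injective ψ) (g : V → V) (hg : ∀ (h : H) v, g (h • v) = ψ h • g v)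
    (R : TreeRetraction T j i) (hj : Function.Injective j)
    (hper : ∀ (h : H) n, 0 < n → ψ^[n] h = h → h ∈ Set.range j)
    {m : ℕ} (r : Fin m → R.Edge) (hr : ∀ a a' (q : Q), q • r a = r a' → a = a')
    (hsrc : ∀ a, g (i (R.ret (T.src (r a).1))) = i (R.ret (T.src (r a).1)))
    (htgt : ∀ a, g (i (R.ret (T.tgt (r a).1))) = i (R.ret (T.tgt (r a).1))) : m ≤ k := by
  classical
  obtain ⟨k', s, hk', hs1, hs2⟩ := hk.exists_reps
  refine le_trans ?_ hk'
  have hsb : FreeBasis H s := ⟨T.free, hs1, hs2⟩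
  set b : Fin m → E →₀ ℤ := fun a =>
    T.geod (i (R.ret (T.src (r a).1))) (i (R.ret (T.tgt (r a).1))) with hb
  have hb1 : ∀ a, ∀ e ∉ R.forest, b a e = T.geod (T.src (r a).1) (T.tgt (r a).1) e :=
    fun a e he => R.geod_ret_ret _ _ he
  refine card_le_of_dense (freeBasis_sigma m) hsb (chainOp_equivariant T b) fun a₀ => ?_
  set W := chainOp T b with hW
  set C : L2 (Σ _ : Fin m, H) →L[ℝ] L2 (Σ _ : Fin m, H) :=
    compL Set.univ (fun x => ⟨x.1, ψ x.2⟩) (by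
      rintro ⟨a1, h1⟩ - ⟨a2, h2⟩ - h
      simp only [Sigma.mk.injEq] at h
      obtain ⟨rfl, h⟩ := h
      rw [hψ (eq_of_heq h)]) with hC
  have hCapply : ∀ u a h, C u ⟨a, h⟩ = u ⟨a, ψ h⟩ := fun u a h =>
    (compL_apply _ _ _ u _).trans (if_pos (Set.mem_univ _))
  have hWd : ∀ e a h, W (dirac e) ⟨a, h⟩ = b a (h⁻¹ • e) := chainOp_dirac T b
  set K : Submodule ℝ (L2 (Σ _ : Fin m, H)) :=
    (Submodule.span ℝ (Set.range fun e => W (dirac e))).topologicalClosure with hK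
  have hWK : ∀ e, W (dirac e) ∈ K := fun e =>
    Submodule.le_topologicalClosure _ (Submodule.subset_span ⟨e, rfl⟩)
  have hKcl : (K : Set (L2 (Σ _ : Fin m, H))) ⊆ closure (Set.range W) := by
    rw [hK, Submodule.topologicalClosure_coe]
    refine closure_mono ?_
    have : Submodule.span ℝ (Set.range fun e => W (dirac e)) ≤ LinearMap.range W.toLinearMap := by
      rw [Submodule.span_le]
      rintro _ ⟨e, rfl⟩
      exact ⟨_, rfl⟩
    intro z hz
    exact this hz
  -- the operator `C` preserves `K`
  have hfin : ∀ e, {e' | T.geod (g (T.src e')) (g (T.tgt e')) e ≠ 0}.Finite := by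
    intro e
    have : {e' | T.geod (g (T.src e')) (g (T.tgt e')) e ≠ 0} ⊆
        ⋃ t, (fun h : H => h • s t) '' ((fun h : H => (ψ h)⁻¹ • e) ⁻¹'
          ((T.geod (g (T.src (s t))) (g (T.tgt (s t)))).support : Set E)) := by
      intro e' he'
      obtain ⟨t, h, rfl⟩ := hs2 e'
      refine Set.mem_iUnion.mpr ⟨t, h, ?_, rfl⟩
      simp only [Set.mem_ofPred_eq, T.src_smul, T.tgt_smul, hg, T.geod_smul_apply] at he'
      simpa using he'
    refine Set.Finite.subset (Set.finite_iUnion fun t => (Set.Finite.preimage ?_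
      (Finset.finite_toSet _)).image _) this
    intro h1 _ h2 _ h12
    simp only at h12
    have : (ψ h2 * (ψ h1)⁻¹) • e = e := by rw [mul_smul, h12, smul_inv_smul]
    exact (hψ (mul_inv_eq_one.mp (T.free _ _ this))).symm
  have hCW : ∀ e, C (W (dirac e)) ∈ K := by
    intro e
    have : C (W (dirac e)) = ∑ e' ∈ (hfin e).toFinset,
        (T.geod (g (T.src e')) (g (T.tgt e')) e : ℝ) • W (dirac e') := by
      ext ⟨a, h⟩
      rw [hCapply, hWd, lp.coeFn_sum, Finset.sum_apply]
      simp only [lp.coeFn_smul, Pi.smul_apply, hWd, smul_eq_mul]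
      have h1 : b a ((ψ h)⁻¹ • e) = T.geod (g (h • i (R.ret (T.src (r a).1))))
          (g (h • i (R.ret (T.tgt (r a).1)))) e := by
        rw [hg, hg, hsrc, htgt, T.geod_smul_apply]
      rw [h1, ← T.sum_geod_map g, Finsupp.sum]
      simp only [T.geod_smul_apply]
      push_cast
      refine (Finset.sum_congr_of_eq_on_inter ?_ ?_ ?_)
      · intro e' _ he'
        simp only [Set.Finite.mem_toFinset, Set.mem_ofPred_eq, not_not] at he'
        rw [he']; simp
      · intro e' _ he'
        rw [Finsupp.notMem_support_iff, T.geod_smul_apply] at he'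
        simp only [hb]
        rw [he']; simp
      · intro e' _ _
        simp only [hb]
        ring
    rw [this]
    exact Submodule.sum_mem _ fun e' _ => Submodule.smul_mem _ _ (hWK e')
  have hCK : ∀ z ∈ K, C z ∈ K := by
    have h1 : Submodule.span ℝ (Set.range fun e => W (dirac e)) ≤ K.comap C.toLinearMap := by
      rw [Submodule.span_le]
      rintro _ ⟨e, rfl⟩
      exact hCW e
    have h2 : IsClosed ((K.comap C.toLinearMap : Submodule ℝ _) : Set (L2 (Σ _ : Fin m, H))) :=
      (Submodule.isClosed_topologicalClosure _).preimage C.continuous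
    exact Submodule.topologicalClosure_minimal _ h1 h2
  have : CompleteSpace K := (Submodule.isClosed_topologicalClosure _).completeSpace_coe
  obtain ⟨y, hy, ξ, hξ, hyξ⟩ := K.exists_add_mem_mem_orthogonal (dirac (⟨a₀, 1⟩ : Σ _ : Fin m, H))
  have hCd : C (dirac ⟨a₀, 1⟩) = dirac ⟨a₀, 1⟩ := by
    ext ⟨a, h⟩
    rw [hCapply]
    by_cases h1 : h = 1
    · subst h1; rw [map_one]
    · rw [dirac_ne, dirac_ne]
      · simp [h1]
      · simp only [ne_eq, Sigma.mk.injEq, not_and]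
        rintro rfl h2
        exact h1 (hψ (by rw [eq_of_heq h2, map_one]))
  have hCξ : C ξ = ξ := by
    have h1 : C ξ - ξ ∈ K := by
      have h2 : C ξ - ξ = y - C y := by
        have h3 : ξ = dirac ⟨a₀, 1⟩ - y := by rw [hyξ]; abel
        rw [h3, map_sub, hCd]; abel
      rw [h2]
      exact K.sub_mem hy (hCK y hy)
    have h2 : inner ℝ ξ (C ξ - ξ) = 0 := (Submodule.mem_orthogonal' _ _).mp hξ _ h1
    have h3 : ‖C ξ‖ ≤ ‖ξ‖ := norm_compL_le _ _ _ _
    have h4 : ‖C ξ‖ ^ 2 = ‖ξ‖ ^ 2 + ‖C ξ - ξ‖ ^ 2 := by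
      have := norm_add_sq_real ξ (C ξ - ξ)
      rw [h2, add_sub_cancel] at this
      linarith
    have h5 : ‖C ξ‖ ^ 2 ≤ ‖ξ‖ ^ 2 := by gcongr
    have h6 : ‖C ξ - ξ‖ ^ 2 ≤ 0 := by linarith
    have h7 : ‖C ξ - ξ‖ = 0 := pow_eq_zero_iff two_ne_zero |>.mp (le_antisymm h6 (sq_nonneg _))
    exact sub_eq_zero.mp (norm_eq_zero.mp h7)
  have hξit : ∀ n a h, ξ ⟨a, ψ^[n] h⟩ = ξ ⟨a, h⟩ := by
    intro n a h
    induction n with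
    | zero => rfl
    | succ n ih =>
      rw [Function.iterate_succ_apply', ← ih, ← hCapply, hCξ]
  have hξper : ∀ a h, ξ ⟨a, h⟩ ≠ 0 → h ∈ Set.range j := by
    intro a h hne
    by_contra hnr
    have hinj : Function.Injective (fun n : ℕ => (⟨a, ψ^[n] h⟩ : Σ _ : Fin m, H)) := by
      have aux : ∀ n d, ψ^[n + d] h = ψ^[n] h → d = 0 := by
        intro n d hd
        by_contra hd0
        rw [Function.iterate_add_apply] at hd
        exact hnr (hper h d (Nat.pos_of_ne_zero hd0) ((hψ.iterate n) hd))
      intro n n' hnn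
      simp only [Sigma.mk.injEq, heq_eq_eq, true_and] at hnn
      rcases le_total n n' with hle | hle
      · obtain ⟨d, rfl⟩ := Nat.exists_eq_add_of_le hle
        rw [aux n d hnn.symm]; rfl
      · obtain ⟨d, rfl⟩ := Nat.exists_eq_add_of_le hle
        rw [aux n' d hnn]; rfl
    obtain ⟨N, hN⟩ := exists_nat_gt (‖ξ‖ ^ 2 / ξ ⟨a, h⟩ ^ 2)
    have h1 := sum_sq_le ξ ((Finset.range N).map ⟨_, hinj⟩)
    rw [Finset.sum_map] at h1
    simp only [Function.Embedding.coeFn_mk, hξit, Finset.sum_const, Finset.card_range,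
      nsmul_eq_mul] at h1
    rw [div_lt_iff₀ (by positivity)] at hN
    linarith
  have hξ0 : ∀ a h, ξ ⟨a, h⟩ = 0 := by
    intro a h
    by_contra hne
    obtain ⟨q, rfl⟩ := hξper a h hne
    have h1 : inner ℝ ξ (W (dirac (j q • (r a).1))) = 0 :=
      (Submodule.mem_orthogonal' _ _).mp hξ _ (hWK _)
    rw [lp.inner_eq_tsum, tsum_eq_single ⟨a, j q⟩] at h1
    · rw [hWd, inv_smul_smul, hb1 a _ (r a).2, T.geod_edge_self] at h1
      simp at h1
      exact hne h1
    · rintro ⟨a', h'⟩ hne'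
      by_cases h0 : ξ ⟨a', h'⟩ = 0
      · rw [h0]; simp
      · obtain ⟨q', rfl⟩ := hξper a' h' h0
        have hnf : j (q'⁻¹ * q) • (r a).1 ∉ R.forest := ((q'⁻¹ * q) • r a).2
        rw [hWd, ← map_inv, ← mul_smul, ← map_mul, hb1 _ _ hnf, T.geod_edge_ne, Int.cast_zero]
        · simp
        · intro heq
          have h2 : (q'⁻¹ * q) • r a = r a' := Subtype.ext heq.symm
          have h3 := hr _ _ _ h2
          subst h3
          have h4 : j (q'⁻¹ * q) = 1 := T.free _ _ heq.symm
          have h5 : q'⁻¹ * q = 1 := hj (by rw [h4, map_one])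
          rw [inv_mul_eq_one.mp h5] at hne'
          exact hne' rfl
  have : ξ = 0 := by ext ⟨a, h⟩; exact hξ0 a h
  rw [this, add_zero] at hyξ
  rw [hyξ]
  exact hKcl hy

theorem Function.iterate_eq_of_dvd {X : Type*} {f : X → X} {x : X} {n N : ℕ} (h : f^[n] x = x)
    (hd : n ∣ N) : f^[N] x = x := by
  obtain ⟨c, rfl⟩ := hd
  rw [Function.iterate_mul]
  exact Function.iterate_fixed h c

theorem MonoidHom.exists_iterate {H : Type*} [Group H] (φ : H →* H) (n : ℕ) :
    ∃ ψ : H →* H, ∀ h, ψ h = φ^[n] h := by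
  induction n with
  | zero => exact ⟨MonoidHom.id H, fun _ => rfl⟩
  | succ n ih =>
    obtain ⟨ψ, hψ⟩ := ih
    exact ⟨φ.comp ψ, fun h => by
      rw [Function.iterate_succ_apply', ← hψ, MonoidHom.comp_apply]⟩

theorem iterate_smul_of_semiconj {H V : Type*} [Group H] [MulAction H V] {φ : H →* H} {f : V → V}
    (hf : ∀ (h : H) v, f (h • v) = φ h • f v) (n : ℕ) (h : H) (v : V) :
    f^[n] (h • v) = φ^[n] h • f^[n] v := by
  induction n with
  | zero => rfl
  | succ n ih =>
    rw [Function.iterate_succ_apply', ih, hf, ← Function.iterate_succ_apply' f,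
      ← Function.iterate_succ_apply' φ]

/-- The retraction onto the periodic part does not increase the number of orbits of edges. -/
theorem TreeRetraction.orbitBound_of_periodic {k : ℕ} (hk : OrbitBound H E k) (φ : H →* H)
    (hφ : Function.Injective φ) (f : V → V) (hf : ∀ (h : H) v, f (h • v) = φ h • f v)
    (R : TreeRetraction T j i) (hj : Function.Injective j)
    (hper : ∀ (h : H) n, 0 < n → φ^[n] h = h → h ∈ Set.range j)
    (hY : ∀ y, ∃ n, 0 < n ∧ f^[n] (i y) = i y) : OrbitBound Q R.Edge k := by
  intro m r hr
  choose p hp hpf using hY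
  set N := ∏ a, (p (R.ret (T.src (r a).1)) * p (R.ret (T.tgt (r a).1))) with hN
  have hdvd : ∀ a, p (R.ret (T.src (r a).1)) * p (R.ret (T.tgt (r a).1)) ∣ N := fun a =>
    Finset.dvd_prod_of_mem (fun a => p (R.ret (T.src (r a).1)) * p (R.ret (T.tgt (r a).1)))
      (Finset.mem_univ a)
  have hNpos : 0 < N := Finset.prod_pos fun a _ => Nat.mul_pos (hp _) (hp _)
  obtain ⟨ψ, hψ⟩ := φ.exists_iterate N
  refine card_le_of_fixed_ends hk ψ ?_ (f^[N]) ?_ R hj ?_ r hr ?_ ?_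
  · intro a b hab
    rw [hψ, hψ] at hab
    exact hφ.iterate N hab
  · intro h v
    rw [hψ, iterate_smul_of_semiconj hf]
  · intro h n hn hh
    refine hper h (N * n) (Nat.mul_pos hNpos hn) ?_
    rw [Function.iterate_mul]
    have : (φ^[N]) = ψ := funext fun h => (hψ h).symm
    rw [this]
    exact hh
  · intro a
    exact Function.iterate_eq_of_dvd (hpf _) ((Dvd.intro _ rfl).trans (hdvd a))
  · intro a
    exact Function.iterate_eq_of_dvd (hpf _) ((Dvd.intro_left _ rfl).trans (hdvd a))

end Periodic

section FixedSubtree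

universe u

variable {S V Q Y : Type*} {E : Type u} [Group S] [MulAction S V] [MulAction S E]
    [Group Q] [MulAction Q Y]

/-- If an equivariant map fixes the endpoints of a set of representatives of the edges, then its
fixed vertices span a subtree. -/
theorem EdgeTree.exists_tree_of_fixed_reps (T : EdgeTree S V E) {k : ℕ} (hk : OrbitBound S E k)
    (φ : S →* S) (hφ : Function.Injective φ) (f : V → V) (hf : ∀ (s : S) v, f (s • v) = φ s • f v)
    {m : ℕ} (r : Fin m → E) (hr1 : ∀ a b (s : S), s • r a = r b → a = b)
    (hr2 : ∀ e, ∃ a, ∃ s : S, s • r a = e)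
    (hsrc : ∀ a, f (T.src (r a)) = T.src (r a)) (htgt : ∀ a, f (T.tgt (r a)) = T.tgt (r a))
    (j : Q →* S) (hj : Function.Injective j) (i : Y → V) (hi : Function.Injective i)
    (hij : ∀ (q : Q) y, i (q • y) = j q • i y)
    (hjr : ∀ s, s ∈ Set.range j ↔ φ s = s) (hir : ∀ v, v ∈ Set.range i ↔ f v = v) :
    ∃ (E' : Type u) (_ : MulAction Q E') (_ : EdgeTree Q Y E'), OrbitBound Q E' k := by
  classical
  -- the map induced on edges
  choose ra rs hrs using hr2
  set F : E → E := fun e => φ (rs e) • r (ra e) with hF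
  have hFsrc : ∀ e, T.src (F e) = f (T.src e) := fun e => by
    conv_rhs => rw [← hrs e, T.src_smul, hf, hsrc]
    rw [T.src_smul]
  have hFtgt : ∀ e, T.tgt (F e) = f (T.tgt e) := fun e => by
    conv_rhs => rw [← hrs e, T.tgt_smul, hf, htgt]
    rw [T.tgt_smul]
  have hFinj : Function.Injective F := by
    intro e e' h
    have h1 : ra e = ra e' := hr1 _ _ ((φ (rs e'))⁻¹ * φ (rs e)) (by
      rw [mul_smul, inv_smul_eq_iff]; exact h)
    have h2 : rs e = rs e' := by
      refine hφ ?_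
      have h3 : φ (rs e) • r (ra e) = φ (rs e') • r (ra e') := h
      rw [← h1] at h3
      have h4 : ((φ (rs e'))⁻¹ * φ (rs e)) • r (ra e) = r (ra e) := by
        rw [mul_smul, inv_smul_eq_iff]; exact h3
      exact (inv_mul_eq_one.mp (T.free _ _ h4)).symm
    rw [← hrs e, ← hrs e', h1, h2]
  have hgeod : ∀ v w e, T.geod (f v) (f w) (F e) = T.geod v w e := by
    intro v w e
    rw [← T.sum_geod_map f v w (F e), Finsupp.sum, Finset.sum_eq_single e]
    · rw [← hFsrc, ← hFtgt, T.geod_edge_self, mul_one]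
    · intro e' _ hne
      rw [← hFsrc, ← hFtgt, T.geod_edge_ne fun h => hne (hFinj h), mul_zero]
    · intro h
      rw [Finsupp.notMem_support_iff.mp h, zero_mul]
  set fixE : Set E := {e | f (T.src e) = T.src e ∧ f (T.tgt e) = T.tgt e} with hfixE
  have hfirst : ∀ {v w e}, f v = v → f w = w → T.Inc e v → T.side e v ≠ T.side e w →
      e ∈ fixE := by
    intro v w e hv hw he hs
    have h1 : T.Inc (F e) v := by
      rcases he with he | he
      · left; rw [hFsrc, he, hv]
      · right; rw [hFtgt, he, hv]
    have h2 : T.side (F e) v ≠ T.side (F e) w := by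
      have := hgeod v w e
      rw [hv, hw, T.geod_apply, T.geod_apply] at this
      lia
    have h3 := T.first_edge_unique he hs h1 h2
    have h4 := hFsrc e
    have h5 := hFtgt e
    rw [← h3] at h4 h5
    exact ⟨h4.symm, h5.symm⟩
  have hsmul : ∀ (q : Q) e, e ∈ fixE → j q • e ∈ fixE := by
    rintro q e ⟨h1, h2⟩
    have hq := (hjr (j q)).mp ⟨q, rfl⟩
    refine ⟨?_, ?_⟩
    · rw [T.src_smul, hf, h1, hq]
    · rw [T.tgt_smul, hf, h2, hq]
  let act : MulAction Q fixE :=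
    { smul := fun q e => ⟨j q • e.1, hsmul q e.1 e.2⟩
      one_smul := fun e => Subtype.ext (by change j 1 • e.1 = e.1; simp)
      mul_smul := fun q q' e => Subtype.ext (by
        change j (q * q') • e.1 = j q • j q' • e.1; simp [mul_smul]) }
  have hcoe : ∀ (q : Q) (e : fixE), (q • e).1 = j q • e.1 := fun _ _ => rfl
  choose src' hsrc' using fun e : fixE => (hir (T.src e.1)).mpr e.2.1
  choose tgt' htgt' using fun e : fixE => (hir (T.tgt e.1)).mpr e.2.2
  refine ⟨fixE, act, ⟨src', tgt', ?_, ?_, ?_, fun y => (T.pot (i y)).subtypeDomain (· ∈ fixE),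
    ?_, ?_⟩, ?_⟩
  · intro q e
    refine hi ?_
    rw [hsrc', hij, hsrc', hcoe, T.src_smul]
  · intro q e
    refine hi ?_
    rw [htgt', hij, htgt', hcoe, T.tgt_smul]
  · intro q e h
    have : j q • e.1 = e.1 := by rw [← hcoe, h]
    exact hj (by rw [T.free _ _ this, map_one])
  · intro e
    ext e'
    rw [htgt', hsrc']
    refine (DFunLike.congr_fun (T.geod_edge e.1) e'.1).trans ?_
    by_cases h : e' = e
    · rw [h, Finsupp.single_eq_same, Finsupp.single_eq_same]
    · rw [Finsupp.single_eq_of_ne h, Finsupp.single_eq_of_ne fun h' => h (Subtype.ext h')]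
  · have key : ∀ (n : ℕ) (v w : Y), (T.geod (i v) (i w)).support.card = n →
        Relation.EqvGen (fun a b => ∃ e, a = src' e ∧ b = tgt' e) v w := by
      intro n
      induction n with
      | zero =>
        intro v w h
        have := T.eq_of_geod_eq_zero (Finsupp.support_eq_empty.mp (Finset.card_eq_zero.mp h))
        rw [hi this]
        exact .refl _
      | succ n ih =>
        intro v w h
        have hne : i v ≠ i w := by
          intro h'
          rw [h'] at h
          simp at h
        obtain ⟨e, he, hs⟩ := T.exists_first_edge hne
        have hv := (hir _).mp ⟨v, rfl⟩
        have hw := (hir _).mp ⟨w, rfl⟩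
        have hmem := hfirst hv hw he hs
        obtain ⟨u, hu, huv⟩ : ∃ u : Y, T.Inc e (i u) ∧ T.side e (i u) ≠ T.side e (i v) := by
          rcases he with he | he
          · refine ⟨tgt' ⟨e, hmem⟩, Or.inr (htgt' ⟨e, hmem⟩).symm, ?_⟩
            rw [htgt', ← he]; simp
          · refine ⟨src' ⟨e, hmem⟩, Or.inl (hsrc' ⟨e, hmem⟩).symm, ?_⟩
            rw [hsrc', ← he]; simp
        have hcard := T.card_support_geod_other_end he hu huv hs
        have h1 := ih u w (by lia)
        refine Relation.EqvGen.trans _ u _ ?_ h1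
        rcases he with he | he
        · have hv' : v = src' ⟨e, hmem⟩ := hi (by rw [hsrc', he])
          have hu' : u = tgt' ⟨e, hmem⟩ := hi (by
            rw [htgt']
            rcases hu with hu | hu
            · exact absurd (by rw [← hu, ← he]) huv
            · exact hu.symm)
          exact .rel _ _ ⟨_, hv', hu'⟩
        · have hv' : v = tgt' ⟨e, hmem⟩ := hi (by rw [htgt', he])
          have hu' : u = src' ⟨e, hmem⟩ := hi (by
            rw [hsrc']
            rcases hu with hu | hu
            · exact hu.symm
            · exact absurd (by rw [← hu, ← he]) huv)
          exact .symm _ _ (.rel _ _ ⟨_, hu', hv'⟩)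
    exact fun v w => key _ v w rfl
  · intro n t ht
    refine hk n (fun a => (t a).1) fun a b s hs => ?_
    have h1 : φ s • T.src (t a).1 = s • T.src (t a).1 := by
      have := (t b).2.1
      rw [← hs, T.src_smul, hf, (t a).2.1] at this
      exact this
    have h2 : φ s • T.tgt (t a).1 = s • T.tgt (t a).1 := by
      have := (t b).2.2
      rw [← hs, T.tgt_smul, hf, (t a).2.2] at this
      exact this
    have h3 : s⁻¹ * φ s = 1 := by
      refine T.eq_one_of_smul_eq (T.src_ne_tgt (t a).1) ?_ ?_
      · rw [mul_smul, h1, inv_smul_smul]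
      · rw [mul_smul, h2, inv_smul_smul]
    obtain ⟨q, rfl⟩ := (hjr s).mpr (inv_mul_eq_one.mp h3).symm
    exact ht a b q (Subtype.ext hs)

end FixedSubtree

section FewVariables

open scoped Classical in
/-- Functions of the variables `x i`, `i : ι`, that are sums of functions each depending on fewer
than `n` of the variables. -/
def fewVars (F ι V : Type*) [Field F] (n : ℕ) : Submodule F ((ι → V) → F) :=
  Submodule.span F {u | ∃ A : Finset ι, A.card < n ∧ DependsOn u (A : Set ι)}

namespace fewVars

variable {F ι V : Type*} [Field F]

theorem mem_of_dependsOn {n : ℕ} {u : (ι → V) → F} (A : Finset ι) (hA : A.card < n)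
    (hu : DependsOn u (A : Set ι)) : u ∈ fewVars F ι V n :=
  Submodule.subset_span ⟨A, hA, hu⟩

theorem apply_eq {u : (ι → V) → F} (hu : u ∈ fewVars F ι V 1) (x y : ι → V) : u x = u y := by
  induction hu using Submodule.span_induction with
  | mem u h =>
    obtain ⟨A, hA, hu⟩ := h
    rw [Finset.card_eq_zero.mp (Nat.lt_one_iff.mp hA)] at hu
    exact hu fun i hi => by simp at hi
  | zero => rfl
  | add u v _ _ hu hv => exact congrArg₂ (· + ·) hu hv
  | smul a u _ hu => exact congrArg (a * ·) hu

theorem comp_mem [DecidableEq ι] {n : ℕ} {u : (ι → V) → F} (hu : u ∈ fewVars F ι V n) (e : ι → ι)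
    (a : ι → V → V) : (fun x => u fun i => a i (x (e i))) ∈ fewVars F ι V n := by
  induction hu using Submodule.span_induction with
  | mem u h =>
    obtain ⟨A, hA, hu⟩ := h
    refine mem_of_dependsOn (A.image e) (Finset.card_image_le.trans_lt hA) fun x y h => ?_
    refine hu fun i hi => ?_
    rw [h (e i) (by simpa using ⟨i, hi, rfl⟩)]
  | zero => exact Submodule.zero_mem _
  | add u v _ _ hu hv => exact Submodule.add_mem _ hu hv
  | smul a u _ hu => exact Submodule.smul_mem _ _ hu

variable [DecidableEq ι]

/-- Freezing the variables outside of `A`. -/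
def freeze (A : Finset ι) (z : ι → V) : ((ι → V) → F) →ₗ[F] ((ι → V) → F) where
  toFun u x := u (A.piecewise x z)
  map_add' _ _ := rfl
  map_smul' _ _ := rfl

theorem freeze_apply (A : Finset ι) (z : ι → V) (u : (ι → V) → F) (x : ι → V) :
    freeze A z u x = u (A.piecewise x z) := rfl

theorem dependsOn_freeze {A B : Finset ι} {u : (ι → V) → F} (hu : DependsOn u (B : Set ι))
    (z : ι → V) : DependsOn (freeze A z u) ((A ∩ B : Finset ι) : Set ι) := by
  intro x y h
  refine hu fun i hi => ?_
  by_cases hA : i ∈ A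
  · rw [Finset.piecewise_eq_of_mem _ _ _ hA, Finset.piecewise_eq_of_mem _ _ _ hA]
    exact h i (by simpa using ⟨hA, hi⟩)
  · rw [Finset.piecewise_eq_of_notMem _ _ _ hA, Finset.piecewise_eq_of_notMem _ _ _ hA]

theorem freeze_eq_self {A : Finset ι} {u : (ι → V) → F} (hu : DependsOn u (A : Set ι))
    (z : ι → V) : freeze A z u = u := by
  funext x
  exact hu fun i hi => Finset.piecewise_eq_of_mem _ _ _ hi

theorem freeze_mem_of_ne {n : ℕ} {A B : Finset ι} (hA : A.card = n) (hB : B.card < n + 1)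
    (hAB : A ≠ B) {u : (ι → V) → F} (hu : DependsOn u (B : Set ι)) (z : ι → V) :
    freeze A z u ∈ fewVars F ι V n := by
  refine mem_of_dependsOn (A ∩ B) ?_ (dependsOn_freeze hu z)
  by_contra h
  have h1 : A ∩ B = A := Finset.eq_of_subset_of_card_le Finset.inter_subset_left (by lia)
  have h2 : A ⊆ B := Finset.inter_eq_left.mp h1
  exact hAB (Finset.eq_of_subset_of_card_le h2 (by lia))

theorem freeze_sub_freeze_mem {n : ℕ} {u : (ι → V) → F} (hu : u ∈ fewVars F ι V (n + 1))
    {A : Finset ι} (hA : A.card = n) (z z' : ι → V) :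
    freeze A z u - freeze A z' u ∈ fewVars F ι V n := by
  induction hu using Submodule.span_induction with
  | mem u h =>
    obtain ⟨B, hB, hu⟩ := h
    by_cases hAB : A = B
    · subst hAB
      rw [freeze_eq_self hu, freeze_eq_self hu, sub_self]
      exact Submodule.zero_mem _
    · exact Submodule.sub_mem _ (freeze_mem_of_ne hA hB hAB hu z)
        (freeze_mem_of_ne hA hB hAB hu z')
  | zero => simp
  | add u v _ _ hu hv =>
    rw [map_add, map_add, add_sub_add_comm]
    exact Submodule.add_mem _ hu hv
  | smul a u _ hu =>
    rw [map_smul, map_smul, ← smul_sub]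
    exact Submodule.smul_mem _ _ hu

theorem sub_sum_freeze_mem [Fintype ι] {n : ℕ} {u : (ι → V) → F}
    (hu : u ∈ fewVars F ι V (n + 1)) (z : ι → V) :
    u - ∑ A ∈ Finset.powersetCard n Finset.univ, freeze A z u ∈ fewVars F ι V n := by
  induction hu using Submodule.span_induction with
  | mem u h =>
    obtain ⟨B, hB, hu⟩ := h
    by_cases hBn : B.card = n
    · rw [← Finset.add_sum_erase _ _ (Finset.mem_powersetCard.mpr ⟨Finset.subset_univ B, hBn⟩),
        freeze_eq_self hu, sub_add_cancel_left]
      refine Submodule.neg_mem _ (Submodule.sum_mem _ fun A hA => ?_)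
      rw [Finset.mem_erase, Finset.mem_powersetCard] at hA
      exact freeze_mem_of_ne hA.2.2 hB hA.1 hu z
    · refine Submodule.sub_mem _ (mem_of_dependsOn B (by lia) hu)
        (Submodule.sum_mem _ fun A hA => ?_)
      rw [Finset.mem_powersetCard] at hA
      refine freeze_mem_of_ne hA.2 hB ?_ hu z
      rintro rfl
      exact hBn hA.2
  | zero => simp
  | add u v _ _ hu hv =>
    simp only [map_add, Finset.sum_add_distrib]
    rw [add_sub_add_comm]
    exact Submodule.add_mem _ hu hv
  | smul a u _ hu =>
    simp only [map_smul]
    rw [← Finset.smul_sum, ← smul_sub]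
    exact Submodule.smul_mem _ _ hu

end fewVars

end FewVariables

section Multilinear

variable {F ι α : Type*} [Field F] [Fintype ι]

/-- The multilinear extension of a function on families of basis vectors. -/
noncomputable def multiExt (η : (ι → α) → F) : MultilinearMap F (fun _ : ι => α →₀ F) F :=
  ((Basis.piTensorProduct fun _ : ι =>
    (Finsupp.basisSingleOne : Module.Basis α F (α →₀ F))).constr F η).compMultilinearMap
      (PiTensorProduct.tprod F)

theorem multiExt_single (η : (ι → α) → F) (ε : ι → α) :
    multiExt η (fun i => Finsupp.single (ε i) 1) = η ε := by
  have := (Basis.piTensorProduct fun _ : ι =>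
    (Finsupp.basisSingleOne : Module.Basis α F (α →₀ F))).constr_basis F η ε
  rw [Basis.piTensorProduct_apply] at this
  simpa [multiExt] using this

theorem MultilinearMap.ext_single {f g : MultilinearMap F (fun _ : ι => α →₀ F) F}
    (h : ∀ ε : ι → α, f (fun i => Finsupp.single (ε i) 1) = g fun i => Finsupp.single (ε i) 1) :
    f = g :=
  Module.Basis.ext_multilinear (fun _ => Finsupp.basisSingleOne) fun ε => by simpa using h ε

/-- Translating the arguments of a multilinear map by constants changes it by functions of fewer
variables. -/
theorem MultilinearMap.add_const_sub_mem [DecidableEq ι] {M V : Type*} [AddCommGroup M] [Module F M]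
    (f : MultilinearMap F (fun _ : ι => M) F) (c : ι → V → M) (d : ι → M) :
    (fun x : ι → V => f fun i => c i (x i) + d i) - (fun x => f fun i => c i (x i)) ∈
      fewVars F ι V (Fintype.card ι) := by
  have h : (fun x : ι → V => f fun i => c i (x i) + d i) - (fun x => f fun i => c i (x i)) =
      ∑ B ∈ Finset.univ.erase Finset.univ,
        fun x : ι → V => f (B.piecewise (fun i => c i (x i)) d) := by
    funext x
    have := f.map_add_univ (fun i => c i (x i)) d
    rw [← Finset.add_sum_erase _ _ (Finset.mem_univ Finset.univ), Finset.piecewise_univ] at this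
    rw [Pi.sub_apply, Finset.sum_apply, sub_eq_iff_eq_add']
    exact this
  rw [h]
  refine Submodule.sum_mem _ fun B hB => fewVars.mem_of_dependsOn B ?_ fun x y hxy => ?_
  · rw [Finset.mem_erase] at hB
    exact Finset.card_lt_univ_of_notMem (x := (Finset.ssubset_univ_iff.mpr hB.1 |>
      Finset.exists_of_ssubset).choose) (Finset.ssubset_univ_iff.mpr hB.1 |>
      Finset.exists_of_ssubset).choose_spec.2
  · congr 1
    funext i
    by_cases hi : i ∈ B
    · rw [Finset.piecewise_eq_of_mem _ _ _ hi, Finset.piecewise_eq_of_mem _ _ _ hi,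
        hxy i (by simpa using hi)]
    · rw [Finset.piecewise_eq_of_notMem _ _ _ hi, Finset.piecewise_eq_of_notMem _ _ _ hi]

end Multilinear

section Norm

/-- A function invariant under a transformation of prime order that vanishes on the fixed points
is a norm. -/
theorem exists_sum_iterate_eq {O F : Type*} [AddCommGroup F] {p : ℕ} (hp : p.Prime) (q : O → O)
    (hq : ∀ o, q^[p] o = o) (u : O → F) (hu : ∀ o, u (q o) = u o) (h0 : ∀ o, q o = o → u o = 0) :
    ∃ κ : O → F, ∀ o, ∑ n ∈ Finset.range p, κ (q^[n] o) = u o := by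
  classical
  let st : Setoid O :=
    { r := fun a b => ∃ n, q^[n] a = b
      iseqv :=
        { refl := fun a => ⟨0, rfl⟩
          symm := by
            rintro a b ⟨n, rfl⟩
            refine ⟨(p - 1) * n, ?_⟩
            rw [← Function.iterate_add_apply]
            have : (p - 1) * n + n = p * n := by
              obtain ⟨c, rfl⟩ := Nat.exists_eq_add_of_le hp.one_le
              simp; ring
            rw [this, Function.iterate_mul]
            exact Function.iterate_fixed (hq a) n
          trans := by
            rintro a b c ⟨n, rfl⟩ ⟨m, rfl⟩
            exact ⟨m + n, Function.iterate_add_apply _ _ _ _⟩ } }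
  have hit : ∀ n o, u (q^[n] o) = u o := by
    intro n o
    induction n with
    | zero => rfl
    | succ n ih => rw [Function.iterate_succ_apply', hu, ih]
  refine ⟨fun o => if o = (Quotient.mk st o).out then u o else 0, fun o => ?_⟩
  have hout : ∀ n, Quotient.mk st (q^[n] o) = Quotient.mk st o := fun n =>
    Quotient.sound (st.symm ⟨n, rfl⟩)
  simp only [hout, hit]
  obtain ⟨N, hN⟩ : ∃ n, q^[n] o = (Quotient.mk st o).out := st.symm (Quotient.mk_out o)
  by_cases hfix : q o = o
  · rw [h0 o hfix]; simp
  have hper : Function.minimalPeriod q o = p := by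
    have hd : Function.minimalPeriod q o ∣ p := Function.IsPeriodicPt.minimalPeriod_dvd (hq o)
    rcases (Nat.dvd_prime hp).mp hd with h | h
    · exact absurd (Function.minimalPeriod_eq_one_iff_isFixedPt.mp h) hfix
    · exact h
  rw [Finset.sum_eq_single (N % p)]
  · rw [if_pos]
    rw [← hN, ← hper, Function.iterate_mod_minimalPeriod_eq]
  · intro n hn hne
    rw [if_neg]
    intro h
    rw [← hN, ← Function.iterate_mod_minimalPeriod_eq (n := N), hper] at h
    refine hne ((Function.iterate_eq_iterate_iff_of_lt_minimalPeriod ?_ ?_).mp h)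
    · rw [hper]; exact Finset.mem_range.mp hn
    · rw [hper]; exact Nat.mod_lt _ hp.pos
  · intro h
    exact absurd (Finset.mem_range.mpr (Nat.mod_lt _ hp.pos)) h

end Norm

/-- A semilinear transformation of finite order of a set with a group action, together with the
data describing its iterates. -/
structure CyclicTwist (p : ℕ) (S V : Type*) [Group S] [MulAction S V] where
  σ : S →* S
  f : V → V
  f_smul : ∀ (s : S) (v : V), f (s • v) = σ s • f v
  f_iterate : ∀ v, f^[p] v = v
  sg : ZMod p → S →* S
  sg_zero : ∀ s, sg 0 s = s
  sg_succ : ∀ i s, sg (i + 1) s = sg i (σ s)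
  fi : ZMod p → V → V
  fi_smul : ∀ i (s : S) (v : V), fi i (s • v) = sg i s • fi i v

namespace CyclicTwist

variable {p : ℕ} {S V M : Type*} [Group S] [MulAction S V] [MulAction S M]

/-- The cyclic shift of a family indexed by `ZMod p`. -/
def shift (x : ZMod p → M) : ZMod p → M := fun i => x (i + 1)

theorem shift_iterate (n : ℕ) (x : ZMod p → M) (i : ZMod p) : shift^[n] x i = x (i + n) := by
  induction n generalizing x with
  | zero => simp
  | succ n ih =>
    rw [Function.iterate_succ_apply, ih, shift]
    congr 1
    push_cast
    ring

theorem shift_iterate_self (x : ZMod p → M) : shift^[p] x = x := by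
  funext i
  rw [shift_iterate, ZMod.natCast_self, add_zero]

theorem shift_iterate_const (n : ℕ) (v : M) : shift^[n] (fun _ : ZMod p => v) = fun _ => v := by
  funext i
  rw [shift_iterate]

variable (τ : CyclicTwist p S V)

/-- The twisted diagonal action on families indexed by `ZMod p`. -/
def tw (s : S) (x : ZMod p → M) : ZMod p → M := fun i => τ.sg i s • x i

theorem tw_one (x : ZMod p → M) : τ.tw 1 x = x := by
  funext i; simp [tw]

theorem tw_mul (s t : S) (x : ZMod p → M) : τ.tw (s * t) x = τ.tw s (τ.tw t x) := by
  funext i; simp [tw, mul_smul]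

theorem tw_inv_tw (s : S) (x : ZMod p → M) : τ.tw s⁻¹ (τ.tw s x) = x := by
  rw [← tw_mul, inv_mul_cancel, tw_one]

theorem tw_tw_inv (s : S) (x : ZMod p → M) : τ.tw s (τ.tw s⁻¹ x) = x := by
  rw [← tw_mul, mul_inv_cancel, tw_one]

theorem shift_tw (s : S) (x : ZMod p → M) : shift (τ.tw s x) = τ.tw (τ.σ s) (shift x) := by
  funext i; simp [tw, shift, τ.sg_succ]

theorem shift_iterate_tw (n : ℕ) (s : S) (x : ZMod p → M) :
    shift^[n] (τ.tw s x) = τ.tw (τ.σ^[n] s) (shift^[n] x) := by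
  induction n with
  | zero => rfl
  | succ n ih => rw [Function.iterate_succ_apply', ih, shift_tw, ← Function.iterate_succ_apply' τ.σ,
      ← Function.iterate_succ_apply' shift]

theorem f_iterate_smul (n : ℕ) (s : S) (v : V) : τ.f^[n] (s • v) = τ.σ^[n] s • τ.f^[n] v :=
  iterate_smul_of_semiconj τ.f_smul n s v

/-- Invariant additive cocycles depending on a family of vertices. -/
structure IsCocycle {F : Type*} [Field F] (G : V → V → (ZMod p → V) → F) : Prop where
  add : ∀ u v w x, G u v x + G v w x = G u w x
  inv : ∀ (s : S) v w x, G (s • v) (s • w) (τ.tw s x) = G v w x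

/-- The norm of a cocycle. -/
def norm {F : Type*} [Field F] (G : V → V → (ZMod p → V) → F) (v w : V) : (ZMod p → V) → F :=
  ∑ n ∈ Finset.range p, fun x => G (τ.f^[n] v) (τ.f^[n] w) (shift^[n] x)

variable {F : Type*} [Field F]

theorem norm_apply (G : V → V → (ZMod p → V) → F) (v w : V) (x : ZMod p → V) :
    τ.norm G v w x = ∑ n ∈ Finset.range p, G (τ.f^[n] v) (τ.f^[n] w) (shift^[n] x) := by
  rw [norm, Finset.sum_apply]

theorem norm_add (G G' : V → V → (ZMod p → V) → F) :
    τ.norm (G + G') = τ.norm G + τ.norm G' := by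
  funext v w x
  simp [norm_apply, Finset.sum_add_distrib]

theorem norm_shift (G : V → V → (ZMod p → V) → F) (v w : V) (x : ZMod p → V) :
    τ.norm G (τ.f v) (τ.f w) (shift x) = τ.norm G v w x := by
  have h1 := Finset.sum_range_succ (fun n => G (τ.f^[n] v) (τ.f^[n] w) (shift^[n] x)) p
  rw [Finset.sum_range_succ', τ.f_iterate, τ.f_iterate, shift_iterate_self] at h1
  simp only [Function.iterate_zero, id_eq] at h1
  rw [norm_apply, norm_apply, ← add_right_cancel h1]
  rfl

variable {τ}

theorem IsCocycle.sub {G G' : V → V → (ZMod p → V) → F} (h : τ.IsCocycle G)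
    (h' : τ.IsCocycle G') : τ.IsCocycle (G - G') where
  add u v w x := by
    simp only [Pi.sub_apply, ← h.add u v w, ← h'.add u v w]; ring
  inv s v w x := by
    simp only [Pi.sub_apply, h.inv, h'.inv]

theorem IsCocycle.add' {G G' : V → V → (ZMod p → V) → F} (h : τ.IsCocycle G)
    (h' : τ.IsCocycle G') : τ.IsCocycle (G + G') where
  add u v w x := by
    simp only [Pi.add_apply, ← h.add u v w, ← h'.add u v w]; ring
  inv s v w x := by
    simp only [Pi.add_apply, h.inv, h'.inv]

theorem IsCocycle.norm {G : V → V → (ZMod p → V) → F} (h : τ.IsCocycle G) :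
    τ.IsCocycle (τ.norm G) where
  add u v w x := by
    simp only [norm_apply, ← Finset.sum_add_distrib, h.add]
  inv s v w x := by
    simp only [norm_apply, f_iterate_smul, shift_iterate_tw, h.inv]

theorem norm_sub_norm_mem {n : ℕ} {G G' : V → V → (ZMod p → V) → F}
    (h : ∀ v w, G v w - G' v w ∈ fewVars F (ZMod p) V n) (v w : V) :
    τ.norm G v w - τ.norm G' v w ∈ fewVars F (ZMod p) V n := by
  classical
  have : τ.norm G v w - τ.norm G' v w = ∑ n ∈ Finset.range p, fun x =>
      (G (τ.f^[n] v) (τ.f^[n] w) - G' (τ.f^[n] v) (τ.f^[n] w)) (shift^[n] x) := by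
    funext x
    simp [norm_apply, Finset.sum_sub_distrib]
  rw [this]
  refine Submodule.sum_mem _ fun k _ => ?_
  have h1 := fewVars.comp_mem (h (τ.f^[k] v) (τ.f^[k] w)) (fun i => i + k) (fun _ => id)
  have h2 : ∀ x : ZMod p → V, shift^[k] x = fun i => id (x (i + k)) := fun x =>
    funext fun i => shift_iterate k x i
  simpa only [h2] using h1

theorem comp_tw_mem {n : ℕ} {u : (ZMod p → V) → F} (hu : u ∈ fewVars F (ZMod p) V n) (s : S) :
    (fun x => u (τ.tw s x)) ∈ fewVars F (ZMod p) V n := by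
  classical
  exact fewVars.comp_mem hu id fun i v => τ.sg i s • v

end CyclicTwist

section Lift

variable {p : ℕ} {S V E F : Type*} [Group S] [MulAction S V] [MulAction S E] [Field F]

theorem EdgeTree.eq_of_add (T : EdgeTree S V E) {A : Type*} [AddCommGroup A] {G G' : V → V → A}
    (hG : ∀ u v w, G u v + G v w = G u w) (hG' : ∀ u v w, G' u v + G' v w = G' u w)
    (h : ∀ e, G (T.src e) (T.tgt e) = G' (T.src e) (T.tgt e)) (v w : V) : G v w = G' v w := by
  have h1 := T.eq_of_edges (fun w => G v w - G' v w) (fun e => by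
    rw [← hG v (T.src e) (T.tgt e), ← hG' v (T.src e) (T.tgt e), h]; abel) w v
  have h2 : G v v = 0 := by simpa using hG v v v
  have h3 : G' v v = 0 := by simpa using hG' v v v
  rw [h2, h3, sub_zero] at h1
  exact sub_eq_zero.mp h1

theorem EdgeTree.exists_section (T : EdgeTree S V E) :
    ∃ (r : E → E) (g : E → S), (∀ e, g e • r e = e) ∧ (∀ (s : S) e, r (s • e) = r e) ∧
      ∀ (s : S) e, g (s • e) = s * g e := by
  let r : E → E := fun e => (Quotient.mk (MulAction.orbitRel S E) e).out
  have hr : ∀ e, ∃ g : S, g • r e = e := fun e => by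
    have : (MulAction.orbitRel S E).r (r e) e := Quotient.mk_out (s := MulAction.orbitRel S E) e
    obtain ⟨g, hg⟩ := this
    exact ⟨g⁻¹, by rw [← hg, inv_smul_smul]⟩
  choose g hg using hr
  have hrs : ∀ (s : S) e, r (s • e) = r e := fun s e => by
    have : Quotient.mk (MulAction.orbitRel S E) (s • e) = Quotient.mk _ e :=
      Quotient.sound ⟨s, rfl⟩
    simp only [r, this]
  refine ⟨r, g, hg, hrs, fun s e => ?_⟩
  have h1 := hg (s • e)
  have h2 : (s * g e) • r e = s • e := by rw [mul_smul, hg]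
  rw [hrs] at h1
  have h3 : ((s * g e)⁻¹ * g (s • e)) • r e = r e := by rw [mul_smul, h1, ← h2, inv_smul_smul]
  exact (inv_mul_eq_one.mp (T.free _ _ h3)).symm

/-- A cochain which is invariant up to functions of few variables lifts to a cocycle. -/
theorem CyclicTwist.exists_cocycle_sub_mem (τ : CyclicTwist p S V) (T : EdgeTree S V E) {n : ℕ}
    (U : V → V → (ZMod p → V) → F) (hadd : ∀ u v w, U u v + U v w = U u w)
    (hinv : ∀ (s : S) v w,
      (fun x => U (s • v) (s • w) (τ.tw s x)) - U v w ∈ fewVars F (ZMod p) V n) :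
    ∃ H, τ.IsCocycle H ∧ ∀ v w, H v w - U v w ∈ fewVars F (ZMod p) V n := by
  obtain ⟨r, g, hgr, hrs, hgs⟩ := T.exists_section
  let h : E → (ZMod p → V) → F := fun e x => U (T.src (r e)) (T.tgt (r e)) (τ.tw (g e)⁻¹ x)
  let H : V → V → (ZMod p → V) → F := fun v w => (T.geod v w).sum fun e n => n • h e
  have hH : ∀ e, H (T.src e) (T.tgt e) = h e := fun e => by simp [H]
  have hHadd : ∀ u v w, H u v + H v w = H u w := fun u v w => by
    simp only [H]
    rw [← T.geod_add u v w, Finsupp.sum_add_index' (by simp) (by simp [add_smul])]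
  refine ⟨H, ⟨fun u v w x => congrFun (hHadd u v w) x, fun s v w x => ?_⟩, fun v w => ?_⟩
  · refine T.eq_of_add (G := fun v w => H (s • v) (s • w) (τ.tw s x)) (G' := fun v w => H v w x)
      ?_ ?_ ?_ v w
    · exact fun u v w => congrFun (hHadd (s • u) (s • v) (s • w)) _
    · exact fun u v w => congrFun (hHadd u v w) _
    · intro e
      rw [← T.src_smul, ← T.tgt_smul, hH, hH]
      simp only [h]
      rw [hrs, hgs, mul_inv_rev, τ.tw_mul, τ.tw_inv_tw]
  · let π := (fewVars F (ZMod p) V n).mkQ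
    have key := T.eq_of_add (G := fun v w => π (H v w)) (G' := fun v w => π (U v w))
      (fun u v w => by rw [← map_add, hHadd]) (fun u v w => by rw [← map_add, hadd]) (fun e => ?_)
      v w
    · rw [← Submodule.Quotient.eq]
      exact key
    · rw [hH]
      refine (Submodule.Quotient.eq _).mpr ?_
      have h1 := Submodule.neg_mem _ (CyclicTwist.comp_tw_mem (τ := τ)
        (hinv (g e) (T.src (r e)) (T.tgt (r e))) (g e)⁻¹)
      rw [← T.src_smul, ← T.tgt_smul, hgr] at h1
      convert h1 using 1
      funext x
      simp [h, τ.tw_tw_inv]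

end Lift

section Reduction

variable {p : ℕ} {S V E F : Type*} [Group S] [MulAction S V] [MulAction S E] [Field F]

/-- The translates of a subset of `ZMod p`. -/
def translateSubset (p n : ℕ) (A : {A : Finset (ZMod p) // A.card = n}) :
    {A : Finset (ZMod p) // A.card = n} :=
  ⟨A.1.map (Equiv.addRight (-1 : ZMod p)).toEmbedding, by rw [Finset.card_map, A.2]⟩

theorem mem_translateSubset_iterate {p n : ℕ} (k : ℕ)
    (A : {A : Finset (ZMod p) // A.card = n}) (i : ZMod p) :
    i ∈ ((translateSubset p n)^[k] A).1 ↔ i + k ∈ A.1 := by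
  induction k generalizing A i with
  | zero => simp
  | succ k ih =>
    rw [Function.iterate_succ_apply, ih]
    simp only [translateSubset, Finset.mem_map_equiv]
    simp [add_assoc]

theorem CyclicTwist.exists_norm_reduction_step [hp : Fact p.Prime] (τ : CyclicTwist p S V)
    (T : EdgeTree S V E) (v₀ : V) {n : ℕ} (hn : 0 < n) (hnp : n < p)
    (G : V → V → (ZMod p → V) → F) (hG : τ.IsCocycle G)
    (hGσ : ∀ v w x, G (τ.f v) (τ.f w) (CyclicTwist.shift x) = G v w x)
    (hGn : ∀ v w, G v w ∈ fewVars F (ZMod p) V (n + 1)) :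
    ∃ H, τ.IsCocycle H ∧ ∀ v w, G v w - τ.norm H v w ∈ fewVars F (ZMod p) V n := by
  classical
  have hqit : ∀ A : {A : Finset (ZMod p) // A.card = n}, (translateSubset p n)^[p] A = A := by
    intro A
    ext i
    rw [mem_translateSubset_iterate, ZMod.natCast_self, add_zero]
  obtain ⟨κ, hκ⟩ := exists_sum_iterate_eq hp.out (translateSubset p n) hqit (fun _ => (1 : F))
    (fun _ => rfl) (by
      intro A hA
      exfalso
      have h1 : ∀ i, i ∈ A.1 → ∀ k : ℕ, i + k ∈ A.1 := by
        intro i hi k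
        rw [← mem_translateSubset_iterate, Function.iterate_fixed hA]
        exact hi
      have h2 : A.1.Nonempty := Finset.card_pos.mp (by rw [A.2]; exact hn)
      obtain ⟨i, hi⟩ := h2
      have h3 : A.1 = Finset.univ := by
        refine Finset.eq_univ_of_forall fun k => ?_
        have := h1 i hi (k - i).val
        rwa [ZMod.natCast_zmod_val, add_sub_cancel] at this
      have h4 := A.2
      rw [h3, Finset.card_univ, ZMod.card] at h4
      lia)
  have hGit : ∀ k v w x, G (τ.f^[k] v) (τ.f^[k] w) (CyclicTwist.shift^[k] x) = G v w x := by
    intro k v w x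
    induction k with
    | zero => rfl
    | succ k ih => rw [Function.iterate_succ_apply', Function.iterate_succ_apply',
        Function.iterate_succ_apply', hGσ, ih]
  let z : ZMod p → V := fun _ => v₀
  let U : V → V → (ZMod p → V) → F := fun v w =>
    ∑ A : {A : Finset (ZMod p) // A.card = n}, κ A • fewVars.freeze A.1 z (G v w)
  obtain ⟨H, hH, hHU⟩ := τ.exists_cocycle_sub_mem T (n := n) U (fun u v w => by
    simp only [U]
    rw [← Finset.sum_add_distrib]
    refine Finset.sum_congr rfl fun A _ => ?_
    rw [← smul_add, ← map_add]
    congr 2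
    funext x
    exact hG.add u v w x) (fun s v w => by
    have h1 : (fun x => U (s • v) (s • w) (τ.tw s x)) - U v w =
        ∑ A : {A : Finset (ZMod p) // A.card = n},
        κ A • (fewVars.freeze A.1 (τ.tw s⁻¹ z) (G v w) - fewVars.freeze A.1 z (G v w)) := by
      funext x
      simp only [U, Pi.sub_apply, Finset.sum_apply, Pi.smul_apply, smul_sub, Finset.sum_sub_distrib]
      congr 1
      refine Finset.sum_congr rfl fun A _ => ?_
      rw [fewVars.freeze_apply, fewVars.freeze_apply, ← hG.inv s v w]
      congr 2
      funext i
      by_cases hi : i ∈ A.1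
      · simp [CyclicTwist.tw, hi]
      · simp [CyclicTwist.tw, hi]
    rw [h1]
    exact Submodule.sum_mem _ fun A _ => Submodule.smul_mem _ _
      (fewVars.freeze_sub_freeze_mem (hGn v w) A.2 _ _))
  refine ⟨H, hH, fun v w => ?_⟩
  have h1 := CyclicTwist.norm_sub_norm_mem (τ := τ) hHU v w
  have h2 : τ.norm U v w = ∑ A ∈ Finset.powersetCard n Finset.univ,
      fewVars.freeze A z (G v w) := by
    have hsub : ∑ A ∈ Finset.powersetCard n Finset.univ, fewVars.freeze A z (G v w) =
        ∑ A : {A : Finset (ZMod p) // A.card = n}, fewVars.freeze A.1 z (G v w) :=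
      Finset.sum_subtype _ (by simp) _
    rw [hsub]
    funext x
    rw [CyclicTwist.norm_apply]
    have h3 : ∀ k, U (τ.f^[k] v) (τ.f^[k] w) (CyclicTwist.shift^[k] x) =
        ∑ A : {A : Finset (ZMod p) // A.card = n}, κ ((translateSubset p n)^[k] A) *
          fewVars.freeze A.1 z (G v w) x := by
      intro k
      simp only [U, Finset.sum_apply, Pi.smul_apply, smul_eq_mul]
      have hbij : Function.Bijective ((translateSubset p n)^[k]) := by
        have h4 : Function.Bijective (translateSubset p n) := by
          refine Function.bijective_iff_has_inverse.mpr ⟨(translateSubset p n)^[p - 1],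
            fun A => ?_, fun A => ?_⟩
          · rw [← Function.iterate_succ_apply, Nat.succ_eq_add_one,
              Nat.sub_add_cancel hp.out.one_le, hqit]
          · rw [← Function.iterate_succ_apply' (translateSubset p n), Nat.succ_eq_add_one,
              Nat.sub_add_cancel hp.out.one_le, hqit]
        exact h4.iterate k
      rw [← hbij.sum_comp]
      refine Finset.sum_congr rfl fun A _ => ?_
      rw [fewVars.freeze_apply, fewVars.freeze_apply, ← hGit k v w]
      congr 2
      funext i
      rw [CyclicTwist.shift_iterate]
      by_cases hi : i + k ∈ A.1
      · rw [Finset.piecewise_eq_of_mem _ _ _ ((mem_translateSubset_iterate k A i).mpr hi),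
          Finset.piecewise_eq_of_mem _ _ _ hi, CyclicTwist.shift_iterate]
      · rw [Finset.piecewise_eq_of_notMem _ _ _
            (fun h => hi ((mem_translateSubset_iterate k A i).mp h)),
          Finset.piecewise_eq_of_notMem _ _ _ hi]
    simp only [h3]
    rw [Finset.sum_comm]
    simp only [← Finset.sum_mul, hκ, one_mul, Finset.sum_apply]
  have h3 := fewVars.sub_sum_freeze_mem (hGn v w) z
  rw [← h2] at h3
  have h4 := Submodule.sub_mem _ h3 h1
  rwa [sub_sub_sub_cancel_right] at h4

end Reduction

section MultiExt

variable {F ι α β : Type*} [Field F] [Fintype ι]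

theorem multiExt_mapDomain (η : (ι → β) → F) (a : ι → α → β) (c : ι → α →₀ F) :
    multiExt η (fun i => (c i).mapDomain (a i)) = multiExt (fun ε => η fun i => a i (ε i)) c := by
  have : (multiExt η).compLinearMap (fun i => Finsupp.lmapDomain F F (a i)) =
      multiExt fun ε => η fun i => a i (ε i) := by
    refine MultilinearMap.ext_single fun ε => ?_
    rw [multiExt_single, MultilinearMap.compLinearMap_apply]
    simp only [Finsupp.lmapDomain_apply, Finsupp.mapDomain_single]
    exact multiExt_single _ _
  exact DFunLike.congr_fun this c

theorem multiExt_reindex (η : (ι → α) → F) (e : Equiv.Perm ι) (c : ι → α →₀ F) :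
    multiExt η (fun i => c (e i)) = multiExt (fun ε => η fun i => ε (e i)) c := by
  have : (multiExt η).domDomCongr e = multiExt fun ε => η fun i => ε (e i) := by
    refine MultilinearMap.ext_single fun ε => ?_
    rw [multiExt_single, MultilinearMap.domDomCongr_apply]
    exact multiExt_single _ _
  exact DFunLike.congr_fun this c

theorem multiExt_sub (η η' : (ι → α) → F) (c : ι → α →₀ F) :
    multiExt (fun ε => η ε - η' ε) c = multiExt η c - multiExt η' c := by
  have : multiExt (fun ε => η ε - η' ε) = multiExt η - multiExt η' := by
    refine MultilinearMap.ext_single fun ε => ?_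
    simp [multiExt_single]
  rw [this, _root_.sub_apply]

theorem multiExt_sum {κ : Type*} (s : Finset κ) (η : κ → (ι → α) → F) (c : ι → α →₀ F) :
    multiExt (fun ε => ∑ n ∈ s, η n ε) c = ∑ n ∈ s, multiExt (η n) c := by
  have : multiExt (fun ε => ∑ n ∈ s, η n ε) = ∑ n ∈ s, multiExt (η n) := by
    refine MultilinearMap.ext_single fun ε => ?_
    simp [multiExt_single]
  rw [this, _root_.sum_apply]

end MultiExt

namespace EdgeTree

variable {S V E : Type*} [Group S] [MulAction S V] [MulAction S E] (T : EdgeTree S V E)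

/-- The endpoints of an edge. -/
def endpt (e : E) (b : Bool) : V := cond b (T.tgt e) (T.src e)

theorem endpt_smul (s : S) (e : E) (b : Bool) : T.endpt (s • e) b = s • T.endpt e b := by
  cases b
  · exact T.src_smul s e
  · exact T.tgt_smul s e

/-- The geodesic between two vertices as a chain with coefficients in a field. -/
noncomputable def geodF (F : Type*) [Field F] (v w : V) : E →₀ F :=
  (T.geod v w).mapRange (Int.cast : ℤ → F) Int.cast_zero

variable (F : Type*) [Field F]

theorem geodF_apply (v w : V) (e : E) : T.geodF F v w e = (T.geod v w e : F) := rfl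

theorem geodF_add (u v w : V) : T.geodF F u v + T.geodF F v w = T.geodF F u w := by
  ext e
  rw [Finsupp.add_apply, geodF_apply, geodF_apply, geodF_apply, ← T.geod_add_apply u v w]
  push_cast
  rfl

theorem geodF_edge (e : E) : T.geodF F (T.src e) (T.tgt e) = Finsupp.single e 1 := by
  rw [geodF, T.geod_edge, Finsupp.mapRange_single, Int.cast_one]

theorem geodF_smul (s : S) (v w : V) :
    T.geodF F (s • v) (s • w) = (T.geodF F v w).mapDomain (s • ·) := by
  ext e
  rw [geodF_apply, T.geod_smul_apply, ← geodF_apply]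
  conv_rhs => rw [← smul_inv_smul s e]
  exact (Finsupp.mapDomain_apply (MulAction.injective s) _ _).symm

/-- The boundary of a chain of edges. -/
noncomputable def bdry : (E →₀ F) →ₗ[F] (V →₀ F) :=
  Finsupp.linearCombination F fun e => Finsupp.single (T.tgt e) 1 - Finsupp.single (T.src e) 1

theorem bdry_geodF (v w : V) :
    T.bdry F (T.geodF F v w) = Finsupp.single w 1 - Finsupp.single v 1 := by
  refine T.eq_of_add (G := fun v w => T.bdry F (T.geodF F v w))
    (G' := fun v w => Finsupp.single w 1 - Finsupp.single v 1) ?_ ?_ ?_ v w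
  · intro u v w
    rw [← map_add, geodF_add]
  · intro u v w
    abel
  · intro e
    simp only [geodF_edge, bdry]
    simp

variable {F} {ι : Type*} [Fintype ι] [DecidableEq ι]

/-- The alternating sum of a function over the corners of a product of edges. -/
noncomputable def corners (u : (ι → V) → F) (ε : ι → E) : F :=
  ∑ b : ι → Bool, (∏ i, (cond (b i) 1 (-1) : F)) * u fun i => T.endpt (ε i) (b i)

theorem multiExt_corners (u : (ι → V) → F) (c : ι → E →₀ F) :
    multiExt (T.corners u) c = multiExt u fun i => T.bdry F (c i) := by
  have : multiExt (T.corners u) = (multiExt u).compLinearMap fun _ => T.bdry F := by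
    refine MultilinearMap.ext_single fun ε => ?_
    rw [multiExt_single, MultilinearMap.compLinearMap_apply]
    have h1 : ∀ i, T.bdry F (Finsupp.single (ε i) 1) =
        ∑ b : Bool, (cond b 1 (-1) : F) • Finsupp.single (T.endpt (ε i) b) (1 : F) := by
      intro i
      simp [bdry, endpt, sub_eq_add_neg]
    simp only [h1]
    rw [MultilinearMap.map_sum]
    refine Finset.sum_congr rfl fun b _ => ?_
    rw [MultilinearMap.map_smul_univ, multiExt_single, smul_eq_mul]
  rw [this, MultilinearMap.compLinearMap_apply]

theorem multiExt_corners_geodF_sub_mem (u : (ι → V) → F) (v₀ : V) :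
    (fun x => multiExt (T.corners u) fun i => T.geodF F v₀ (x i)) - u ∈
      fewVars F ι V (Fintype.card ι) := by
  have := (multiExt u).add_const_sub_mem (V := V) (fun _ y => Finsupp.single y 1)
    (fun _ => - Finsupp.single v₀ 1)
  simp only [multiExt_single, ← sub_eq_add_neg] at this
  simpa only [multiExt_corners, bdry_geodF] using this

end EdgeTree

section TopStep

open CyclicTwist

variable {p : ℕ} {S V E F : Type*} [Group S] [MulAction S V] [MulAction S E] [Field F]
  [hp : Fact p.Prime] (τ : CyclicTwist p S V) (T : EdgeTree S V E)

theorem CyclicTwist.shift_bijective (M : Type*) :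
    Function.Bijective (shift : (ZMod p → M) → ZMod p → M) := by
  refine Function.bijective_iff_has_inverse.mpr ⟨shift^[p - 1], fun A => ?_, fun A => ?_⟩
  · rw [← Function.iterate_succ_apply, Nat.succ_eq_add_one,
      Nat.sub_add_cancel hp.out.one_le, shift_iterate_self]
  · rw [← Function.iterate_succ_apply' shift, Nat.succ_eq_add_one,
      Nat.sub_add_cancel hp.out.one_le, shift_iterate_self]

theorem EdgeTree.corners_tw (lam : V → (ZMod p → V) → F)
    (hinv : ∀ (s : S) v x, lam (s • v) (τ.tw s x) = lam v x) (s : S) (v : V) (ε : ZMod p → E) :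
    T.corners (lam (s • v)) (τ.tw s ε) = T.corners (lam v) ε := by
  refine Finset.sum_congr rfl fun b _ => ?_
  rw [← hinv s v]
  congr 2
  funext i
  exact T.endpt_smul _ _ _

theorem EdgeTree.corners_shift (f : V → V) (lam : V → (ZMod p → V) → F)
    (hf : ∀ v x, lam (f v) (shift x) = lam v x) (v : V) (ε : ZMod p → E) :
    T.corners (lam (f v)) (shift ε) = T.corners (lam v) ε := by
  rw [corners, ← (CyclicTwist.shift_bijective (p := p) Bool).sum_comp]
  refine Finset.sum_congr rfl fun b _ => ?_
  rw [← hf v]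
  congr 1
  exact Equiv.prod_comp (Equiv.addRight (1 : ZMod p)) fun i => (cond (b i) 1 (-1) : F)

/-- An invariant function on pairs of a vertex and a family of edges that depends only on the
family at the points with a nontrivial symmetry is a norm up to a function of the family. -/
theorem CyclicTwist.exists_norm_eq (hfree : ∀ (s : S) (e : E), s • e = e → s = 1)
    (μ : V → (ZMod p → E) → F) (hinv : ∀ (s : S) v ε, μ (s • v) (τ.tw s ε) = μ v ε)
    (hshift : ∀ v ε, μ (τ.f v) (shift ε) = μ v ε)
    (hfix : ∀ (s : S) v v' ε, s • τ.f v = v → s • τ.f v' = v' → τ.tw s (shift ε) = ε →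
      μ v ε = μ v' ε) :
    ∃ (κ : V → (ZMod p → E) → F) (μ₀ : (ZMod p → E) → F),
      (∀ (s : S) v ε, κ (s • v) (τ.tw s ε) = κ v ε) ∧
      ∀ v ε, ∑ n ∈ Finset.range p, κ (τ.f^[n] v) (shift^[n] ε) = μ v ε - μ₀ ε := by
  classical
  let good : (ZMod p → E) → V → Prop := fun ε v => ∃ s : S, s • τ.f v = v ∧ τ.tw s (shift ε) = ε
  have hgood : ∀ ε v v', good ε v → good ε v' → μ v ε = μ v' ε := by
    rintro ε v v' ⟨s, h1, h2⟩ ⟨s', h1', h2'⟩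
    have hs : s = s' := by
      have h3 := (congrFun h2 0).trans (congrFun h2' 0).symm
      simp only [tw, τ.sg_zero] at h3
      have := hfree (s'⁻¹ * s) (shift ε 0) (by rw [mul_smul, h3, inv_smul_smul])
      exact (inv_mul_eq_one.mp this).symm
    subst hs
    exact hfix s v v' ε h1 h1' h2
  have good_smul : ∀ (t : S) ε v, good ε v → good (τ.tw t ε) (t • v) := by
    rintro t ε v ⟨s, h1, h2⟩
    refine ⟨t * s * (τ.σ t)⁻¹, ?_, ?_⟩
    · rw [τ.f_smul, mul_smul, inv_smul_smul, mul_smul, h1]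
    · rw [shift_tw, tw_mul, tw_inv_tw, tw_mul, h2]
  have good_shift : ∀ ε v, good ε v → good (shift ε) (τ.f v) := by
    rintro ε v ⟨s, h1, h2⟩
    refine ⟨τ.σ s, ?_, ?_⟩
    · rw [← τ.f_smul, h1]
    · rw [← shift_tw, h2]
  have good_shift_iterate : ∀ n ε v, good ε v → good (shift^[n] ε) (τ.f^[n] v) := by
    intro n ε v h
    induction n with
    | zero => exact h
    | succ n ih =>
      rw [Function.iterate_succ_apply', Function.iterate_succ_apply']
      exact good_shift _ _ ih
  let μ₀ : (ZMod p → E) → F := fun ε => if h : ∃ v, good ε v then μ h.choose ε else 0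
  have hμ₀ : ∀ ε v, good ε v → μ₀ ε = μ v ε := by
    intro ε v h
    have h' : ∃ v, good ε v := ⟨v, h⟩
    simp only [μ₀, dif_pos h']
    exact hgood _ _ _ h'.choose_spec h
  have hμ₀' : ∀ ε, (¬ ∃ v, good ε v) → μ₀ ε = 0 := fun ε h => dif_neg h
  have hμ₀s : ∀ (t : S) ε, μ₀ (τ.tw t ε) = μ₀ ε := by
    intro t ε
    by_cases h : ∃ v, good ε v
    · obtain ⟨v, hv⟩ := h
      rw [hμ₀ ε v hv, hμ₀ _ _ (good_smul t ε v hv), hinv]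
    · rw [hμ₀' ε h, hμ₀']
      rintro ⟨v, hv⟩
      refine h ⟨t⁻¹ • v, ?_⟩
      have := good_smul t⁻¹ _ _ hv
      rwa [tw_inv_tw] at this
  have hμ₀f : ∀ ε, μ₀ (shift ε) = μ₀ ε := by
    intro ε
    by_cases h : ∃ v, good ε v
    · obtain ⟨v, hv⟩ := h
      rw [hμ₀ ε v hv, hμ₀ _ _ (good_shift ε v hv), hshift]
    · rw [hμ₀' ε h, hμ₀']
      rintro ⟨v, hv⟩
      refine h ⟨τ.f^[p - 1] v, ?_⟩
      have := good_shift_iterate (p - 1) _ _ hv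
      rwa [← Function.iterate_succ_apply, Nat.succ_eq_add_one,
        Nat.sub_add_cancel hp.out.one_le, shift_iterate_self] at this
  let st : Setoid (V × (ZMod p → E)) :=
    { r := fun a b => ∃ s : S, s • a.1 = b.1 ∧ τ.tw s a.2 = b.2
      iseqv :=
        { refl := fun a => ⟨1, one_smul _ _, τ.tw_one _⟩
          symm := by
            rintro a b ⟨s, h1, h2⟩
            exact ⟨s⁻¹, by rw [← h1, inv_smul_smul], by rw [← h2, tw_inv_tw]⟩
          trans := by
            rintro a b c ⟨s, h1, h2⟩ ⟨t, h3, h4⟩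
            exact ⟨t * s, by rw [mul_smul, h1, h3], by rw [tw_mul, h2, h4]⟩ } }
  let q : Quotient st → Quotient st := Quotient.map (fun a => (τ.f a.1, shift a.2)) (by
    rintro a b ⟨s, h1, h2⟩
    exact ⟨τ.σ s, by rw [← τ.f_smul, h1], by rw [← shift_tw, h2]⟩)
  have hq : ∀ n v ε, q^[n] (Quotient.mk st (v, ε)) = Quotient.mk st (τ.f^[n] v, shift^[n] ε) := by
    intro n v ε
    induction n with
    | zero => rfl
    | succ n ih =>
      rw [Function.iterate_succ_apply', ih, Function.iterate_succ_apply' τ.f,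
        Function.iterate_succ_apply' shift]
      rfl
  let u : Quotient st → F := Quotient.lift (fun a => μ a.1 a.2 - μ₀ a.2) (by
    rintro a b ⟨s, h1, h2⟩
    rw [← h1, ← h2, hinv, hμ₀s])
  obtain ⟨κ, hκ⟩ := exists_sum_iterate_eq hp.out q (by
      intro o
      induction o using Quotient.inductionOn with
      | h a =>
        rw [hq, τ.f_iterate, shift_iterate_self]) u (by
      intro o
      induction o using Quotient.inductionOn with
      | h a =>
        change μ (τ.f a.1) (shift a.2) - μ₀ (shift a.2) = μ a.1 a.2 - μ₀ a.2
        rw [hshift, hμ₀f]) (by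
      intro o ho
      induction o using Quotient.inductionOn with
      | h a =>
        obtain ⟨s, h1, h2⟩ := Quotient.exact ho
        change μ a.1 a.2 - μ₀ a.2 = 0
        rw [hμ₀ a.2 a.1 ⟨s, h1, h2⟩, sub_self])
  refine ⟨fun v ε => κ (Quotient.mk st (v, ε)), μ₀, fun s v ε => ?_, fun v ε => ?_⟩
  · refine congrArg κ ?_
    have h : st.r (v, ε) (s • v, τ.tw s ε) := ⟨s, rfl, rfl⟩
    exact (Quotient.sound h).symm
  · have := hκ (Quotient.mk st (v, ε))
    simp only [hq] at this
    exact this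

theorem CyclicTwist.exists_norm_sub_mem (v₀ : V) (lam : V → (ZMod p → V) → F)
    (hinv : ∀ (s : S) v x, lam (s • v) (τ.tw s x) = lam v x)
    (hshift : ∀ v x, lam (τ.f v) (shift x) = lam v x)
    (hfix : ∀ (s : S) v v' (ε : ZMod p → E), s • τ.f v = v → s • τ.f v' = v' →
      τ.tw s (shift ε) = ε → T.corners (lam v) ε = T.corners (lam v') ε) :
    ∃ H, τ.IsCocycle H ∧ ∀ v w, lam w - lam v - τ.norm H v w ∈ fewVars F (ZMod p) V p := by
  classical
  obtain ⟨κ, μ₀, hκ, hsum⟩ := τ.exists_norm_eq T.free (fun v => T.corners (lam v))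
    (T.corners_tw τ lam hinv) (T.corners_shift τ.f lam hshift) hfix
  let K : V → (ZMod p → V) → F := fun v x => multiExt (κ v) fun i => T.geodF F v₀ (x i)
  have hcard : Fintype.card (ZMod p) = p := ZMod.card p
  have hK : ∀ (s : S) v, (fun x => K (s • v) (τ.tw s x)) - K v ∈ fewVars F (ZMod p) V p := by
    intro s v
    have h1 := (multiExt (κ v)).add_const_sub_mem (V := V) (fun _ y => T.geodF F v₀ y)
      (fun i => T.geodF F ((τ.sg i s)⁻¹ • v₀) v₀)
    rw [hcard] at h1
    convert h1 using 2
    funext x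
    have h2 : ∀ i, T.geodF F v₀ (τ.tw s x i) =
        (T.geodF F v₀ (x i) + T.geodF F ((τ.sg i s)⁻¹ • v₀) v₀).mapDomain (τ.sg i s • ·) := by
      intro i
      rw [add_comm, T.geodF_add, ← T.geodF_smul, smul_inv_smul]
      rfl
    simp only [K, h2]
    rw [multiExt_mapDomain]
    congr 1
    congr 1
    funext ε
    exact hκ s v ε
  obtain ⟨H, hH, hHU⟩ := τ.exists_cocycle_sub_mem T (n := p) (fun v w => K w - K v)
    (fun u v w => by abel) (fun s v w => by
      have := Submodule.sub_mem _ (hK s w) (hK s v)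
      convert this using 1
      funext x
      simp only [Pi.sub_apply]
      ring)
  refine ⟨H, hH, fun v w => ?_⟩
  have h1 := CyclicTwist.norm_sub_norm_mem (τ := τ) hHU v w
  have h2 : ∀ v x, ∑ n ∈ Finset.range p, K (τ.f^[n] v) (shift^[n] x) =
      multiExt (T.corners (lam v)) (fun i => T.geodF F v₀ (x i)) -
        multiExt μ₀ fun i => T.geodF F v₀ (x i) := by
    intro v x
    have h3 : (fun ε => T.corners (lam v) ε - μ₀ ε) = fun ε =>
        ∑ n ∈ Finset.range p, κ (τ.f^[n] v) (shift^[n] ε) := funext fun ε => (hsum v ε).symm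
    rw [← multiExt_sub, h3, multiExt_sum]
    refine Finset.sum_congr rfl fun n _ => ?_
    simp only [K, shift_iterate]
    refine (multiExt_reindex _ (Equiv.addRight (n : ZMod p)) (fun i => T.geodF F v₀ (x i))).trans ?_
    congr 2
    funext ε
    congr 1
    funext i
    exact (shift_iterate n ε i).symm
  have h3 := Submodule.sub_mem _ (T.multiExt_corners_geodF_sub_mem (lam w) v₀)
    (T.multiExt_corners_geodF_sub_mem (lam v) v₀)
  rw [hcard] at h3
  have h4 := Submodule.neg_mem _ (Submodule.add_mem _ h1 h3)
  convert h4 using 1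
  funext x
  simp only [Pi.sub_apply, Pi.neg_apply, Pi.add_apply, norm_apply, Finset.sum_sub_distrib, h2]
  ring

/-- The invariant cocycle attached to an invariant function is a norm, up to a cocycle that does
not depend on the parameters. -/
theorem CyclicTwist.exists_norm_sub_const (v₀ : V) (lam : V → (ZMod p → V) → F)
    (hinv : ∀ (s : S) v x, lam (s • v) (τ.tw s x) = lam v x)
    (hshift : ∀ v x, lam (τ.f v) (shift x) = lam v x)
    (hfix : ∀ (s : S) v v' (ε : ZMod p → E), s • τ.f v = v → s • τ.f v' = v' →
      τ.tw s (shift ε) = ε → T.corners (lam v) ε = T.corners (lam v') ε) :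
    ∃ (H : V → V → (ZMod p → V) → F) (ψ : V → V → F), τ.IsCocycle H ∧
      (∀ u v w, ψ u v + ψ v w = ψ u w) ∧ (∀ (s : S) v w, ψ (s • v) (s • w) = ψ v w) ∧
      ∀ v w x, lam w x - lam v x = τ.norm H v w x + ψ v w := by
  let G : V → V → (ZMod p → V) → F := fun v w => lam w - lam v
  have hG : τ.IsCocycle G := ⟨fun u v w x => by simp only [G, Pi.sub_apply]; ring,
    fun s v w x => by simp only [G, Pi.sub_apply, hinv]⟩
  have key : ∀ j, j < p → ∃ H, τ.IsCocycle H ∧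
      ∀ v w, G v w - τ.norm H v w ∈ fewVars F (ZMod p) V (p - j) := by
    intro j
    induction j with
    | zero => exact fun _ => τ.exists_norm_sub_mem T v₀ lam hinv hshift hfix
    | succ j ih =>
      intro hj
      obtain ⟨H, hH, hHm⟩ := ih (by lia)
      have hpj : p - j = (p - (j + 1)) + 1 := by lia
      rw [hpj] at hHm
      obtain ⟨H', hH', hHm'⟩ := τ.exists_norm_reduction_step T v₀ (n := p - (j + 1)) (by lia)
        (by lia) (G - τ.norm H) (hG.sub hH.norm) (fun v w x => by
          simp only [Pi.sub_apply, norm_shift, G, hshift]) hHm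
      refine ⟨H + H', hH.add' hH', fun v w => ?_⟩
      have := hHm' v w
      rwa [Pi.sub_apply, Pi.sub_apply, sub_sub, ← Pi.add_apply, ← Pi.add_apply, ← norm_add]
        at this
  obtain ⟨H, hH, hHm⟩ := key (p - 1) (Nat.sub_lt hp.out.pos one_pos)
  rw [Nat.sub_sub_self hp.out.one_le] at hHm
  have hC : τ.IsCocycle (G - τ.norm H) := hG.sub hH.norm
  refine ⟨H, fun v w => (G - τ.norm H) v w fun _ => v₀, hH, fun u v w => hC.add _ _ _ _,
    fun s v w => ?_, fun v w x => ?_⟩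
  · change (G - τ.norm H) (s • v) (s • w) (fun _ => v₀) = (G - τ.norm H) v w fun _ => v₀
    rw [← hC.inv s v w]
    exact fewVars.apply_eq (hHm (s • v) (s • w)) _ _
  · have := fewVars.apply_eq (hHm v w) x (fun _ => v₀)
    change _ = τ.norm H v w x + (G v w - τ.norm H v w) (fun _ => v₀)
    rw [← this]
    simp [G]

end TopStep

section ChainSum

variable {E : Type*} (F : Type*) [Ring F]

open scoped Classical in
/-- The sum of the coefficients of a chain over a set of edges. -/
noncomputable def chainSum (O : Set E) : (E →₀ ℤ) →+ F :=
  Finsupp.liftAddHom fun e => if e ∈ O then Int.castAddHom F else 0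

open scoped Classical in
theorem chainSum_single (O : Set E) (e : E) :
    chainSum F O (Finsupp.single e 1) = if e ∈ O then 1 else 0 := by
  rw [chainSum, Finsupp.liftAddHom_apply_single]
  split_ifs <;> simp

theorem chainSum_eq_zero {O : Set E} {c : E →₀ ℤ} (h : ∀ e ∈ O, c e = 0) : chainSum F O c = 0 := by
  rw [chainSum, Finsupp.liftAddHom_apply]
  refine Finset.sum_eq_zero fun e _ => ?_
  by_cases he : e ∈ O
  · simp [h e he]
  · simp [he]

end ChainSum

namespace EdgeTree

variable {S V E : Type*} [Group S] [MulAction S V] [MulAction S E] (T : EdgeTree S V E)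

theorem chainSum_geod_add (F : Type*) [Ring F] (O : Set E) (u v w : V) :
    chainSum F O (T.geod u v) + chainSum F O (T.geod v w) = chainSum F O (T.geod u w) := by
  rw [← map_add, T.geod_add]

theorem chainSum_geod_smul (F : Type*) [Ring F] (O : Set E) (s : S)
    (hO : ∀ e, s • e ∈ O ↔ e ∈ O) (v w : V) :
    chainSum F O (T.geod (s • v) (s • w)) = chainSum F O (T.geod v w) := by
  classical
  refine T.eq_of_add (G := fun v w => chainSum F O (T.geod (s • v) (s • w)))
    (G' := fun v w => chainSum F O (T.geod v w)) (fun _ _ _ => T.chainSum_geod_add F O _ _ _)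
    (fun _ _ _ => T.chainSum_geod_add F O _ _ _) (fun e => ?_) v w
  simp only [← T.src_smul, ← T.tgt_smul, geod_edge, chainSum_single, hO]

theorem smul_endpt_ne (s : S) {u : V} (hu : s • u = u) (e : E) (b : Bool) :
    s • T.endpt e b ≠ T.endpt e (!b) := by
  intro h
  have h1 := T.chainSum_geod_smul ℤ Set.univ s (by simp) u (T.endpt e b)
  rw [hu, h] at h1
  have h2 := T.chainSum_geod_add ℤ Set.univ u (T.src e) (T.tgt e)
  rw [T.geod_edge, chainSum_single, if_pos (Set.mem_univ e)] at h2
  cases b <;> simp only [endpt, Bool.not_true, Bool.not_false, cond_true, cond_false] at h1 <;> lia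

end EdgeTree

namespace CyclicTwist

variable {p : ℕ} {S V E : Type*} [Group S] [MulAction S V] [MulAction S E]
  (τ : CyclicTwist p S V) (T : EdgeTree S V E)

theorem eq_of_sg_smul_eq {s : S} {u v : V} (h : τ.tw s (fun _ => u) = fun _ => v) :
    s • u = v ∧ τ.σ s • u = v := by
  refine ⟨?_, ?_⟩
  · have := congrFun h 0
    rwa [tw, τ.sg_zero] at this
  · have := congrFun h (0 + 1)
    rwa [tw, τ.sg_succ, τ.sg_zero] at this

/-- `Straight v x s w` says that `s` moves `v` to a fixed point of `f` and `x` to the constant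
family at `w`. -/
def Straight (v : V) (x : ZMod p → V) (s : S) (w : V) : Prop :=
  τ.f (s • v) = s • v ∧ τ.tw s x = fun _ => w

variable {τ}

theorem Straight.smul {v : V} {x : ZMod p → V} {s : S} {w : V} (h : τ.Straight v x s w) (t : S) :
    τ.Straight (t • v) (τ.tw t x) (s * t⁻¹) w := by
  refine ⟨?_, ?_⟩
  · rw [mul_smul, inv_smul_smul, h.1]
  · rw [tw_mul, tw_inv_tw, h.2]

theorem Straight.shift {v : V} {x : ZMod p → V} {s : S} {w : V} (h : τ.Straight v x s w) :
    τ.Straight (τ.f v) (shift x) (τ.σ s) w := by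
  refine ⟨?_, ?_⟩
  · rw [← τ.f_smul, h.1, h.1]
  · rw [← shift_tw, h.2]
    rfl

variable {F : Type*} [Field F]

theorem Straight.unique (T : EdgeTree S V E) {N : V → V → F}
    (hN : ∀ u v w, N u v + N v w = N u w)
    (hN' : ∀ s v w, τ.σ s = s → N (s • v) (s • w) = N v w) {v : V} {x : ZMod p → V} {s s' : S}
    {w w' : V} (h : τ.Straight v x s w) (h' : τ.Straight v x s' w') :
    N w (s • v) = N w' (s' • v) := by
  have hNs : ∀ u, N u u = 0 := fun u => by simpa using hN u u u
  have h1 : τ.tw (s' * s⁻¹) (fun _ => w) = fun _ => w' := by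
    rw [← h.2, tw_mul, tw_inv_tw, h'.2]
  obtain ⟨h2, h3⟩ := τ.eq_of_sg_smul_eq h1
  have h4 : (s' * s⁻¹) • s • v = s' • v := by rw [mul_smul, inv_smul_smul]
  have h5 : τ.σ (s' * s⁻¹) • s • v = s' • v := by
    rw [← h.1, ← τ.f_smul, h4, h'.1]
  generalize s' * s⁻¹ = t at *
  by_cases ht : τ.σ t = t
  · rw [← hN' t w (s • v) ht, h2, h4]
  · have hw : w = s • v := by
      by_contra hne
      refine ht ?_
      have := T.eq_one_of_smul_eq (g := t⁻¹ * τ.σ t) hne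
        (by rw [mul_smul, h3, ← h2, inv_smul_smul])
        (by rw [mul_smul, h5, ← h4, inv_smul_smul])
      exact (inv_mul_eq_one.mp this).symm
    rw [← h2, ← h4, hw, hNs, hNs]

variable (τ) [hp : Fact p.Prime]

theorem eq_const_of_forall_succ {M : Type*} {b : ZMod p → M} (h : ∀ i, b i = b (i + 1)) :
    b = fun _ => b 0 := by
  funext i
  have : ∀ n : ℕ, b (n : ZMod p) = b 0 := by
    intro n
    induction n with
    | zero => simp
    | succ n ih => rw [Nat.cast_succ, ← h, ih]
  rw [← ZMod.natCast_zmod_val i, this]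

/-- If two corners of a product of edges with a symmetry can be straightened, a discrepancy
between the straightening and the symmetry is a group element with prescribed behaviour. -/
theorem Straight.sg_smul_endpt {s : S} {v : V} {ε : ZMod p → E} (h1 : s • τ.f v = v)
    (h2 : τ.tw s (CyclicTwist.shift ε) = ε) {b : ZMod p → Bool} {t : S} {w : V}
    (h : τ.Straight v (fun i => T.endpt (ε i) (b i)) t w) :
    (t⁻¹ * τ.σ t * s⁻¹) • v = v ∧
      ∀ i, τ.sg i (t⁻¹ * τ.σ t * s⁻¹) • T.endpt (ε i) (b (i + 1)) = T.endpt (ε i) (b i) := by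
  refine ⟨?_, fun i => ?_⟩
  · conv_lhs => rw [← h1]
    rw [mul_smul, inv_smul_smul, mul_smul, ← τ.f_smul, h.1, inv_smul_smul]
  · have h3 : τ.sg i s⁻¹ • ε i = ε (i + 1) := by
      conv_lhs => rw [← h2]
      rw [map_inv]
      exact inv_smul_smul _ _
    have h4 : τ.sg i t • T.endpt (ε i) (b i) = w := congrFun h.2 i
    have h5 : τ.sg i (τ.σ t) • T.endpt (ε (i + 1)) (b (i + 1)) = w := by
      rw [← τ.sg_succ]
      exact congrFun h.2 (i + 1)
    rw [map_mul, map_mul, mul_smul, ← T.endpt_smul, h3, mul_smul, h5, ← h4, map_inv,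
      inv_smul_smul]

/-- An additive function on pairs of vertices that is invariant under the fixed subgroup gives
rise to an invariant function with good symmetry properties. -/
theorem exists_invariant_function {N : V → V → ZMod p} (hN : ∀ u v w, N u v + N v w = N u w)
    (hN' : ∀ s v w, τ.σ s = s → N (s • v) (s • w) = N v w) :
    ∃ lam : V → (ZMod p → V) → ZMod p,
      (∀ (s : S) v x, lam (s • v) (τ.tw s x) = lam v x) ∧
      (∀ v x, lam (τ.f v) (shift x) = lam v x) ∧
      (∀ (s : S) v v' (ε : ZMod p → E), s • τ.f v = v → s • τ.f v' = v' →
        τ.tw s (shift ε) = ε → T.corners (lam v) ε = T.corners (lam v') ε) ∧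
      ∀ v w, τ.f v = v → lam v (fun _ => w) = N w v := by
  classical
  have hNs : ∀ u, N u u = 0 := fun u => by simpa using hN u u u
  let lam : V → (ZMod p → V) → ZMod p := fun v x =>
    if h : ∃ s w, τ.Straight v x s w then N h.choose_spec.choose (h.choose • v) else 0
  have lam_eq : ∀ {v x s w}, τ.Straight v x s w → lam v x = N w (s • v) := by
    intro v x s w h
    have h' : ∃ s w, τ.Straight v x s w := ⟨s, w, h⟩
    simp only [lam, dif_pos h']
    exact h'.choose_spec.choose_spec.unique T hN hN' h
  have lam_zero : ∀ {v x}, (¬ ∃ s w, τ.Straight v x s w) → lam v x = 0 := fun h => dif_neg h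
  have straight_iterate : ∀ n {v x}, (∃ s w, τ.Straight v x s w) →
      ∃ s w, τ.Straight (τ.f^[n] v) (shift^[n] x) s w := by
    intro n v x h
    induction n with
    | zero => exact h
    | succ n ih =>
      obtain ⟨s, w, hs⟩ := ih
      rw [Function.iterate_succ_apply', Function.iterate_succ_apply']
      exact ⟨_, _, hs.shift⟩
  refine ⟨lam, fun t v x => ?_, fun v x => ?_, fun s v v' ε h1 h1' h2 => ?_, fun v w hv => ?_⟩
  · by_cases h : ∃ s w, τ.Straight v x s w
    · obtain ⟨s, w, hs⟩ := h
      rw [lam_eq hs, lam_eq (hs.smul t), mul_smul, inv_smul_smul]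
    · rw [lam_zero h, lam_zero]
      rintro ⟨s, w, hs⟩
      have := hs.smul t⁻¹
      rw [inv_smul_smul, tw_inv_tw] at this
      exact h ⟨_, _, this⟩
  · by_cases h : ∃ s w, τ.Straight v x s w
    · obtain ⟨s, w, hs⟩ := h
      rw [lam_eq hs, lam_eq hs.shift, ← τ.f_smul, hs.1]
    · rw [lam_zero h, lam_zero]
      intro h'
      refine h ?_
      have := straight_iterate (p - 1) h'
      rwa [← Function.iterate_succ_apply, ← Function.iterate_succ_apply, Nat.succ_eq_add_one,
        Nat.sub_add_cancel hp.out.one_le, shift_iterate_self, τ.f_iterate] at this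
  · have mixed : ∀ v, s • τ.f v = v → ∀ b : ZMod p → Bool, b ≠ (fun _ => true) →
        b ≠ (fun _ => false) → lam v (fun i => T.endpt (ε i) (b i)) = 0 := by
      intro v hv b hb1 hb2
      refine lam_zero ?_
      rintro ⟨t, w, ht⟩
      obtain ⟨h3, h4⟩ := Straight.sg_smul_endpt τ T hv h2 ht
      obtain ⟨i, hi⟩ : ∃ i, b i ≠ b (i + 1) := by
        by_contra! hcon
        have := eq_const_of_forall_succ hcon
        cases h0 : b 0
        · exact hb2 (by rw [this, h0])
        · exact hb1 (by rw [this, h0])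
      have h5 := T.smul_endpt_ne (τ.sg i (t⁻¹ * τ.σ t * s⁻¹)) (u := τ.fi i v)
        (by rw [← τ.fi_smul, h3]) (ε i) (b (i + 1))
      refine h5 ((h4 i).trans ?_)
      rw [Bool.eq_not_of_ne hi]
    have corners_eq : ∀ v, s • τ.f v = v → T.corners (lam v) ε =
        lam v (fun i => T.endpt (ε i) true) - lam v fun i => T.endpt (ε i) false := by
      intro v hv
      have hne : (fun _ : ZMod p => true) ≠ fun _ => false := fun h => by simpa using congrFun h 0
      rw [EdgeTree.corners, Finset.sum_eq_add (fun _ => true) (fun _ => false) hne]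
      · simp only [cond_true, cond_false, Finset.prod_const, one_pow, one_mul, Finset.card_univ,
          ZMod.card, ZMod.pow_card, neg_one_mul, sub_eq_add_neg]
      · rintro b - ⟨hb1, hb2⟩
        rw [mixed v hv b hb1 hb2, mul_zero]
      · simp
      · simp
    rw [corners_eq v h1, corners_eq v' h1']
    by_cases hs : ∃ t, τ.σ t = t * s
    · obtain ⟨t, ht⟩ := hs
      have h3 : τ.tw t ε = fun _ => τ.tw t ε 0 := by
        refine eq_const_of_forall_succ fun i => ?_
        change τ.sg i t • ε i = τ.sg (i + 1) t • ε (i + 1)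
        rw [τ.sg_succ, ht, map_mul, mul_smul]
        congr 1
        exact (congrFun h2 i).symm
      have h4 : ∀ v, s • τ.f v = v → ∀ b, τ.Straight v (fun i => T.endpt (ε i) b) t
          (T.endpt (τ.tw t ε 0) b) := by
        intro v hv b
        refine ⟨?_, ?_⟩
        · rw [τ.f_smul, ht, mul_smul, hv]
        · funext i
          change τ.sg i t • T.endpt (ε i) b = _
          rw [← T.endpt_smul]
          congr 1
          exact congrFun h3 i
      rw [lam_eq (h4 v h1 true), lam_eq (h4 v h1 false), lam_eq (h4 v' h1' true),
        lam_eq (h4 v' h1' false), ← hN (T.endpt (τ.tw t ε 0) true) (T.endpt (τ.tw t ε 0) false),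
        ← hN (T.endpt (τ.tw t ε 0) true) (T.endpt (τ.tw t ε 0) false) (t • v')]
      ring
    · have h3 : ∀ v, s • τ.f v = v → ∀ b, lam v (fun i => T.endpt (ε i) b) = 0 := by
        intro v hv b
        by_cases h : ∃ t w, τ.Straight v (fun i => T.endpt (ε i) b) t w
        · obtain ⟨t, w, ht⟩ := h
          obtain ⟨h4, h5⟩ := Straight.sg_smul_endpt τ T (b := fun _ => b) hv h2 ht
          have h6 := h5 0
          rw [τ.sg_zero] at h6
          have h7 : v = T.endpt (ε 0) b := by
            by_contra hne
            have := T.eq_one_of_smul_eq hne h4 h6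
            refine hs ⟨t, ?_⟩
            rw [mul_inv_eq_one] at this
            rw [← this, mul_inv_cancel_left]
          have h8 := congrFun ht.2 0
          simp only [tw, τ.sg_zero] at h8
          rw [lam_eq ht, ← h8, ← h7, hNs]
        · exact lam_zero h
      rw [h3 v h1, h3 v h1, h3 v' h1', h3 v' h1']
  · have h : τ.Straight v (fun _ => w) 1 w := ⟨by rw [one_smul, hv], τ.tw_one _⟩
    rw [lam_eq h, one_smul]

end CyclicTwist

theorem TreeRetraction.orbitBound_of_twist {p : ℕ} [hp : Fact p.Prime] {S V E Q Y : Type*}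
    [Group S] [MulAction S V] [MulAction S E] [Group Q] [MulAction Q Y] {T : EdgeTree S V E}
    {k : ℕ} (hk : OrbitBound S E k) (τ : CyclicTwist p S V) {j : Q →* S} {i : Y → V}
    (hjr : ∀ s, s ∈ Set.range j ↔ τ.σ s = s) (hir : ∀ y, τ.f (i y) = i y)
    (R : TreeRetraction T j i) (v₀ : V) : OrbitBound Q R.Edge k := by
  classical
  intro m r hr
  obtain ⟨k', u, hk', hu1, hu2⟩ := hk.exists_reps
  refine le_trans ?_ hk'
  let orb : Fin k' → Set E := fun t => {e | ∃ g : S, g • u t = e}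
  have horb : ∀ t (s : S) e, s • e ∈ orb t ↔ e ∈ orb t := by
    intro t s e
    refine ⟨?_, ?_⟩
    · rintro ⟨g, hg⟩
      exact ⟨s⁻¹ * g, by rw [mul_smul, hg, inv_smul_smul]⟩
    · rintro ⟨g, hg⟩
      exact ⟨s * g, by rw [mul_smul, hg]⟩
  let β : Fin m → Fin k' → ZMod p := fun a t =>
    chainSum (ZMod p) (orb t) (T.geod (i (R.ret (T.src (r a).1))) (i (R.ret (T.tgt (r a).1))))
  have hβ : LinearIndependent (ZMod p) β := by
    rw [Fintype.linearIndependent_iff]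
    intro c hc a₀
    let O : Set E := {e | ∃ q : Q, j q • (r a₀).1 = e}
    have hO : ∀ s, τ.σ s = s → ∀ e, s • e ∈ O ↔ e ∈ O := by
      intro s hs e
      obtain ⟨q, rfl⟩ := (hjr s).mpr hs
      refine ⟨?_, ?_⟩
      · rintro ⟨q', h⟩
        exact ⟨q⁻¹ * q', by rw [map_mul, mul_smul, h, map_inv, inv_smul_smul]⟩
      · rintro ⟨q', h⟩
        exact ⟨q * q', by rw [map_mul, mul_smul, h]⟩
    have hOf : ∀ e ∈ O, e ∉ R.forest := by
      rintro e ⟨q, rfl⟩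
      rw [R.smul_mem]
      exact (r a₀).2
    let N : V → V → ZMod p := fun v w => chainSum (ZMod p) O (T.geod v w)
    have hNadd : ∀ u v w, N u v + N v w = N u w := fun u v w => T.chainSum_geod_add _ O u v w
    obtain ⟨lam, h1, h2, h3, h4⟩ := τ.exists_invariant_function T (N := N) hNadd
      (fun s v w hs => T.chainSum_geod_smul _ O s (hO s hs) v w)
    obtain ⟨H, ψ, -, hψ, hψ', hH⟩ := τ.exists_norm_sub_const T v₀ lam h1 h2 h3
    have hNret : ∀ x, N x (i (R.ret x)) = 0 := fun x =>
      chainSum_eq_zero _ fun e he => R.geod_ret x e (hOf e he)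
    have hN : ∀ a, N (i (R.ret (T.src (r a).1))) (i (R.ret (T.tgt (r a).1))) =
        if a = a₀ then 1 else 0 := by
      intro a
      have h5 := hNadd (T.src (r a).1) (i (R.ret (T.src (r a).1))) (i (R.ret (T.tgt (r a).1)))
      have h6 := hNadd (T.src (r a).1) (T.tgt (r a).1) (i (R.ret (T.tgt (r a).1)))
      rw [hNret, zero_add] at h5
      rw [hNret, add_zero] at h6
      rw [h5, ← h6]
      simp only [N, T.geod_edge, chainSum_single]
      refine if_congr ⟨?_, ?_⟩ rfl rfl
      · rintro ⟨q, hq⟩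
        exact (hr a₀ a q (Subtype.ext hq)).symm
      · rintro rfl
        exact ⟨1, by rw [map_one, one_smul]⟩
    have hψN : ∀ y y', ψ (i y) (i y') = N (i y) (i y') := by
      intro y y'
      have h5 := hH (i y) (i y') fun _ => v₀
      have hf : ∀ y n, τ.f^[n] (i y) = i y := fun y n => Function.iterate_fixed (hir y) n
      rw [h4 _ _ (hir y), h4 _ _ (hir y'), CyclicTwist.norm_apply] at h5
      simp only [hf, CyclicTwist.shift_iterate_const, Finset.sum_const, Finset.card_range,
        nsmul_eq_mul, CharP.cast_eq_zero, zero_mul, zero_add] at h5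
      rw [← h5, ← hNadd v₀ (i y) (i y'), add_sub_cancel_left]
    have hψorb : ∀ v w, ψ v w = ∑ t, chainSum (ZMod p) (orb t) (T.geod v w) *
        ψ (T.src (u t)) (T.tgt (u t)) := by
      refine T.eq_of_add hψ (fun v w x => ?_) (fun e => ?_)
      · rw [← Finset.sum_add_distrib]
        refine Finset.sum_congr rfl fun t _ => ?_
        rw [← add_mul, T.chainSum_geod_add]
      · obtain ⟨t, g, rfl⟩ := hu2 e
        rw [Finset.sum_eq_single t]
        · rw [T.geod_edge, chainSum_single, if_pos ⟨g, rfl⟩, one_mul, T.src_smul, T.tgt_smul, hψ']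
        · intro t' _ ht'
          rw [T.geod_edge, chainSum_single, if_neg, zero_mul]
          rw [horb]
          rintro ⟨g', hg'⟩
          exact ht' (hu1 _ _ g' hg')
        · simp
    have h5 : ∑ a, c a * ψ (i (R.ret (T.src (r a).1))) (i (R.ret (T.tgt (r a).1))) = 0 := by
      rw [Finset.sum_congr rfl fun a _ =>
        (congrArg (c a * ·) (hψorb _ _)).trans (Finset.mul_sum _ _ _), Finset.sum_comm]
      refine Finset.sum_eq_zero fun t _ => ?_
      have h6 := congrFun hc t
      simp only [Finset.sum_apply, Pi.smul_apply, smul_eq_mul, Pi.zero_apply, β] at h6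
      rw [← zero_mul (ψ (T.src (u t)) (T.tgt (u t))), ← h6, Finset.sum_mul]
      exact Finset.sum_congr rfl fun a _ => (mul_assoc _ _ _).symm
    simp only [hψN, hN, mul_ite, mul_one, mul_zero] at h5
    rwa [Finset.sum_ite_eq' Finset.univ a₀ c, if_pos (Finset.mem_univ _)] at h5
  have := hβ.fintype_card_le_finrank
  simpa using this

theorem MonoidHom.exists_lift_of_injective {Q H K : Type*} [Group Q] [Group H] [Group K]
    {j : Q →* H} (hj : Function.Injective j) (ψ : K →* H) (h : ∀ q, ψ q ∈ Set.range j) :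
    ∃ σ : K →* Q, ∀ q, j (σ q) = ψ q := by
  choose σ hσ using h
  exact ⟨{ toFun := σ
           map_one' := hj (by rw [hσ, map_one, map_one])
           map_mul' := fun a b => hj (by rw [hσ, map_mul, map_mul, hσ, hσ]) }, hσ⟩

/-- A realization of the fixed points of a map of groups and a compatible map of spaces. -/
structure FixedPair {H V : Type*} [Group H] [MulAction H V] (φ : H → H) (f : V → V)
    (Q Y : Type*) [Group Q] [MulAction Q Y] where
  j : Q →* H
  i : Y → V
  j_inj : Function.Injective j
  i_inj : Function.Injective i
  i_smul : ∀ (q : Q) y, i (q • y) = j q • i y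
  j_range : ∀ h, h ∈ Set.range j ↔ φ h = h
  i_range : ∀ v, v ∈ Set.range i ↔ f v = v

/-- There is a tree on which the group acts with a bounded number of orbits of edges. -/
def HasTree (k : ℕ) (Q Y : Type) [Group Q] [MulAction Q Y] : Prop :=
  ∃ (E : Type) (_ : MulAction Q E) (_ : EdgeTree Q Y E), OrbitBound Q E k

section Restrict

variable {H V Q Y : Type*} [Group H] [MulAction H V] [Group Q] [MulAction Q Y]

theorem exists_restrict {Q' Y' : Type*} [Group Q'] [MulAction Q' Y'] {j : Q' →* H}
    (hj : Function.Injective j) {i : Y' → V} (hi : Function.Injective i)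
    (hij : ∀ (q : Q') y, i (q • y) = j q • i y) (φ : H →* H) (f : V → V)
    (hf : ∀ (h : H) v, f (h • v) = φ h • f v) (h1 : ∀ q, φ (j q) ∈ Set.range j)
    (h2 : ∀ y, f (i y) ∈ Set.range i) :
    ∃ (σ : Q' →* Q') (g : Y' → Y'), (∀ q, j (σ q) = φ (j q)) ∧ (∀ y, i (g y) = f (i y)) ∧
      ∀ (q : Q') y, g (q • y) = σ q • g y := by
  obtain ⟨σ, hσ⟩ := MonoidHom.exists_lift_of_injective hj (φ.comp j) h1
  choose g hg using h2
  exact ⟨σ, g, hσ, hg, fun q y => hi (by rw [hg, hij, hf, hij, hσ, hg]; rfl)⟩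

theorem FixedPair.nonempty_restrict {φ : H → H} {f : V → V} (P : FixedPair φ f Q Y)
    {Q' Y' : Type*} [Group Q'] [MulAction Q' Y'] {j : Q' →* H}
    (hj : Function.Injective j) {i : Y' → V} (hi : Function.Injective i)
    (hij : ∀ (q : Q') y, i (q • y) = j q • i y) (h1 : ∀ h, φ h = h → h ∈ Set.range j)
    (h2 : ∀ v, f v = v → v ∈ Set.range i) (σ : Q' → Q') (g : Y' → Y')
    (hσ : ∀ q, j (σ q) = φ (j q)) (hg : ∀ y, i (g y) = f (i y)) :
    Nonempty (FixedPair σ g Q Y) := by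
  have hP1 : ∀ q, φ (P.j q) = P.j q := fun q => (P.j_range _).mp ⟨q, rfl⟩
  have hP2 : ∀ y, f (P.i y) = P.i y := fun y => (P.i_range _).mp ⟨y, rfl⟩
  obtain ⟨j', hj'⟩ := MonoidHom.exists_lift_of_injective hj P.j fun q => h1 _ (hP1 q)
  have h3 : ∀ y, P.i y ∈ Set.range i := fun y => h2 _ (hP2 y)
  choose i' hi' using h3
  refine ⟨⟨j', i', fun a b hab => P.j_inj ?_, fun a b hab => P.i_inj ?_, fun q y => hi ?_,
    fun s => ⟨?_, fun hs => ?_⟩, fun v => ⟨?_, fun hv => ?_⟩⟩⟩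
  · rw [← hj', ← hj', hab]
  · rw [← hi', ← hi', hab]
  · rw [hij, hi', hi', hj', P.i_smul]
  · rintro ⟨q, rfl⟩
    exact hj (by rw [hσ, hj', hP1])
  · obtain ⟨q, hq⟩ := (P.j_range (j s)).mpr (by rw [← hσ, hs])
    exact ⟨q, hj (by rw [hj', hq])⟩
  · rintro ⟨y, rfl⟩
    exact hi (by rw [hg, hi', hP2])
  · obtain ⟨y, hy⟩ := (P.i_range (i v)).mpr (by rw [← hg, hv])
    exact ⟨y, hi (by rw [hi', hy])⟩

end Restrict

theorem exists_fixedPair {H V : Type} [Group H] [MulAction H V] (φ : H →* H) (f : V → V)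
    (hf : ∀ (h : H) v, f (h • v) = φ h • f v) :
    ∃ (Q Y : Type) (_ : Group Q) (_ : MulAction Q Y), Nonempty (FixedPair φ f Q Y) := by
  let S : Subgroup H := φ.eqLocus (MonoidHom.id H)
  have hS : ∀ h, h ∈ S ↔ φ h = h := fun h => Iff.rfl
  let W : SubMulAction S V :=
    { carrier := {v | f v = v}
      smul_mem' := fun s v hv => by
        change f ((s : H) • v) = (s : H) • v
        rw [hf, (hS s).mp s.2, show f v = v from hv] }
  exact ⟨S, W, inferInstance, inferInstance,
    ⟨⟨S.subtype, Subtype.val, S.subtype_injective, Subtype.val_injective, fun _ _ => rfl,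
      fun h => ⟨fun ⟨s, hs⟩ => hs ▸ (hS _).mp s.2, fun hh => ⟨⟨h, hh⟩, rfl⟩⟩,
      fun v => ⟨fun ⟨s, hs⟩ => hs ▸ s.2, fun hv => ⟨⟨v, hv⟩, rfl⟩⟩⟩⟩⟩

section Smith

/-- The twist given by the iterates of an automorphism of finite order. -/
theorem exists_cyclicTwist {p : ℕ} [hp : Fact p.Prime] {S V : Type*} [Group S] [MulAction S V]
    (σ : S →* S) (f : V → V) (hf : ∀ (s : S) v, f (s • v) = σ s • f v)
    (hσp : ∀ s, σ^[p] s = s) (hfp : ∀ v, f^[p] v = v) :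
    ∃ τ : CyclicTwist p S V, τ.σ = σ ∧ τ.f = f := by
  choose ψ hψ using σ.exists_iterate
  refine ⟨⟨σ, f, hf, hfp, fun i => ψ i.val, fun s => ?_, fun i s => ?_, fun i => f^[i.val],
    fun i s v => ?_⟩, rfl, rfl⟩
  · rw [hψ, ZMod.val_zero, Function.iterate_zero, id]
  · have h1 : ∀ m s, σ^[m % p] s = σ^[m] s := fun m s =>
      Function.IsPeriodicPt.iterate_mod_apply (hσp s) m
    rw [hψ, hψ, ← Function.iterate_succ_apply, ZMod.val_add, h1, ← h1, Nat.add_mod,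
      ZMod.val_one_eq_one_mod, Nat.mod_mod, ← Nat.add_mod, h1]
  · rw [hψ, iterate_smul_of_semiconj hf]

variable {H V Q Y Q' Y' : Type} [Group H] [MulAction H V] [Group Q] [MulAction Q Y]
  [Group Q'] [MulAction Q' Y']

theorem HasTree.of_prime {p k : ℕ} (hp : p.Prime) (φ : H →* H) (f : V → V)
    (hf : ∀ (h : H) v, f (h • v) = φ h • f v) (v₀ : V) (hv₀ : f v₀ = v₀)
    (P' : FixedPair φ^[p] f^[p] Q' Y') (h : HasTree k Q' Y') (P : FixedPair φ f Q Y) :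
    HasTree k Q Y := by
  have := Fact.mk hp
  obtain ⟨E, _, T, hk⟩ := h
  have hP'1 : ∀ q, φ^[p] (P'.j q) = P'.j q := fun q => (P'.j_range _).mp ⟨q, rfl⟩
  have hP'2 : ∀ y, f^[p] (P'.i y) = P'.i y := fun y => (P'.i_range _).mp ⟨y, rfl⟩
  obtain ⟨σ, g, hσ, hg, hσg⟩ := exists_restrict P'.j_inj P'.i_inj P'.i_smul φ f hf
    (fun q => (P'.j_range _).mpr (by
      rw [← Function.iterate_succ_apply, Function.iterate_succ_apply' φ, hP'1]))
    (fun y => (P'.i_range _).mpr (by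
      rw [← Function.iterate_succ_apply, Function.iterate_succ_apply' f, hP'2]))
  have hσn : ∀ n q, P'.j (σ^[n] q) = φ^[n] (P'.j q) := by
    intro n q
    induction n with
    | zero => rfl
    | succ n ih => rw [Function.iterate_succ_apply', hσ, ih, ← Function.iterate_succ_apply' φ]
  have hgn : ∀ n y, P'.i (g^[n] y) = f^[n] (P'.i y) := by
    intro n y
    induction n with
    | zero => rfl
    | succ n ih => rw [Function.iterate_succ_apply', hg, ih, ← Function.iterate_succ_apply' f]
  obtain ⟨τ, hτσ, hτf⟩ := exists_cyclicTwist σ g hσg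
    (fun q => P'.j_inj (by rw [hσn, hP'1])) (fun y => P'.i_inj (by rw [hgn, hP'2]))
  obtain ⟨P₁⟩ := P.nonempty_restrict P'.j_inj P'.i_inj P'.i_smul
    (fun h hh => (P'.j_range h).mpr (Function.iterate_fixed hh p))
    (fun v hv => (P'.i_range v).mpr (Function.iterate_fixed hv p)) σ g hσ hg
  have hP1 : ∀ q, σ (P₁.j q) = P₁.j q := fun q => (P₁.j_range _).mp ⟨q, rfl⟩
  have hP2 : ∀ y, g (P₁.i y) = P₁.i y := fun y => (P₁.i_range _).mp ⟨y, rfl⟩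
  obtain ⟨y₀, -⟩ := (P.i_range v₀).mpr hv₀
  have : Nonempty Y := ⟨y₀⟩
  obtain ⟨R⟩ := exists_treeRetraction T P₁.j P₁.i P₁.i_inj P₁.i_smul (fun q x hx hqx => by
    have hne : x ≠ g x := fun h => hx ((P₁.i_range x).mpr h.symm)
    have h1 : P₁.j q • g x = g x := by
      conv_rhs => rw [← hqx]
      rw [hσg, hP1]
    exact P₁.j_inj (by rw [T.eq_one_of_smul_eq hne hqx h1, map_one]))
  refine ⟨R.Edge, inferInstance, R.tree P₁.j_inj, ?_⟩
  refine R.orbitBound_of_twist hk τ (fun s => ?_) (fun y => ?_) (P₁.i y₀)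
  · rw [hτσ]; exact P₁.j_range s
  · rw [hτf, hP2]

theorem HasTree.of_iterate {k N : ℕ} (hN : 0 < N) :
    ∀ {H V : Type} [Group H] [MulAction H V] (φ : H →* H) (f : V → V)
    (_ : ∀ (h : H) v, f (h • v) = φ h • f v) (v₀ : V) (_ : f v₀ = v₀)
    (_ : ∀ (Q Y : Type) [Group Q] [MulAction Q Y], FixedPair φ^[N] f^[N] Q Y → HasTree k Q Y)
    (Q Y : Type) [Group Q] [MulAction Q Y], FixedPair φ f Q Y → HasTree k Q Y := by
  induction N using Nat.recOnMul with
  | zero => exact absurd hN (lt_irrefl 0)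
  | one => exact fun φ f _ _ _ h => h
  | prime p hp =>
    intro H V _ _ φ f hf v₀ hv₀ h Q Y _ _ P
    obtain ⟨ψ, hψ⟩ := φ.exists_iterate p
    obtain ⟨Q', Y', _, _, ⟨P'⟩⟩ := exists_fixedPair ψ f^[p] (fun h v => by
      rw [iterate_smul_of_semiconj hf, hψ])
    rw [funext hψ] at P'
    exact HasTree.of_prime hp φ f hf v₀ hv₀ P' (h Q' Y' P') P
  | mul a b iha ihb =>
    intro H V _ _ φ f hf v₀ hv₀ h
    obtain ⟨ψ, hψ⟩ := φ.exists_iterate a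
    refine iha (Nat.pos_of_mul_pos_right hN) φ f hf v₀ hv₀ ?_
    have hψ' : (ψ : H → H) = φ^[a] := funext hψ
    have := ihb (Nat.pos_of_mul_pos_left hN) ψ f^[a] (fun h v => by
      rw [iterate_smul_of_semiconj hf, hψ]) v₀ (Function.iterate_fixed hv₀ a)
    rw [hψ', ← Function.iterate_mul, ← Function.iterate_mul] at this
    exact this h

/-- The fixed points of an injective endomorphism of a group acting on a tree, together with the
fixed vertices of a compatible map, carry a tree with at most as many orbits of edges. -/
theorem EdgeTree.hasTree_of_fixedPair {E : Type} [MulAction H E] (T : EdgeTree H V E) {k : ℕ}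
    (hk : OrbitBound H E k) (φ : H →* H) (hφ : Function.Injective φ) (f : V → V)
    (hf : ∀ (h : H) v, f (h • v) = φ h • f v) (v₀ : V) (hv₀ : f v₀ = v₀)
    (P : FixedPair φ f Q Y) : HasTree k Q Y := by
  let S : Subgroup H :=
    { carrier := {h | ∃ n, 0 < n ∧ φ^[n] h = h}
      one_mem' := ⟨1, one_pos, by simp⟩
      mul_mem' := by
        rintro a b ⟨n, hn, ha⟩ ⟨m, hm, hb⟩
        refine ⟨n * m, Nat.mul_pos hn hm, ?_⟩
        rw [iterate_map_mul, Function.iterate_eq_of_dvd ha (Dvd.intro m rfl),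
          Function.iterate_eq_of_dvd hb (Dvd.intro_left n rfl)]
      inv_mem' := by
        rintro a ⟨n, hn, ha⟩
        exact ⟨n, hn, by rw [iterate_map_inv, ha]⟩ }
  have hS : ∀ h, h ∈ S ↔ ∃ n, 0 < n ∧ φ^[n] h = h := fun h => Iff.rfl
  let W : SubMulAction S V :=
    { carrier := {v | ∃ n, 0 < n ∧ f^[n] v = v}
      smul_mem' := by
        rintro ⟨s, n, hn, hs⟩ v ⟨m, hm, hv⟩
        refine ⟨n * m, Nat.mul_pos hn hm, ?_⟩
        change f^[n * m] (s • v) = s • v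
        rw [iterate_smul_of_semiconj hf, Function.iterate_eq_of_dvd hs (Dvd.intro m rfl),
          Function.iterate_eq_of_dvd hv (Dvd.intro_left n rfl)] }
  have hW : ∀ v, v ∈ W ↔ ∃ n, 0 < n ∧ f^[n] v = v := fun v => Iff.rfl
  let j : S →* H := S.subtype
  let i : W → V := Subtype.val
  have hj : Function.Injective j := S.subtype_injective
  have hi : Function.Injective i := Subtype.val_injective
  have hij : ∀ (q : S) (y : W), i (q • y) = j q • i y := fun _ _ => rfl
  have hjr : ∀ h, h ∈ Set.range j ↔ h ∈ S := fun h => by simp [j]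
  have hir : ∀ v, v ∈ Set.range i ↔ v ∈ W := fun v => by simp [i]
  have : Nonempty W := ⟨⟨v₀, 1, one_pos, hv₀⟩⟩
  obtain ⟨R⟩ := exists_treeRetraction T j i hi hij (fun q x hx hqx => by
    obtain ⟨n, hn, hq⟩ := (hS _).mp q.2
    have hne : x ≠ f^[n] x := fun h => hx ((hir x).mpr ⟨n, hn, h.symm⟩)
    refine hj (T.eq_one_of_smul_eq hne hqx ?_)
    conv_rhs => rw [← hqx]
    rw [iterate_smul_of_semiconj hf]
    exact congrArg (· • f^[n] x) hq.symm)
  have hkR : OrbitBound S R.Edge k := R.orbitBound_of_periodic hk φ hφ f hf hj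
    (fun h n hn hh => (hjr h).mpr ⟨n, hn, hh⟩) (fun y => (hW _).mp y.2)
  have TR := R.tree hj
  obtain ⟨m, r, -, hr1, hr2⟩ := hkR.exists_reps
  have hper : ∀ y : W, ∃ n, 0 < n ∧ f^[n] (i y) = i y := fun y => (hW _).mp y.2
  choose per hper0 hper1 using hper
  obtain ⟨N, hN, hN1⟩ : ∃ N, 0 < N ∧ ∀ a, per (TR.src (r a)) ∣ N ∧ per (TR.tgt (r a)) ∣ N := by
    refine ⟨∏ a, (per (TR.src (r a)) * per (TR.tgt (r a))),
      Finset.prod_pos fun a _ => Nat.mul_pos (hper0 _) (hper0 _), fun a => ?_⟩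
    have := Finset.dvd_prod_of_mem (fun a => per (TR.src (r a)) * per (TR.tgt (r a)))
      (Finset.mem_univ a)
    exact ⟨(Dvd.intro _ rfl).trans this, (Dvd.intro_left _ rfl).trans this⟩
  refine HasTree.of_iterate hN φ f hf v₀ hv₀ ?_ Q Y P
  intro Q' Y' _ _ P'
  obtain ⟨ψ, hψ⟩ := φ.exists_iterate N
  have hψf : ∀ (h : H) v, f^[N] (h • v) = ψ h • f^[N] v := fun h v => by
    rw [iterate_smul_of_semiconj hf, hψ]
  obtain ⟨σ, g, hσ, hg, hσg⟩ := exists_restrict hj hi hij ψ f^[N] hψf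
    (fun q => by
      obtain ⟨n, hn, hq⟩ := (hS _).mp q.2
      refine (hjr _).mpr ⟨n, hn, ?_⟩
      rw [hψ, ← Function.iterate_add_apply, add_comm, Function.iterate_add_apply]
      exact congrArg _ hq)
    (fun y => by
      refine (hir _).mpr ⟨per y, hper0 y, ?_⟩
      rw [← Function.iterate_add_apply, add_comm, Function.iterate_add_apply, hper1])
  obtain ⟨P₁⟩ := P'.nonempty_restrict hj hi hij (fun h hh => (hjr h).mpr ⟨N, hN, hh⟩)
    (fun v hv => (hir v).mpr ⟨N, hN, hv⟩) σ g (fun q => by rw [hσ, hψ]) hg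
  refine TR.exists_tree_of_fixed_reps hkR σ (fun a b hab => ?_) g hσg r hr1 hr2 (fun a => hi ?_)
    (fun a => hi ?_) P₁.j P₁.j_inj P₁.i P₁.i_inj P₁.i_smul P₁.j_range P₁.i_range
  · have h1 := congrArg j hab
    rw [hσ, hσ, hψ, hψ] at h1
    exact hj (hφ.iterate N h1)
  · rw [hg]
    exact Function.iterate_eq_of_dvd (hper1 _) (hN1 a).1
  · rw [hg]
    exact Function.iterate_eq_of_dvd (hper1 _) (hN1 a).2

end Smith

/-- The subgroup `K` is generated by at most `n` elements. -/
def Subgroup.GenBy {G : Type*} [Group G] (K : Subgroup G) (n : ℕ) : Prop :=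
  ∃ S : Finset G, S.card ≤ n ∧ Subgroup.closure (S : Set G) = K

namespace Subgroup.GenBy

variable {G : Type*} [Group G]

theorem mono {K : Subgroup G} {m n : ℕ} (h : K.GenBy m) (hmn : m ≤ n) : K.GenBy n :=
  let ⟨S, hS, hK⟩ := h
  ⟨S, hS.trans hmn, hK⟩

theorem bot : (⊥ : Subgroup G).GenBy 0 := ⟨∅, by simp, by simp⟩

theorem sup {K K' : Subgroup G} {m n : ℕ} (h : K.GenBy m) (h' : K'.GenBy n) :
    (K ⊔ K').GenBy (m + n) := by
  classical
  obtain ⟨S, hS, rfl⟩ := h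
  obtain ⟨S', hS', rfl⟩ := h'
  refine ⟨S ∪ S', (Finset.card_union_le _ _).trans (by lia), ?_⟩
  rw [Finset.coe_union, Subgroup.closure_union]

theorem zpowers (g : G) : (Subgroup.zpowers g).GenBy 1 :=
  ⟨{g}, by simp, by rw [Finset.coe_singleton, Subgroup.zpowers_eq_closure]⟩

theorem map {G' : Type*} [Group G'] {K : Subgroup G} {n : ℕ} (h : K.GenBy n) (f : G →* G') :
    (K.map f).GenBy n := by
  classical
  obtain ⟨S, hS, rfl⟩ := h
  exact ⟨S.image f, Finset.card_image_le.trans hS, by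
    rw [Finset.coe_image, MonoidHom.map_closure]⟩

theorem exists_fg_rank_le {n : ℕ} (h : (⊤ : Subgroup G).GenBy n) :
    ∃ h : Group.FG G, @Group.rank G _ h ≤ n := by
  obtain ⟨S, hS, hS'⟩ := h
  have hfg : Group.FG G := ⟨⟨S, hS'⟩⟩
  exact ⟨hfg, (Group.rank_le hS').trans hS⟩

theorem of_rank (G : Type*) [Group G] [Group.FG G] : (⊤ : Subgroup G).GenBy (Group.rank G) := by
  obtain ⟨S, hS, hS'⟩ := Group.rank_spec G
  exact ⟨S, hS.le, hS'⟩

end Subgroup.GenBy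

namespace EdgeTree

variable {Γ V E : Type*} [Group Γ] [MulAction Γ V] [MulAction Γ E]

/-- A group acting on a tree with at most `k` orbits of edges, with a vertex with trivial
stabilizer and with all stabilizers generated by at most `L` elements, is generated by at most
`k * L` elements. -/
theorem genBy_top (T : EdgeTree Γ V E) {k L : ℕ} (hk : OrbitBound Γ E k) (hL : 0 < L) (v₀ : V)
    (h₀ : ∀ g : Γ, g • v₀ = v₀ → g = 1)
    (hstab : ∀ v : V, (MulAction.stabilizer Γ v).GenBy L) : (⊤ : Subgroup Γ).GenBy (k * L) := by
  classical
  obtain ⟨m, r, hm, hr1, hr2⟩ := hk.exists_reps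
  let good : Finset (Fin m) → Subgroup Γ → Set V → Prop := fun I Ψ R =>
    v₀ ∈ R ∧ Ψ.GenBy (I.card * L) ∧ (∀ x ∈ R, ∀ g : Γ, g • x = x → g ∈ Ψ) ∧
    (∀ x ∈ R, ∀ y ∈ R, ∀ g : Γ, g • x = y → x = y) ∧
    ∀ a ∈ I, ∃ g : Γ, ∀ b, ∃ ψ ∈ Ψ, ∃ x ∈ R, T.endpt (g • r a) b = ψ • x
  have hgood : ∃ Ψ R, good ∅ Ψ R := by
    refine ⟨⊥, {v₀}, rfl, Subgroup.GenBy.bot.mono (by simp), ?_, ?_, by simp⟩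
    · rintro x rfl g hg
      exact h₀ g hg
    · rintro x rfl y rfl g -
      rfl
  obtain ⟨I, hI⟩ : ∃ I, Maximal (fun I => ∃ Ψ R, good I Ψ R) I :=
    (Set.toFinite _).exists_maximal ⟨∅, hgood⟩
  obtain ⟨Ψ, R, hv₀, hgen, hst, hdist, hedge⟩ := hI.prop
  have step : ∀ e b, (∃ ψ ∈ Ψ, ∃ x ∈ R, T.endpt e b = ψ • x) →
      ∃ ψ ∈ Ψ, ∃ x ∈ R, T.endpt e (!b) = ψ • x := by
    rintro e b ⟨ψ, hψ, x, hx, hex⟩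
    by_contra hcon
    obtain ⟨a, g, rfl⟩ := hr2 e
    have haI : a ∉ I := by
      intro ha
      obtain ⟨g', hg'⟩ := hedge a ha
      obtain ⟨ψ', hψ', x', hx', hex'⟩ := hg' b
      obtain ⟨ψ₁, hψ₁, x₁, hx₁, hex₁⟩ := hg' (!b)
      rw [T.endpt_smul] at hex hex' hex₁
      have h1 : (ψ'⁻¹ * g' * g⁻¹ * ψ) • x = x' := by
        simp only [mul_smul, ← hex, inv_smul_smul, hex']
      obtain rfl := hdist x hx x' hx' _ h1
      have h2 : g' * g⁻¹ ∈ Ψ := by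
        have h3 := Ψ.mul_mem (Ψ.mul_mem hψ' (hst x hx _ h1)) (Ψ.inv_mem hψ)
        convert h3 using 1
        group
      refine hcon ⟨(g' * g⁻¹)⁻¹ * ψ₁, Ψ.mul_mem (Ψ.inv_mem h2) hψ₁, x₁, hx₁, ?_⟩
      rw [mul_smul, ← hex₁, T.endpt_smul, mul_inv_rev, inv_inv, mul_smul, inv_smul_smul]
    have hcard : (insert a I).card * L = I.card * L + L := by
      rw [Finset.card_insert_of_notMem haI, add_mul, one_mul]
    suffices ∃ Ψ' R', good (insert a I) Ψ' R' from
      haI (hI.le_of_ge this (Finset.subset_insert a I) (Finset.mem_insert_self a I))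
    by_cases horb : ∃ x' ∈ R, ∃ h : Γ, T.endpt (g • r a) (!b) = h • x'
    · obtain ⟨x', hx', h, hh⟩ := horb
      have hle : Ψ ≤ Ψ ⊔ Subgroup.zpowers h := le_sup_left
      refine ⟨Ψ ⊔ Subgroup.zpowers h, R, hv₀, ?_, fun y hy g hg => hle (hst y hy g hg), hdist, ?_⟩
      · rw [hcard]
        exact (hgen.sup (Subgroup.GenBy.zpowers h)).mono (by lia)
      · intro c hc
        rcases Finset.mem_insert.mp hc with rfl | hc
        · refine ⟨g, fun b' => ?_⟩
          rcases eq_or_ne b' b with rfl | hb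
          · exact ⟨ψ, hle hψ, x, hx, hex⟩
          · rw [Bool.eq_not_of_ne hb]
            exact ⟨h, (le_sup_right : _ ≤ Ψ ⊔ _) (Subgroup.mem_zpowers h), x', hx', hh⟩
        · obtain ⟨g', hg'⟩ := hedge c hc
          refine ⟨g', fun b' => ?_⟩
          obtain ⟨ψ', hψ', y, hy, hey⟩ := hg' b'
          exact ⟨ψ', hle hψ', y, hy, hey⟩
    · set w := T.endpt (g • r a) (!b) with hw
      have hle : Ψ ≤ Ψ ⊔ MulAction.stabilizer Γ w := le_sup_left
      refine ⟨Ψ ⊔ MulAction.stabilizer Γ w, insert w R, Or.inr hv₀, ?_, ?_, ?_, ?_⟩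
      · rw [hcard]
        exact hgen.sup (hstab w)
      · rintro y (rfl | hy) g hg
        · exact (le_sup_right : _ ≤ Ψ ⊔ _) hg
        · exact hle (hst y hy g hg)
      · rintro y (rfl | hy) z (rfl | hz) h hyz
        · rfl
        · exact absurd ⟨z, hz, h⁻¹, by rw [← hyz, inv_smul_smul]⟩ horb
        · exact absurd ⟨y, hy, h, hyz.symm⟩ horb
        · exact hdist y hy z hz h hyz
      · intro c hc
        rcases Finset.mem_insert.mp hc with rfl | hc
        · refine ⟨g, fun b' => ?_⟩
          rcases eq_or_ne b' b with rfl | hb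
          · exact ⟨ψ, hle hψ, x, Or.inr hx, hex⟩
          · rw [Bool.eq_not_of_ne hb]
            exact ⟨1, Subgroup.one_mem _, w, Or.inl rfl, by rw [one_smul]⟩
        · obtain ⟨g', hg'⟩ := hedge c hc
          refine ⟨g', fun b' => ?_⟩
          obtain ⟨ψ', hψ', y, hy, hey⟩ := hg' b'
          exact ⟨ψ', hle hψ', y, Or.inr hy, hey⟩
  have hall : ∀ v, ∃ ψ ∈ Ψ, ∃ x ∈ R, v = ψ • x :=
    T.forall_of_edges _ v₀ ⟨1, Ψ.one_mem, v₀, hv₀, (one_smul _ _).symm⟩ fun e =>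
      ⟨step e true, step e false⟩
  have htop : Ψ = ⊤ := by
    rw [eq_top_iff]
    rintro g -
    obtain ⟨ψ, hψ, x, hx, hgx⟩ := hall (g • v₀)
    obtain rfl := hdist v₀ hv₀ x hx (ψ⁻¹ * g) (by rw [mul_smul, hgx, inv_smul_smul])
    have := h₀ (ψ⁻¹ * g) (by rw [mul_smul, hgx, inv_smul_smul])
    rw [← inv_mul_eq_one.mp this]
    exact hψ
  rw [← htop]
  exact hgen.mono (Nat.mul_le_mul_right _ ((Finset.card_le_univ I).trans (by simpa using hm)))

end EdgeTree

/-- `Reads B p g q`: the element `g` is the label of a path from `p` to `q` in the graph with the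
set of labelled arcs `B`. -/
inductive Reads {P K : Type*} [Group K] (B : Set (P × K × P)) : P → K → P → Prop
  | refl (p : P) : Reads B p 1 p
  | arc (x : P × K × P) (hx : x ∈ B) : Reads B x.1 x.2.1 x.2.2
  | symm {p : P} {m : K} {q : P} (h : Reads B p m q) : Reads B q m⁻¹ p
  | trans {p : P} {m : K} {q : P} {m' : K} {r : P} (h : Reads B p m q) (h' : Reads B q m' r) :
      Reads B p (m * m') r

namespace Reads

variable {P K P' K' : Type*} [Group K] [Group K'] {B : Set (P × K × P)} {B' : Set (P' × K' × P')}

theorem map_twist (h : P → P') (f : K →* K') (c : P → K')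
    (hB : ∀ x ∈ B, Reads B' (h x.1) ((c x.1)⁻¹ * f x.2.1 * c x.2.2) (h x.2.2)) {p q : P} {g : K}
    (hr : Reads B p g q) : Reads B' (h p) ((c p)⁻¹ * f g * c q) (h q) := by
  induction hr with
  | refl p => simpa using Reads.refl (B := B') (h p)
  | arc x hx => exact hB x hx
  | symm _ ih => simpa [mul_assoc] using ih.symm
  | trans _ _ ih ih' => simpa [mul_assoc] using ih.trans ih'

theorem map (h : P → P') (f : K →* K')
    (hB : ∀ x ∈ B, Reads B' (h x.1) (f x.2.1) (h x.2.2)) {p q : P} {g : K}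
    (hr : Reads B p g q) : Reads B' (h p) (f g) (h q) := by
  simpa using hr.map_twist (B' := B') h f (fun _ => 1) (by simpa using hB)

theorem iff_of_arcs {p₀ : P} (hB : ∀ x ∈ B, x.1 = p₀ ↔ x.2.2 = p₀) {p q : P} {g : K}
    (hr : Reads B p g q) : p = p₀ ↔ q = p₀ := by
  induction hr with
  | refl p => rfl
  | arc x hx => exact hB x hx
  | symm _ ih => exact ih.symm
  | trans _ _ ih ih' => exact ih.trans ih'

theorem mem_closure {p q : P} {g : K} (hr : Reads B p g q) :
    g ∈ Subgroup.closure ((fun x : P × K × P => x.2.1) '' B) := by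
  induction hr with
  | refl p => exact one_mem _
  | arc x hx => exact Subgroup.subset_closure ⟨x, hx, rfl⟩
  | symm _ ih => exact inv_mem ih
  | trans _ _ ih ih' => exact mul_mem ih ih'

theorem of_mem_closure {S : Set K} {p : P} (hS : ∀ g ∈ S, Reads B p g p) {g : K}
    (hg : g ∈ Subgroup.closure S) : Reads B p g p := by
  induction hg using Subgroup.closure_induction with
  | mem x hx => exact hS x hx
  | one => exact .refl p
  | mul x y _ _ hx hy => exact hx.trans hy
  | inv x _ hx => exact hx.symm

end Reads

open Monoid

section ArcSystem

variable {ι : Type} {M : ι → Type} [∀ i, Group (M i)] {P P' : Type}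

/-- The arcs of type `i` of a set of arcs labelled by elements of the groups `M i`. -/
def typeArcs (A : Set (Σ i, P × M i × P)) (i : ι) : Set (P × M i × P) := {x | ⟨i, x⟩ ∈ A}

/-- The arcs of all types, with labels in the free product. -/
def allArcs (A : Set (Σ i, P × M i × P)) : Set (P × CoprodI M × P) :=
  {x | ∃ a ∈ A, x = (a.2.1, CoprodI.of a.2.2.1, a.2.2.2)}

theorem Reads.typeArcs_allArcs {A : Set (Σ i, P × M i × P)} {i : ι} {p q : P} {m : M i}
    (h : Reads (typeArcs A i) p m q) : Reads (allArcs A) p (CoprodI.of m) q :=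
  h.map id CoprodI.of fun x hx => by
    exact Reads.arc (B := allArcs A) (x.1, CoprodI.of x.2.1, x.2.2) ⟨⟨i, x⟩, hx, rfl⟩

/-- A finite connected graph with arcs labelled by elements of the groups `M i`, whose first Betti
number is at most `n`. -/
structure IsArcSystem (n : ℕ) [Fintype P] (p₀ : P) (A : Finset (Σ i, P × M i × P)) : Prop where
  card_le : A.card + 1 ≤ Fintype.card P + n
  conn : ∀ p, ∃ g, Reads (allArcs (A : Set (Σ i, P × M i × P))) p₀ g p

theorem Reads.allArcs_map {A : Set (Σ i, P × M i × P)} {A' : Set (Σ i, P' × M i × P')} (h : P → P')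
    (hA : ∀ x ∈ A, (⟨x.1, h x.2.1, x.2.2.1, h x.2.2.2⟩ : Σ i, P' × M i × P') ∈ A') {p q : P}
    {g : CoprodI M} (hr : Reads (allArcs A) p g q) : Reads (allArcs A') (h p) g (h q) := by
  refine hr.map h (MonoidHom.id _) ?_
  rintro _ ⟨a, ha, rfl⟩
  exact .arc (h a.2.1, CoprodI.of a.2.2.1, h a.2.2.2) ⟨_, hA a ha, rfl⟩

/-- An arc system can be enlarged so that a given element is read from a given point. -/
theorem IsArcSystem.exists_extend (g : CoprodI M) : ∀ {n : ℕ} {P : Type} [Fintype P] {p₀ : P}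
    {A : Finset (Σ i, P × M i × P)} (_ : IsArcSystem n p₀ A) (p : P),
    ∃ (P' : Type) (_ : Fintype P') (A' : Finset (Σ i, P' × M i × P')) (h : P → P') (q : P'),
      IsArcSystem n (h p₀) A' ∧
      (∀ p k q, Reads (allArcs (A : Set (Σ i, P × M i × P))) p k q →
        Reads (allArcs (A' : Set (Σ i, P' × M i × P'))) (h p) k (h q)) ∧
      Reads (allArcs (A' : Set (Σ i, P' × M i × P'))) (h p) g q := by
  classical
  induction g using CoprodI.induction_on with
  | one => exact fun {n P _ p₀ A} hA p => ⟨P, _, A, id, p, hA, fun _ _ _ h => h, .refl _⟩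
  | of i m =>
    intro n P _ p₀ A hA p
    let F : (Σ i, P × M i × P) → (Σ i, Option P × M i × Option P) :=
      fun x => ⟨x.1, some x.2.1, x.2.2.1, some x.2.2.2⟩
    let A' : Finset (Σ i, Option P × M i × Option P) :=
      insert ⟨i, some p, m, none⟩ (A.image F)
    have hmap : ∀ p k q, Reads (allArcs (A : Set (Σ i, P × M i × P))) p k q →
        Reads (allArcs (A' : Set (Σ i, Option P × M i × Option P))) (some p) k (some q) := by
      intro p k q h
      refine h.allArcs_map some ?_
      intro x hx
      simp only [A', Finset.coe_insert, Finset.coe_image]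
      exact Or.inr ⟨x, hx, rfl⟩
    have hnew : Reads (allArcs (A' : Set (Σ i, Option P × M i × Option P))) (some p)
        (CoprodI.of m) none :=
      .arc (some p, CoprodI.of m, none) ⟨⟨i, some p, m, none⟩, by simp [A'], rfl⟩
    refine ⟨Option P, inferInstance, A', some, none, ⟨?_, ?_⟩, hmap, hnew⟩
    · have h1 := Finset.card_insert_le (⟨i, some p, m, none⟩ : Σ i, Option P × M i × Option P)
        (A.image F)
      have h2 : (A.image F).card ≤ A.card := Finset.card_image_le
      have h3 := hA.card_le
      rw [Fintype.card_option]
      change (insert _ (A.image F)).card + 1 ≤ _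
      lia
    · rintro (_ | q)
      · obtain ⟨g, hg⟩ := hA.conn p
        exact ⟨_, (hmap _ _ _ hg).trans hnew⟩
      · obtain ⟨g, hg⟩ := hA.conn q
        exact ⟨g, hmap _ _ _ hg⟩
  | mul x y ihx ihy =>
    intro n P _ p₀ A hA p
    obtain ⟨P', _, A', h', q', hA', hm', hr'⟩ := ihx hA p
    obtain ⟨P'', _, A'', h'', q'', hA'', hm'', hr''⟩ := ihy hA' q'
    exact ⟨P'', _, A'', h'' ∘ h', q'', hA'', fun _ _ _ h => hm'' _ _ _ (hm' _ _ _ h),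
      (hm'' _ _ _ hr').trans hr''⟩

theorem exists_isArcSystem [Nonempty ι] (S : Finset (CoprodI M)) :
    ∃ (P : Type) (_ : Fintype P) (p₀ : P) (A : Finset (Σ i, P × M i × P)),
      IsArcSystem S.card p₀ A ∧
      ∀ g ∈ S, Reads (allArcs (A : Set (Σ i, P × M i × P))) p₀ g p₀ := by
  classical
  induction S using Finset.induction_on with
  | empty =>
    exact ⟨Unit, _, (), ∅, ⟨by simp, fun _ => ⟨1, .refl _⟩⟩, by simp⟩
  | insert g S hg ih =>
    obtain ⟨P, _, p₀, A, hA, hS⟩ := ih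
    obtain ⟨P', _, A', h, q, hA', hm, hr⟩ := hA.exists_extend g p₀
    obtain ⟨i⟩ := ‹Nonempty ι›
    let a : Σ i, P' × M i × P' := ⟨i, q, 1, h p₀⟩
    have hmap : ∀ p k q, Reads (allArcs (A' : Set (Σ i, P' × M i × P'))) p k q →
        Reads (allArcs ((insert a A' : Finset _) : Set (Σ i, P' × M i × P'))) p k q := by
      intro p k q h
      refine h.allArcs_map id ?_
      intro x hx
      rw [Finset.coe_insert]
      exact Or.inr hx
    have hnew : Reads (allArcs ((insert a A' : Finset _) : Set (Σ i, P' × M i × P'))) q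
        (CoprodI.of (1 : M i)) (h p₀) :=
      .arc (q, CoprodI.of (1 : M i), h p₀) ⟨a, by simp, rfl⟩
    refine ⟨P', _, h p₀, insert a A', ⟨?_, ?_⟩, ?_⟩
    · have h1 := Finset.card_insert_le a A'
      have h2 := hA'.card_le
      rw [Finset.card_insert_of_notMem hg]
      lia
    · intro p
      obtain ⟨k, hk⟩ := hA'.conn p
      exact ⟨k, hmap _ _ _ hk⟩
    · intro k hk
      rcases Finset.mem_insert.1 hk with rfl | hk
      · simpa using (hmap _ _ _ hr).trans hnew
      · exact hmap _ _ _ (hm _ _ _ (hS k hk))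

/-- If two points are connected by a path of one type with trivial label, they can be
identified. -/
theorem IsArcSystem.exists_fold {n : ℕ} [Fintype P] {p₀ : P} {A : Finset (Σ i, P × M i × P)}
    (hA : IsArcSystem n p₀ A) {i : ι} {p p' : P} (hpp' : p ≠ p') (hp₀ : p ≠ p₀)
    (hr : Reads (typeArcs (A : Set (Σ i, P × M i × P)) i) p 1 p') :
    ∃ (P' : Type) (_ : Fintype P') (A' : Finset (Σ i, P' × M i × P')) (h : P → P'),
      Fintype.card P' < Fintype.card P ∧ IsArcSystem n (h p₀) A' ∧
      (∀ p k q, Reads (allArcs (A : Set (Σ i, P × M i × P))) p k q →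
        Reads (allArcs (A' : Set (Σ i, P' × M i × P'))) (h p) k (h q)) := by
  classical
  obtain ⟨x₀, q, m₁, hx₀, hqp, hx₀'⟩ : ∃ (x₀ : P × M i × P) (q : P) (m₁ : M i),
      (⟨i, x₀⟩ : Σ i, P × M i × P) ∈ A ∧ q ≠ p ∧
      (x₀ = (p, m₁, q) ∨ x₀ = (q, m₁⁻¹, p)) := by
    by_contra! hcon
    refine absurd ((hr.iff_of_arcs (p₀ := p) ?_).1 rfl) hpp'.symm
    rintro ⟨a, m, b⟩ hx
    constructor
    · rintro rfl
      by_contra hb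
      exact (hcon _ b m hx hb).1 rfl
    · rintro rfl
      by_contra ha
      exact (hcon _ a m⁻¹ hx ha).2 (by simp)
  let P' : Type := {x // x ≠ p}
  let r : ι → P → P' := fun j a => if h : a = p then if j = i then ⟨q, hqp⟩ else ⟨p', hpp'.symm⟩
    else ⟨a, h⟩
  let c : ∀ j, P → M j := fun j a => if a = p then Pi.mulSingle i m₁ j else 1
  let π : P → P' := fun a => if h : a = p then ⟨p', hpp'.symm⟩ else ⟨a, h⟩
  have hr_ne : ∀ j a (h : a ≠ p), r j a = ⟨a, h⟩ := fun j a h => dif_neg h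
  have hr_p : r i p = ⟨q, hqp⟩ := by simp [r]
  have hr_p' : ∀ j, j ≠ i → r j p = ⟨p', hpp'.symm⟩ := fun j hj => by simp [r, hj]
  have hc_ne : ∀ j a, a ≠ p → c j a = 1 := fun j a h => if_neg h
  have hc_p : c i p = m₁ := by simp [c]
  have hc_p' : ∀ j, j ≠ i → c j p = 1 := fun j hj => by simp [c, hj]
  have hπ_ne : ∀ a (h : a ≠ p), π a = ⟨a, h⟩ := fun a h => dif_neg h
  have hπ_p : π p = ⟨p', hpp'.symm⟩ := by simp [π]
  let F : (Σ i, P × M i × P) → (Σ i, P' × M i × P') := fun x =>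
    ⟨x.1, r x.1 x.2.1, (c x.1 x.2.1)⁻¹ * x.2.2.1 * c x.1 x.2.2.2, r x.1 x.2.2.2⟩
  let A' : Finset (Σ i, P' × M i × P') := (A.erase ⟨i, x₀⟩).image F
  have htype : ∀ j, ∀ x ∈ typeArcs (A : Set (Σ i, P × M i × P)) j,
      Reads (typeArcs (A' : Set (Σ i, P' × M i × P')) j) (r j x.1)
        ((c j x.1)⁻¹ * x.2.1 * c j x.2.2) (r j x.2.2) := by
    intro j x hx
    by_cases hxx : (⟨j, x⟩ : Σ i, P × M i × P) = ⟨i, x₀⟩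
    · obtain ⟨rfl, hxx⟩ := Sigma.mk.inj_iff.1 hxx
      obtain rfl := eq_of_heq hxx
      rcases hx₀' with rfl | rfl
      · simp only [hc_p, hc_ne _ _ hqp, hr_p, hr_ne _ _ hqp]
        simpa using Reads.refl _
      · simp only [hc_p, hc_ne _ _ hqp, hr_p, hr_ne _ _ hqp]
        simpa using Reads.refl _
    · refine Reads.arc (r j x.1, (c j x.1)⁻¹ * x.2.1 * c j x.2.2, r j x.2.2) ?_
      change F ⟨j, x⟩ ∈ (A' : Set (Σ i, P' × M i × P'))
      exact Finset.mem_coe.2 (Finset.mem_image_of_mem F (Finset.mem_erase.2 ⟨hxx, hx⟩))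
  have hshift : ∀ j a, Reads (allArcs (A' : Set (Σ i, P' × M i × P'))) (π a)
      (CoprodI.of (c j a)) (r j a) := by
    intro j a
    by_cases ha : a = p
    · subst ha
      by_cases hj : j = i
      · subst hj
        have := (hr.map_twist (r j) (MonoidHom.id _) (c j) (htype j)).symm.typeArcs_allArcs
        simpa [hc_p, hc_ne _ _ hpp'.symm, hr_p, hr_ne _ _ hpp'.symm, hπ_p] using this
      · simpa [hc_p' j hj, hr_p' j hj, hπ_p] using Reads.refl _
    · simpa [hc_ne j a ha, hr_ne j a ha, hπ_ne a ha] using Reads.refl _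
  have hmap : ∀ p k q, Reads (allArcs (A : Set (Σ i, P × M i × P))) p k q →
      Reads (allArcs (A' : Set (Σ i, P' × M i × P'))) (π p) k (π q) := by
    intro a k b hab
    refine hab.map π (MonoidHom.id _) ?_
    rintro _ ⟨⟨j, x⟩, hx, rfl⟩
    simpa [mul_assoc] using ((hshift j x.1).trans (htype j x hx).typeArcs_allArcs).trans
      (hshift j x.2.2).symm
  have hcard : Fintype.card P' + 1 = Fintype.card P := by
    have h1 : Fintype.card P' = Fintype.card P - 1 := by
      rw [Fintype.card_subtype_compl (fun x => x = p), Fintype.card_subtype_eq]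
    have h2 : 0 < Fintype.card P := Fintype.card_pos_iff.2 ⟨p⟩
    lia
  refine ⟨P', inferInstance, A', π, by lia, ⟨?_, ?_⟩, hmap⟩
  · have h1 : A'.card ≤ (A.erase ⟨i, x₀⟩).card := Finset.card_image_le
    have h2 := Finset.card_erase_add_one hx₀
    have h3 := hA.card_le
    lia
  · rintro ⟨a, ha⟩
    obtain ⟨g, hg⟩ := hA.conn a
    have := hmap _ _ _ hg
    rw [hπ_ne a ha] at this
    exact ⟨g, this⟩

/-- `PathWord A p l q`: the list `l` is the list of labels of the maximal subpaths of constant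
type of a path from `p` to `q`. -/
def PathWord (A : Set (Σ i, P × M i × P)) : P → List (Σ i, M i) → P → Prop
  | p, [], q => p = q
  | p, x :: l, q => ∃ r, Reads (typeArcs A x.1) p x.2 r ∧ PathWord A r l q

open Classical in
theorem pathWord_rcons {A : Set (Σ i, P × M i × P)}
    (hA : ∀ i p p', Reads (typeArcs A i) p 1 p' → p = p') {i : ι} (w : CoprodI.Word.Pair M i)
    (p s : P) :
    PathWord A p (CoprodI.Word.rcons w).toList s ↔
      ∃ r, Reads (typeArcs A i) p w.head r ∧ PathWord A r w.tail.toList s := by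
  unfold CoprodI.Word.rcons
  split_ifs with h
  · constructor
    · intro hp
      exact ⟨p, h ▸ .refl p, hp⟩
    · rintro ⟨r, hr, hp⟩
      rw [h] at hr
      rwa [hA i p r hr]
  · exact Iff.rfl

open Classical in
theorem pathWord_of_smul {A : Set (Σ i, P × M i × P)}
    (hA : ∀ i p p', Reads (typeArcs A i) p 1 p' → p = p') {i : ι} {m : M i} {p q s : P}
    (h : Reads (typeArcs A i) p m q) {w : CoprodI.Word M} (hw : PathWord A q w.toList s) :
    PathWord A p (CoprodI.of m • w).toList s := by
  have hw' : CoprodI.Word.rcons (CoprodI.Word.equivPair i w) = w := by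
    rw [← CoprodI.Word.equivPair_symm, Equiv.symm_apply_apply]
  rw [CoprodI.Word.of_smul_def, pathWord_rcons hA]
  rw [← hw', pathWord_rcons hA] at hw
  obtain ⟨r, hr, hw⟩ := hw
  exact ⟨r, h.trans hr, hw⟩

open Classical in
theorem pathWord_smul {A : Set (Σ i, P × M i × P)}
    (hA : ∀ i p p', Reads (typeArcs A i) p 1 p' → p = p') {g : CoprodI M} {p q : P}
    (h : Reads (allArcs A) p g q) :
    (∀ (w : CoprodI.Word M) s, PathWord A q w.toList s → PathWord A p (g • w).toList s) ∧
    ∀ (w : CoprodI.Word M) s, PathWord A p w.toList s → PathWord A q (g⁻¹ • w).toList s := by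
  induction h with
  | refl p => simp
  | arc x hx =>
    obtain ⟨⟨i, a⟩, ha, rfl⟩ := hx
    have h1 : Reads (typeArcs A i) a.1 a.2.1 a.2.2 := .arc a ha
    refine ⟨fun w s hw => pathWord_of_smul hA h1 hw, fun w s hw => ?_⟩
    have := pathWord_of_smul hA h1.symm hw
    rwa [map_inv] at this
  | symm _ ih => exact ⟨ih.2, by simpa using ih.1⟩
  | trans _ _ ih ih' =>
    refine ⟨fun w s hw => ?_, fun w s hw => ?_⟩
    · rw [mul_smul]
      exact ih.1 _ _ (ih'.1 _ _ hw)
    · rw [mul_inv_rev, mul_smul]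
      exact ih'.2 _ _ (ih.2 _ _ hw)

theorem reads_of_reads_allArcs {A : Set (Σ i, P × M i × P)}
    (hA : ∀ i p p', Reads (typeArcs A i) p 1 p' → p = p') {i : ι} {m : M i} {p q : P}
    (h : Reads (allArcs A) p (CoprodI.of m) q) : Reads (typeArcs A i) p m q := by
  classical
  have h1 := (pathWord_smul hA h).1 CoprodI.Word.empty q rfl
  have h2 : CoprodI.Word.equivPair i (CoprodI.Word.empty : CoprodI.Word M) =
      ⟨1, CoprodI.Word.empty, by
      simp [CoprodI.Word.fstIdx, CoprodI.Word.empty]⟩ :=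
    CoprodI.Word.equivPair_eq_of_fstIdx_ne _
  rw [CoprodI.Word.of_smul_def, pathWord_rcons hA, h2] at h1
  obtain ⟨r, hr, hw⟩ := h1
  obtain rfl : r = q := hw
  simpa using hr

/-- **Grushko's theorem**: generating sets of a free product decompose. -/
theorem Subgroup.GenBy.grushko [Fintype ι] {n : ℕ} (h : (⊤ : Subgroup (CoprodI M)).GenBy n) :
    ∃ N : ι → ℕ, ∑ i, N i ≤ n ∧ ∀ i, (⊤ : Subgroup (M i)).GenBy (N i) := by
  classical
  rcases isEmpty_or_nonempty ι with hι | hι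
  · exact ⟨fun _ => 0, by simp, fun i => isEmptyElim i⟩
  obtain ⟨S, hSn, hS⟩ := h
  let good : ℕ → Prop := fun c => ∃ (P : Type) (_ : Fintype P) (p₀ : P)
    (A : Finset (Σ i, P × M i × P)), Fintype.card P = c ∧ IsArcSystem S.card p₀ A ∧
      ∀ g, Reads (allArcs (A : Set (Σ i, P × M i × P))) p₀ g p₀
  have hgood : ∃ c, good c := by
    obtain ⟨P, _, p₀, A, hA, hAS⟩ := exists_isArcSystem S
    exact ⟨_, P, _, p₀, A, rfl, hA, fun g => Reads.of_mem_closure hAS (hS ▸ Subgroup.mem_top g)⟩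
  obtain ⟨P, _, p₀, A, hPc, hA, hall⟩ := Nat.find_spec hgood
  have hfold : ∀ i p p', p ≠ p' → p ≠ p₀ →
      ¬ Reads (typeArcs (A : Set (Σ i, P × M i × P)) i) p 1 p' := by
    intro i p p' hpp' hp₀ hr
    obtain ⟨P', _, A', h, hlt, hA', hm⟩ := hA.exists_fold hpp' hp₀ hr
    exact Nat.find_min hgood (hPc ▸ hlt) ⟨P', _, h p₀, A', rfl, hA', fun g => hm _ _ _ (hall g)⟩
  have hun : ∀ i p p', Reads (typeArcs (A : Set (Σ i, P × M i × P)) i) p 1 p' → p = p' := by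
    intro i p p' hr
    by_contra hne
    by_cases hp₀ : p = p₀
    · refine hfold i p' p (Ne.symm hne) (fun h => hne (hp₀.trans h.symm)) ?_
      simpa using hr.symm
    · exact hfold i p p' hne hp₀ hr
  have hloop : ∀ i (m : M i), Reads (typeArcs (A : Set (Σ i, P × M i × P)) i) p₀ m p₀ :=
    fun i m => reads_of_reads_allArcs hun (hall _)
  have hpt : ∀ p, p = p₀ := by
    intro p
    obtain ⟨g, hg⟩ := hA.conn p
    refine (hg.iff_of_arcs (p₀ := p₀) ?_).1 rfl
    rintro _ ⟨⟨i, a, m, b⟩, ha, rfl⟩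
    have h1 : Reads (typeArcs (A : Set (Σ i, P × M i × P)) i) a m b := .arc (a, m, b) ha
    constructor
    · rintro rfl
      refine hun i b a ?_
      simpa using h1.symm.trans (hloop i m)
    · rintro rfl
      refine hun i a b ?_
      simpa using h1.trans (hloop i m).symm
  have hcard : Fintype.card P = 1 := Fintype.card_eq_one_iff.2 ⟨p₀, hpt⟩
  let A' : ∀ i, Finset (P × M i × P) := fun i =>
    A.preimage (fun x => ⟨i, x⟩) (sigma_mk_injective (β := fun i => P × M i × P)).injOn
  have hAA' : A = Finset.univ.sigma A' := by
    ext ⟨i, x⟩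
    simp [A']
  refine ⟨fun i => (A' i).card, ?_, fun i => ⟨(A' i).image fun x => x.2.1, Finset.card_image_le,
    ?_⟩⟩
  · rw [← Finset.card_sigma, ← hAA']
    have := hA.card_le
    lia
  · rw [eq_top_iff]
    intro m _
    have := (hloop i m).mem_closure
    convert this using 2
    ext x
    simp [A', typeArcs]

end ArcSystem
/-- The group `H` is the free product of the subgroups `A i`. -/
def IsFreeProd {ι H : Type} [Group H] (A : ι → Subgroup H) : Prop :=
  ⨆ i, A i = ⊤ ∧ ∀ (K : Type) [Group K] (ψ : ∀ i, A i →* K),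
    ∃ Ψ : H →* K, ∀ i (a : A i), Ψ a = ψ i a

section

variable {ι H : Type} [Group H] {A : ι → Subgroup H}

theorem lift_subtype_surjective (hA : ⨆ i, A i = ⊤) :
    Function.Surjective (CoprodI.lift fun i => (A i).subtype) := by
  rw [← MonoidHom.range_eq_top, CoprodI.range_eq_iSup, ← hA]
  simp

theorem IsFreeProd.of_lift_injective (hA : ⨆ i, A i = ⊤)
    (h : Function.Injective (CoprodI.lift fun i => (A i).subtype)) : IsFreeProd A := by
  refine ⟨hA, fun K _ ψ => ?_⟩
  let F := MulEquiv.ofBijective _ ⟨h, lift_subtype_surjective hA⟩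
  refine ⟨(CoprodI.lift ψ).comp F.symm.toMonoidHom, fun i a => ?_⟩
  have h1 : F (CoprodI.of a) = (a : H) := CoprodI.lift_of (fun i => (A i).subtype) a
  have h2 : F.symm (a : H) = CoprodI.of (M := fun i => A i) a := by
    rw [← h1, MulEquiv.symm_apply_apply]
  change CoprodI.lift ψ (F.symm a) = _
  rw [h2, CoprodI.lift_of]

theorem IsFreeProd.lift_bijective (hA : IsFreeProd A) :
    Function.Bijective (CoprodI.lift fun i => (A i).subtype) := by
  refine ⟨?_, lift_subtype_surjective hA.1⟩
  obtain ⟨Ψ, hΨ⟩ := hA.2 (CoprodI fun i => A i) fun _ => CoprodI.of (M := fun i => A i)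
  have : Ψ.comp (CoprodI.lift fun i => (A i).subtype) = MonoidHom.id _ := by
    ext i a
    simp [hΨ]
  exact Function.LeftInverse.injective fun x => DFunLike.congr_fun this x

theorem IsFreeProd.top : IsFreeProd fun _ : Unit => (⊤ : Subgroup H) := by
  refine ⟨by simp, fun K _ ψ => ⟨(ψ ()).comp Subgroup.topEquiv.symm.toMonoidHom, ?_⟩⟩
  rintro ⟨⟩ a
  rfl

/-- Free product decompositions of the factors of a free product can be combined. -/
theorem IsFreeProd.sigma (hA : IsFreeProd A) {κ : ι → Type} {B : ∀ i, κ i → Subgroup (A i)}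
    (hB : ∀ i, IsFreeProd (B i)) :
    IsFreeProd fun x : Σ i, κ i => (B x.1 x.2).map (A x.1).subtype := by
  constructor
  · rw [iSup_sigma, ← hA.1]
    refine iSup_congr fun i => ?_
    change ⨆ j, (B i j).map (A i).subtype = _
    rw [← Subgroup.map_iSup, (hB i).1, ← MonoidHom.range_eq_map, Subgroup.range_subtype]
  · intro K _ ψ
    have h1 : ∀ i, ∃ Ψ : A i →* K, ∀ j (b : B i j),
        Ψ b = ψ ⟨i, j⟩ ⟨b, Subgroup.mem_map_of_mem (A i).subtype b.2⟩ := fun i =>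
      (hB i).2 K fun j => (ψ ⟨i, j⟩).comp ((A i).subtype.subgroupMap (B i j))
    choose Ψ hΨ using h1
    obtain ⟨Θ, hΘ⟩ := hA.2 K Ψ
    refine ⟨Θ, ?_⟩
    rintro ⟨i, j⟩ ⟨_, b, hb, rfl⟩
    exact (hΘ i b).trans (hΨ i j ⟨b, hb⟩)

theorem IsFreeProd.exists_genBy [Fintype ι] (hA : IsFreeProd A) {n : ℕ}
    (hn : (⊤ : Subgroup H).GenBy n) :
    ∃ N : ι → ℕ, ∑ i, N i ≤ n ∧ ∀ i, (⊤ : Subgroup (A i)).GenBy (N i) := by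
  refine Subgroup.GenBy.grushko (M := fun i => A i) ?_
  have := hn.map (MulEquiv.ofBijective _ hA.lift_bijective).symm.toMonoidHom
  rwa [← MonoidHom.range_eq_map, MonoidHom.range_eq_top.2 (MulEquiv.surjective _)] at this

/-- A variant of the ping-pong lemma with a base point. -/
theorem lift_injective_of_basePoint {α : Type*} [MulAction H α] (X : ι → Set α) (ω : α)
    (hω : ∀ i, ω ∉ X i) (hbase : ∀ i, ∀ a ∈ A i, a ≠ 1 → a • ω ∈ X i)
    (hpp : ∀ i j, i ≠ j → ∀ a ∈ A i, a ≠ 1 → ∀ x ∈ X j, a • x ∈ X i) :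
    Function.Injective (CoprodI.lift fun i => (A i).subtype) := by
  classical
  set F := CoprodI.lift fun i => (A i).subtype
  have key : ∀ w : CoprodI.Word fun i => A i,
      w = CoprodI.Word.empty ∨ ∃ i, w.fstIdx = some i ∧ F w.prod • ω ∈ X i := by
    intro w
    induction w using CoprodI.Word.consRecOn with
    | empty => exact Or.inl rfl
    | cons i m w h1 h2 ih =>
      refine Or.inr ⟨i, CoprodI.Word.fstIdx_cons _ _ _ _, ?_⟩
      have hm : (m : H) ≠ 1 := fun h => h2 (Subtype.ext h)
      have hF : F (CoprodI.of m) = (m : H) := CoprodI.lift_of (fun i => (A i).subtype) m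
      rw [CoprodI.Word.prod_cons, map_mul, mul_smul, hF]
      rcases ih with rfl | ⟨j, hj, hw⟩
      · rw [CoprodI.Word.prod_empty, map_one, one_smul]
        exact hbase i m m.2 hm
      · refine hpp i j ?_ m m.2 hm _ hw
        rintro rfl
        exact h1 hj
  rw [injective_iff_map_eq_one]
  intro x hx
  obtain ⟨w, rfl⟩ : ∃ w : CoprodI.Word fun i => A i, w.prod = x :=
    ⟨CoprodI.Word.equiv x, CoprodI.Word.equiv.symm_apply_apply x⟩
  rcases key w with rfl | ⟨i, -, hw⟩
  · exact CoprodI.Word.prod_empty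
  · rw [hx, one_smul] at hw
    exact absurd hw (hω i)

end
namespace EdgeTree

variable {Γ V E : Type*} [Group Γ] [MulAction Γ V] [MulAction Γ E]

/-- The vertices `v` and `w` are not separated by any edge in the orbit of `e`. -/
def SameSides (T : EdgeTree Γ V E) (e : E) (v w : V) : Prop :=
  ∀ a : Γ, T.side (a • e) v = T.side (a • e) w

section SameSides

variable {T : EdgeTree Γ V E} {e : E}

theorem SameSides.refl (v : V) : T.SameSides e v v := fun _ => rfl

theorem SameSides.symm {v w : V} (h : T.SameSides e v w) : T.SameSides e w v := fun a => (h a).symm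

theorem SameSides.trans {u v w : V} (h : T.SameSides e u v) (h' : T.SameSides e v w) :
    T.SameSides e u w := fun a => (h a).trans (h' a)

theorem SameSides.smul {v w : V} (h : T.SameSides e v w) (g : Γ) :
    T.SameSides e (g • v) (g • w) := fun a => by
  have h1 : a • e = g • (g⁻¹ * a) • e := by rw [smul_smul, mul_inv_cancel_left]
  rw [h1, T.side_smul, T.side_smul, h]

theorem SameSides.of_inc {e' : E} {v w : V} (hv : T.Inc e' v) (hw : T.Inc e' w)
    (he' : ∀ a : Γ, a • e ≠ e') : T.SameSides e v w := fun a =>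
  T.side_eq_of_inc hv hw (he' a)

variable (T e) in
/-- The stabilizer of the class of a vertex `v` for the relation `SameSides`. -/
def classStab (v : V) : Subgroup Γ where
  carrier := {a | T.SameSides e v (a • v)}
  one_mem' := by simpa using SameSides.refl v
  mul_mem' := by
    intro a b ha hb
    have := ha.trans (SameSides.smul hb a)
    rwa [← mul_smul] at this
  inv_mem' := by
    intro a ha
    have := (SameSides.smul ha a⁻¹).symm
    rwa [inv_smul_smul] at this

theorem side_smul_eq_of_side_ne {e₁ e₂ : E} (h₁ : ∃ a : Γ, a • e = e₁) (h₂ : ∃ a : Γ, a • e = e₂)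
    {u₁ u₂ z v : V} (hu₁ : T.Inc e₁ u₁) (hu₂ : T.Inc e₂ u₂) (hz₁ : T.SameSides e u₁ z)
    (hz₂ : T.SameSides e u₂ z) {b : Γ} (hb : T.SameSides e z (b • z)) (hne : b • e₁ ≠ e₂)
    (hv : T.side e₁ v ≠ T.side e₁ z) : T.side e₂ (b • v) = T.side e₂ z := by
  obtain ⟨a₁, rfl⟩ := h₁
  obtain ⟨a₂, rfl⟩ := h₂
  have h1 : T.side (b • a₁ • e) (b • v) ≠ T.side (b • a₁ • e) (T.src (a₂ • e)) := by
    rw [← hu₂.side_eq hne, T.side_smul, smul_smul, hz₂ (b * a₁), hb (b * a₁), mul_smul, T.side_smul]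
    exact hv
  rw [T.side_eq_of_side_ne hne h1, ← (T.inc_smul.2 hu₁ : T.Inc _ (b • u₁)).side_eq hne.symm,
    hz₁.smul b a₂, ← hb a₂]

end SameSides

/-- A finitely generated group acting on a tree without a fixed vertex acts without a fixed vertex
on the tree obtained by collapsing all the edges outside of some orbit. -/
theorem exists_not_sameSides (T : EdgeTree Γ V E) [Group.FG Γ] [Nonempty V]
    (hfix : ¬ ∃ v : V, ∀ a : Γ, a • v = v) :
    ∃ e, ∀ y, ∃ a : Γ, ¬ T.SameSides e y (a • y) := by
  classical
  obtain ⟨S, hS⟩ := (Group.fg_def.1 ‹_› : (⊤ : Subgroup Γ).FG)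
  let L : V → ℕ := fun x => ∑ s ∈ S, (T.geod x (s • x)).support.card
  obtain ⟨x, hx⟩ : ∃ x, ∀ y, L x ≤ L y :=
    ⟨Function.argmin L, fun y => Function.argmin_le L y⟩
  obtain ⟨s, hs, hsx⟩ : ∃ s ∈ S, s • x ≠ x := by
    by_contra! hcon
    refine hfix ⟨x, fun a => ?_⟩
    have h1 : (⊤ : Subgroup Γ) ≤ MulAction.stabilizer Γ x := by
      rw [← hS, Subgroup.closure_le]
      exact hcon
    exact h1 (Subgroup.mem_top a)
  obtain ⟨e, -, hex⟩ := T.exists_first_edge hsx.symm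
  refine ⟨e, ?_⟩
  by_contra! hcon
  have hy : ∃ n y, (∀ a : Γ, T.SameSides e y (a • y)) ∧ (T.geod y x).support.card = n := by
    obtain ⟨y, hy⟩ := hcon
    exact ⟨_, y, hy, rfl⟩
  obtain ⟨y, hfixy, hyn⟩ := Nat.find_spec hy
  have hyx : y ≠ x := by
    rintro rfl
    have := hfixy s 1
    rw [one_smul] at this
    exact hex this
  obtain ⟨e', he'y, he'x⟩ := T.exists_first_edge hyx
  obtain ⟨c, hc⟩ : ∃ c : Γ, c • e = e' := by
    by_contra! hno
    obtain ⟨u, hu, huy⟩ := T.exists_other_end he'y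
    have h1 := T.card_support_geod_other_end he'y hu huy he'x
    have h2 : T.SameSides e y u := .of_inc he'y hu hno
    exact Nat.find_min hy (m := (T.geod u x).support.card) (by lia)
      ⟨u, fun a => h2.symm.trans ((hfixy a).trans (h2.smul a)), rfl⟩
  have hside : ∀ a b : Γ, T.side (a • e') (b • y) = T.side (a • e') y := by
    intro a b
    have := hfixy b (a * c)
    rw [mul_smul, hc] at this
    exact this.symm
  have key : ∀ a : Γ, a ≠ 1 →
      (T.geod y (a • y)).support.card < (T.geod x (a • x)).support.card := by
    intro a ha
    have hne : a • e' ≠ e' := fun h => ha (T.free a e' h)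
    have h1 : T.side (a • e') (a • x) ≠ T.side (a • e') (T.src e') := by
      rw [T.side_smul, ← he'y.side_eq hne, ← hside a a, T.side_smul]
      exact he'x.symm
    have h2 : T.side e' (a • x) = T.side e' y := by
      have h3 := hside 1 a
      rw [one_smul] at h3
      rw [T.side_eq_of_side_ne hne h1, ← h3]
      exact ((T.inc_smul.2 he'y : T.Inc (a • e') (a • y)).side_eq hne.symm).symm
    have h3 : (T.geod y (a • x)).support ⊂ (T.geod x (a • x)).support := by
      refine (Finset.ssubset_iff_of_subset (T.support_geod_subset he'y he'x.symm h2)).2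
        ⟨e', ?_, ?_⟩
      · rw [T.mem_support_geod, h2]
        exact he'x.symm
      · rw [T.mem_support_geod, h2]
        exact fun h => h rfl
    have h4 : (T.geod (a • y) y).support ⊆ (T.geod (a • x) y).support := by
      refine T.support_geod_subset (T.inc_smul.2 he'y : T.Inc (a • e') (a • y)) ?_ (hside a a).symm
      rw [T.side_smul, T.side_smul]
      exact he'x.symm
    rw [← T.neg_geod y, ← T.neg_geod y, Finsupp.support_neg, Finsupp.support_neg] at h4
    exact (Finset.card_le_card h4).trans_lt (Finset.card_lt_card h3)
  refine absurd (hx y) (not_le.2 (Finset.sum_lt_sum (fun a _ => ?_) ⟨s, hs, key s ?_⟩))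
  · by_cases ha : a = 1
    · subst ha
      simp
    · exact (key a ha).le
  · rintro rfl
    exact hsx (one_smul _ x)

end EdgeTree

namespace EdgeTree

variable {Γ V E : Type} [Group Γ] [MulAction Γ V] [MulAction Γ E]

/-- The case of an amalgamated product over the trivial group. -/
theorem isFreeProd_of_not_sameSides (T : EdgeTree Γ V E) (e : E)
    (he : ∀ y, ∃ a : Γ, ¬ T.SameSides e y (a • y))
    (hne : ∀ a : Γ, ¬ T.SameSides e (T.tgt e) (a • T.src e)) :
    ∃ B : Bool → Subgroup Γ, (∀ b, B b ≠ ⊥) ∧ IsFreeProd B := by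
  classical
  let B : Bool → Subgroup Γ := fun β => T.classStab e (T.endpt e β)
  have hsup : ⨆ β, B β = ⊤ := by
    set W := ⨆ β, B β with hW
    have hBW : ∀ β, B β ≤ W := le_iSup B
    have hP := T.forall_of_edges
      (fun v => ∃ w ∈ W, ∃ β, T.SameSides e v (w • T.endpt e β)) (T.src e)
      ⟨1, one_mem _, false, by rw [one_smul]; exact .refl _⟩ ?_
    · rw [eq_top_iff]
      intro a _
      obtain ⟨w, hw, β, hβ⟩ := hP (a • T.src e)
      have h1 := hβ.smul w⁻¹
      rw [inv_smul_smul, smul_smul] at h1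
      cases β
      · have h2 : w⁻¹ * a ∈ B false := h1.symm
        simpa using mul_mem hw (hBW _ h2)
      · exact absurd h1.symm (hne _)
    · intro e'
      by_cases he' : ∃ a : Γ, a • e = e'
      · obtain ⟨a, rfl⟩ := he'
        have h : ∀ γ, (∃ w ∈ W, ∃ β, T.SameSides e (T.endpt (a • e) γ) (w • T.endpt e β)) ↔
            a ∈ W := by
          intro γ
          constructor
          · rintro ⟨w, hw, β, hβ⟩
            rw [T.endpt_smul] at hβ
            have h1 := hβ.smul w⁻¹
            rw [inv_smul_smul, smul_smul] at h1
            have h3 : β = γ → w⁻¹ * a ∈ B β := by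
              rintro rfl
              exact h1.symm
            have h4 : β = γ := by
              cases β <;> cases γ
              · rfl
              · have h5 := h1.symm.smul (w⁻¹ * a)⁻¹
                rw [inv_smul_smul] at h5
                exact absurd h5.symm (hne _)
              · exact absurd h1.symm (hne _)
              · rfl
            simpa using mul_mem hw (hBW _ (h3 h4))
          · intro ha
            exact ⟨a, ha, γ, by rw [T.endpt_smul]; exact .refl _⟩
        exact (h true).trans (h false).symm
      · push Not at he'
        have h1 : T.SameSides e (T.src e') (T.tgt e') := .of_inc (Or.inl rfl) (Or.inr rfl) he'
        constructor
        · rintro ⟨w, hw, β, hβ⟩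
          exact ⟨w, hw, β, h1.trans hβ⟩
        · rintro ⟨w, hw, β, hβ⟩
          exact ⟨w, hw, β, h1.symm.trans hβ⟩
  have hinc : ∀ β, T.Inc e (T.endpt e β) := by
    rintro (_ | _)
    · exact Or.inl rfl
    · exact Or.inr rfl
  have hnot : ∀ β, B β ≠ ⊥ := by
    intro β hβ
    have h1 : B (!β) = ⊤ := by
      rw [eq_top_iff, ← hsup, iSup_bool_eq]
      cases β
      · rw [hβ]
        simp
      · rw [hβ]
        simp
    obtain ⟨a, ha⟩ := he (T.endpt e (!β))
    refine ha ?_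
    have h2 : a ∈ B (!β) := h1 ▸ Subgroup.mem_top a
    exact h2
  refine ⟨B, hnot, .of_lift_injective hsup ?_⟩
  have horb : ∃ a : Γ, a • e = e := ⟨1, one_smul _ e⟩
  have hends : ∀ β γ, β ≠ γ → T.side e (T.endpt e β) ≠ T.side e (T.endpt e γ) := by
    rintro (_ | _) (_ | _) h
    · exact absurd rfl h
    · simp [endpt]
    · simp [endpt]
    · exact absurd rfl h
  have hbase : ∀ β, ∀ b ∈ B β, b ≠ 1 →
      b • e ≠ e ∧ T.side e (T.src (b • e)) = T.side e (T.endpt e β) := by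
    intro β b hb hb1
    have hbe : b • e ≠ e := fun h => hb1 (T.free b e h)
    refine ⟨hbe, ?_⟩
    rw [← (T.inc_smul.2 (hinc β) : T.Inc (b • e) (b • T.endpt e β)).side_eq hbe.symm]
    have := hb 1
    rw [one_smul] at this
    exact this.symm
  refine lift_injective_of_basePoint
    (fun β => {e' : E | e' ≠ e ∧ T.side e (T.src e') = T.side e (T.endpt e β)}) e
    (fun β h => h.1 rfl) hbase ?_
  rintro β γ hβγ b hb hb1 e' ⟨-, he''⟩
  constructor
  · intro h
    obtain rfl : e' = b⁻¹ • e := by rw [← h, inv_smul_smul]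
    exact hends β γ hβγ ((hbase β b⁻¹ ((B β).inv_mem hb) (inv_ne_one.2 hb1)).2.symm.trans he'')
  · rw [T.src_smul]
    refine side_smul_eq_of_side_ne horb horb (hinc β) (hinc β) (.refl _) (.refl _) hb
      (fun h => hb1 (T.free b e h)) ?_
    rw [he'']
    exact (hends β γ hβγ).symm

/-- The case of an HNN extension over the trivial group. -/
theorem isFreeProd_of_sameSides (T : EdgeTree Γ V E) (e : E) {t : Γ}
    (ht : T.SameSides e (T.tgt e) (t • T.src e)) :
    (∃ t : Γ, Subgroup.zpowers t = ⊤ ∧ ¬ IsOfFinOrder t) ∨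
      ∃ B : Bool → Subgroup Γ, (∀ b, B b ≠ ⊥) ∧ IsFreeProd B := by
  classical
  have h1 : T.side e (t • T.src e) = 1 := by
    have := ht 1
    rwa [one_smul, T.side_tgt, eq_comm] at this
  have h2 : T.side (t⁻¹ • e) (T.src e) = 1 := by rw [T.side_smul_left, inv_inv, h1]
  have hstep : ∀ v, T.side (t⁻¹ • e) v = T.side e (t • v) := fun v => by
    rw [T.side_smul_left, inv_inv]
  have htend : T.SameSides e (t⁻¹ • T.tgt e) (T.src e) := by
    have := ht.smul t⁻¹
    rwa [inv_smul_smul] at this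
  have hinc : T.Inc (t⁻¹ • e) (t⁻¹ • T.tgt e) := T.inc_smul.2 (Or.inr rfl)
  have ht1 : t⁻¹ • e ≠ e := by
    intro h
    rw [h, T.side_src] at h2
    exact zero_ne_one h2
  have hmono : ∀ v, T.side e v = 1 → T.side (t⁻¹ • e) v = 1 := by
    intro v hv
    have h3 : T.side e (T.src (t⁻¹ • e)) = 0 := by
      rw [← hinc.side_eq ht1.symm]
      have := htend 1
      rwa [one_smul, T.side_src] at this
    rw [T.side_eq_of_side_ne ht1.symm (by rw [hv, h3]; exact one_ne_zero), h2]
  have hpow : ∀ (n : ℕ) v, T.side (t⁻¹ • e) v = 1 → T.side e (t ^ (n + 1) • v) = 1 := by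
    intro n v hv
    induction n with
    | zero => rw [zero_add, pow_one, ← hstep, hv]
    | succ n ih => rw [pow_succ', mul_smul, ← hstep, hmono _ ih]
  have hpow' : ∀ (n : ℕ) v, T.side e v = 0 → T.side (t⁻¹ • e) ((t ^ (n + 1))⁻¹ • v) = 0 := by
    intro n v hv
    rcases T.side_eq_zero_or_one (t⁻¹ • e) ((t ^ (n + 1))⁻¹ • v) with h | h
    · exact h
    · have := hpow n _ h
      rw [smul_inv_smul, hv] at this
      exact absurd this zero_ne_one
  have hfin : ¬ IsOfFinOrder t := by
    rw [isOfFinOrder_iff_pow_eq_one]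
    rintro ⟨n, hn, hn1⟩
    have := hpow (n - 1) (T.src e) h2
    rw [Nat.sub_add_cancel hn, hn1, one_smul, T.side_src] at this
    exact zero_ne_one this
  let B : Subgroup Γ := T.classStab e (T.src e)
  have hsup : B ⊔ Subgroup.zpowers t = ⊤ := by
    set W := B ⊔ Subgroup.zpowers t
    have htW : t ∈ W := (le_sup_right : _ ≤ W) (Subgroup.mem_zpowers t)
    have hBW : B ≤ W := le_sup_left
    have hmem : ∀ a, (∃ w ∈ W, T.SameSides e (a • T.src e) (w • T.src e)) ↔ a ∈ W := by
      intro a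
      refine ⟨?_, fun ha => ⟨a, ha, .refl _⟩⟩
      rintro ⟨w, hw, hwa⟩
      have h3 := hwa.smul w⁻¹
      rw [inv_smul_smul, smul_smul] at h3
      have h4 : w⁻¹ * a ∈ B := h3.symm
      simpa using mul_mem hw (hBW h4)
    have hP := T.forall_of_edges (fun v => ∃ w ∈ W, T.SameSides e v (w • T.src e)) (T.src e)
      ⟨1, one_mem _, by rw [one_smul]; exact .refl _⟩ ?_
    · rw [eq_top_iff]
      intro a _
      exact (hmem a).1 (hP _)
    · intro e'
      have hcongr : ∀ {v v'}, T.SameSides e v v' → ((∃ w ∈ W, T.SameSides e v (w • T.src e)) ↔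
          ∃ w ∈ W, T.SameSides e v' (w • T.src e)) := fun h =>
        ⟨fun ⟨w, hw, hv⟩ => ⟨w, hw, h.symm.trans hv⟩, fun ⟨w, hw, hv⟩ => ⟨w, hw, h.trans hv⟩⟩
      by_cases he' : ∃ a : Γ, a • e = e'
      · obtain ⟨a, rfl⟩ := he'
        have h3 := ht.smul a
        rw [smul_smul] at h3
        rw [T.tgt_smul, T.src_smul, hcongr h3, hmem, hmem]
        exact Subgroup.mul_mem_cancel_right W htW
      · push Not at he'
        exact hcongr (.of_inc (Or.inr rfl) (Or.inl rfl) he')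
  by_cases hB : B = ⊥
  · left
    refine ⟨t, ?_, hfin⟩
    rwa [hB, bot_sup_eq] at hsup
  right
  let F : Bool → Subgroup Γ := fun b => cond b B (Subgroup.zpowers t)
  have ht0 : t ≠ 1 := by
    rintro rfl
    exact hfin IsOfFinOrder.one
  have hsup' : ⨆ b, F b = ⊤ := by
    rw [iSup_bool_eq]
    exact hsup
  have hinf : Infinite (Subgroup.zpowers t) := (infinite_zpowers.2 hfin).to_subtype
  refine ⟨F, ?_, .of_lift_injective hsup' ?_⟩
  · rintro (_ | _)
    · exact fun h => ht0 (Subgroup.zpowers_eq_bot.1 h)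
    · exact hB
  let X : Bool → Set V := fun b => cond b {v | T.side e v = 0 ∧ T.side (t⁻¹ • e) v = 1}
    {v | T.side e v = 1 ∨ T.side (t⁻¹ • e) v = 0}
  refine CoprodI.lift_injective_of_ping_pong (fun b => (F b).subtype) (Or.inr ⟨false, ?_⟩) X ?_ ?_
    ?_
  · exact (Cardinal.ofNat_lt_aleph0.trans_le (Cardinal.aleph0_le_mk (Subgroup.zpowers t))).le
  · rintro (_ | _)
    · exact ⟨T.tgt e, Or.inl (T.side_tgt e)⟩
    · exact ⟨T.src e, T.side_src e, h2⟩
  · have hdisj : Disjoint (X false) (X true) := by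
      rw [Set.disjoint_left]
      rintro v (h | h) ⟨h', h''⟩
      · exact zero_ne_one (h'.symm.trans h)
      · exact zero_ne_one (h.symm.trans h'')
    rintro (_ | _) (_ | _) h
    · exact absurd rfl h
    · exact hdisj
    · exact hdisj.symm
    · exact absurd rfl h
  · rintro (_ | _) (_ | _) h
    · exact absurd rfl h
    · rintro ⟨_, n, rfl⟩ hb _ ⟨v, ⟨hv, hv'⟩, rfl⟩
      change T.side e (t ^ n • v) = 1 ∨ T.side (t⁻¹ • e) (t ^ n • v) = 0
      obtain ⟨m, rfl | rfl⟩ := n.eq_nat_or_neg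
      · rcases m with _ | m
        · exact absurd (Subtype.ext (by simp)) hb
        · left
          rw [zpow_natCast]
          exact hpow m v hv'
      · rcases m with _ | m
        · exact absurd (Subtype.ext (by simp)) hb
        · right
          rw [zpow_neg, zpow_natCast]
          exact hpow' m v hv
    · rintro ⟨b, hb⟩ hb1 _ ⟨v, hv, rfl⟩
      have hb0 : b ≠ 1 := fun h => hb1 (Subtype.ext h)
      have hbS : T.SameSides e (T.src e) (b • T.src e) := hb
      have hbt : b • e ≠ t⁻¹ • e := by
        intro h
        have h3 : b = t⁻¹ := by
          have h4 : (t * b) • e = e := by rw [mul_smul, h, smul_inv_smul]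
          exact (inv_eq_of_mul_eq_one_right (T.free _ _ h4)).symm
        subst h3
        have h5 := hbS t⁻¹
        rw [T.side_smul, T.side_src, h2] at h5
        exact one_ne_zero h5
      have hbt' : b • t⁻¹ • e ≠ e := by
        intro h
        have h3 : b = t := by
          rw [smul_smul] at h
          exact mul_inv_eq_one.1 (T.free _ _ h)
        subst h3
        have h5 := hbS 1
        rw [one_smul, T.side_src, h1] at h5
        exact zero_ne_one h5
      have hbb : b • e ≠ e := fun h => hb0 (T.free _ _ h)
      have hbb' : b • t⁻¹ • e ≠ t⁻¹ • e := fun h => hb0 (T.free _ _ h)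
      have horb : ∃ a : Γ, a • e = e := ⟨1, one_smul _ e⟩
      have horb' : ∃ a : Γ, a • e = t⁻¹ • e := ⟨_, rfl⟩
      have hinc' : T.Inc e (T.src e) := Or.inl rfl
      change T.side e (b • v) = 0 ∧ T.side (t⁻¹ • e) (b • v) = 1
      rw [← T.side_src e, ← h2]
      rcases hv with hv | hv
      · have hv' : T.side e v ≠ T.side e (T.src e) := by
          rw [hv, T.side_src]
          exact one_ne_zero
        exact ⟨side_smul_eq_of_side_ne horb horb hinc' hinc' (.refl _) (.refl _) hbS hbb hv',
          side_smul_eq_of_side_ne horb horb' hinc' hinc (.refl _) htend hbS hbt hv'⟩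
      · have hv' : T.side (t⁻¹ • e) v ≠ T.side (t⁻¹ • e) (T.src e) := by
          rw [hv, h2]
          exact zero_ne_one
        exact ⟨side_smul_eq_of_side_ne horb' horb hinc hinc' htend (.refl _) hbS hbt' hv',
          side_smul_eq_of_side_ne horb' horb' hinc hinc htend htend hbS hbb' hv'⟩
    · exact absurd rfl h

/-- A finitely generated group acting on a tree with trivial edge stabilizers fixes a vertex, is
infinite cyclic, or splits as a free product. -/
theorem exists_fixed_or_isFreeProd (T : EdgeTree Γ V E) [Group.FG Γ] [Nonempty V] :
    (∃ v : V, ∀ a : Γ, a • v = v) ∨ (∃ t : Γ, Subgroup.zpowers t = ⊤ ∧ ¬ IsOfFinOrder t) ∨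
      ∃ B : Bool → Subgroup Γ, (∀ b, B b ≠ ⊥) ∧ IsFreeProd B := by
  by_cases hfix : ∃ v : V, ∀ a : Γ, a • v = v
  · exact Or.inl hfix
  right
  obtain ⟨e, he⟩ := T.exists_not_sameSides hfix
  by_cases ht : ∃ t : Γ, T.SameSides e (T.tgt e) (t • T.src e)
  · obtain ⟨t, ht⟩ := ht
    exact T.isFreeProd_of_sameSides e ht
  · push Not at ht
    exact Or.inr (T.isFreeProd_of_not_sameSides e he ht)

end EdgeTree
section Derivation

variable {H M : Type*} [Group H] [AddCommGroup M] [DistribMulAction H M]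

theorem MonoidHom.apply_eq_add_smul {S : Set H} (hS : Subgroup.closure S = ⊤)
    (Ψ : H →* Equiv.Perm M) (h : ∀ s ∈ S, ∀ m, Ψ s m = Ψ s 0 + s • m) (g : H) (m : M) :
    Ψ g m = Ψ g 0 + g • m := by
  have hg : g ∈ Subgroup.closure S := hS ▸ Subgroup.mem_top g
  induction hg using Subgroup.closure_induction generalizing m with
  | mem x hx => exact h x hx m
  | one => simp
  | mul x y _ _ hx hy =>
    rw [map_mul, Equiv.Perm.mul_apply, Equiv.Perm.mul_apply, hx (Ψ y m), hx (Ψ y 0), hy m, smul_add,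
      mul_smul, add_assoc]
  | inv x _ hx =>
    rw [map_inv]
    have hinv : ∀ m', Ψ x ((Ψ x)⁻¹ m') = m' := fun m' => (Ψ x).apply_symm_apply m'
    apply (Ψ x).injective
    rw [hinv, hx, smul_add, smul_inv_smul, ← add_assoc, ← hx, hinv, zero_add]

theorem MonoidHom.derivation_mul {Ψ : H →* Equiv.Perm M} (h : ∀ g m, Ψ g m = Ψ g 0 + g • m)
    (a b : H) : Ψ (a * b) 0 = Ψ a 0 + a • Ψ b 0 := by
  rw [map_mul, Equiv.Perm.mul_apply, h]

/-- The affine transformation `m' ↦ m + h • m'`. -/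
def affinePerm (h : H) (m : M) : Equiv.Perm M := (MulAction.toPerm h).trans (Equiv.addLeft m)

theorem affinePerm_apply (h : H) (m m' : M) : affinePerm h m m' = m + h • m' := rfl

theorem exists_derivation_of_zpowers {x : H} (hx : Subgroup.zpowers x = ⊤) (hx' : ¬ IsOfFinOrder x)
    (m : M) : ∃ δ : H → M, (∀ a b, δ (a * b) = δ a + a • δ b) ∧ δ x = m := by
  have hb : Function.Bijective (zpowersHom H x) := by
    constructor
    · intro a b hab
      exact injective_zpow_iff_not_isOfFinOrder.2 hx' hab
    · intro h
      obtain ⟨n, hn⟩ : h ∈ Subgroup.zpowers x := hx ▸ Subgroup.mem_top h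
      exact ⟨Multiplicative.ofAdd n, hn⟩
  let F := MulEquiv.ofBijective _ hb
  let Ψ : H →* Equiv.Perm M := (zpowersHom _ (affinePerm x m)).comp F.symm.toMonoidHom
  have hΨ : Ψ x = affinePerm x m := by
    have h1 : F.symm x = Multiplicative.ofAdd 1 := by
      rw [MulEquiv.symm_apply_eq]
      exact (zpow_one x).symm
    change zpowersHom _ (affinePerm x m) (F.symm x) = _
    rw [h1]
    exact zpow_one _
  have h := Ψ.apply_eq_add_smul (S := {x}) (by rw [← Subgroup.zpowers_eq_closure, hx]) (by
    rintro _ rfl m'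
    simp [hΨ, affinePerm_apply])
  exact ⟨fun g => Ψ g 0, Ψ.derivation_mul h, by simp [hΨ, affinePerm_apply]⟩

theorem IsFreeProd.exists_derivation {ι H M : Type} [Group H] [AddCommGroup M]
    [DistribMulAction H M] {A : ι → Subgroup H} (hA : IsFreeProd A) (c : ∀ i, A i → M)
    (hc : ∀ i a b, c i (a * b) = c i a + (a : H) • c i b) :
    ∃ δ : H → M, (∀ a b, δ (a * b) = δ a + a • δ b) ∧ ∀ i (a : A i), δ a = c i a := by
  have hc1 : ∀ i, c i 1 = 0 := fun i => by simpa using hc i 1 1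
  let ψ : ∀ i, A i →* Equiv.Perm M := fun i =>
    { toFun := fun a => affinePerm (a : H) (c i a)
      map_one' := by
        ext m
        simp [affinePerm_apply, hc1]
      map_mul' := fun a b => by
        ext m
        simp [affinePerm_apply, hc, mul_smul, add_assoc] }
  obtain ⟨Ψ, hΨ⟩ := hA.2 _ ψ
  have hΨ' : ∀ i (a : A i) m, Ψ a m = c i a + (a : H) • m := fun i a m => by rw [hΨ]; rfl
  have h := Ψ.apply_eq_add_smul (S := ⋃ i, (A i : Set H))
    (by rw [Subgroup.closure_iUnion, ← hA.1]; simp) (by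
      intro s hs m
      obtain ⟨i, hi⟩ := Set.mem_iUnion.1 hs
      have := hΨ' i ⟨s, hi⟩
      simp only at this
      rw [this, this, smul_zero, add_zero])
  exact ⟨fun g => Ψ g 0, Ψ.derivation_mul h, fun i a => by
    change Ψ a 0 = _
    rw [hΨ', smul_zero, add_zero]⟩

end Derivation

section FreeProdTree

variable {ι H : Type} [Group H] (A : ι → Subgroup H) (Z : ι → Prop)

/-- The vertices of the tree of a free product with set of letters `Z`: the elements of the group
and the cosets of the factors that are not letters. -/
abbrev FreeProdVertex : Type := H ⊕ Σ i : {i // ¬ Z i}, H ⧸ A i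

variable (H ι) in
/-- The edges of the tree of a free product. -/
abbrev FreeProdEdge : Type := Σ _ : ι, H

variable {A Z}

/-- The vertex of the tree of a free product at the end of the edge of type `i` starting at `h`. -/
noncomputable def freeProdEnd (A : ι → Subgroup H) (Z : ι → Prop) (x : ι → H) (i : ι) (h : H) :
    FreeProdVertex A Z :=
  open Classical in
  if hi : Z i then Sum.inl (h * x i) else Sum.inr ⟨⟨i, hi⟩, (h : H ⧸ A i)⟩

theorem freeProdEnd_of_letter {x : ι → H} {i : ι} (hi : Z i) (h : H) :
    freeProdEnd A Z x i h = Sum.inl (h * x i) := dif_pos hi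

theorem freeProdEnd_of_not_letter {x : ι → H} {i : ι} (hi : ¬ Z i) (h : H) :
    freeProdEnd A Z x i h = Sum.inr ⟨⟨i, hi⟩, (h : H ⧸ A i)⟩ := dif_neg hi

theorem smul_freeProdEnd {x : ι → H} (g : H) (i : ι) (h : H) :
    freeProdEnd A Z x i (g * h) = g • freeProdEnd A Z x i h := by
  by_cases hi : Z i
  · rw [freeProdEnd_of_letter hi, freeProdEnd_of_letter hi, mul_assoc]
    rfl
  · rw [freeProdEnd_of_not_letter hi, freeProdEnd_of_not_letter hi]
    rfl

theorem IsFreeProd.eqvGen (hA : IsFreeProd A) {x : ι → H}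
    (hx : ∀ i, Z i → Subgroup.zpowers (x i) = A i) (v w : FreeProdVertex A Z) :
    Relation.EqvGen (fun a b => ∃ e : FreeProdEdge ι H,
      a = Sum.inl e.2 ∧ b = freeProdEnd A Z x e.1 e.2) v w := by
  set R : FreeProdVertex A Z → FreeProdVertex A Z → Prop := fun a b => ∃ e : FreeProdEdge ι H,
      a = Sum.inl e.2 ∧ b = freeProdEnd A Z x e.1 e.2 with hR
  have hsmul : ∀ (g : H) {v w}, Relation.EqvGen R v w → Relation.EqvGen R (g • v) (g • w) := by
    intro g v w h
    induction h with
    | rel _ _ h =>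
      obtain ⟨e, rfl, rfl⟩ := h
      exact .rel _ _ ⟨⟨e.1, g * e.2⟩, rfl, (smul_freeProdEnd _ _ _).symm⟩
    | refl _ => exact .refl _
    | symm _ _ _ ih => exact .symm _ _ ih
    | trans _ _ _ _ _ ih ih' => exact .trans _ _ _ ih ih'
  let W : Subgroup H :=
    { carrier := {a | Relation.EqvGen R (Sum.inl 1) (Sum.inl a)}
      one_mem' := .refl _
      mul_mem' := by
        intro a b ha hb
        refine .trans _ _ _ ha ?_
        simpa using hsmul a hb
      inv_mem' := by
        intro a ha
        simpa using (hsmul a⁻¹ ha).symm }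
  have hedge : ∀ i h, Relation.EqvGen R (Sum.inl h) (freeProdEnd A Z x i h) := fun i h =>
    .rel _ _ ⟨⟨i, h⟩, rfl, rfl⟩
  have hW : W = ⊤ := by
    rw [eq_top_iff, ← hA.1]
    refine iSup_le fun i => ?_
    by_cases hi : Z i
    · rw [← hx i hi, Subgroup.zpowers_le]
      have := hedge i 1
      rw [freeProdEnd_of_letter hi, one_mul] at this
      exact this
    · intro a ha
      have h1 := hedge i 1
      have h2 := hedge i a
      rw [freeProdEnd_of_not_letter hi] at h1 h2
      have h3 : (a : H ⧸ A i) = ((1 : H) : H ⧸ A i) := by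
        rw [eq_comm, QuotientGroup.eq]
        simpa using ha
      rw [h3] at h2
      exact h1.trans _ _ _ h2.symm
  have hinl : ∀ a, Relation.EqvGen R (Sum.inl 1) (Sum.inl a) := fun a => by
    have h1 : a ∈ W := hW ▸ Subgroup.mem_top a
    exact h1
  have hall : ∀ v, Relation.EqvGen R (Sum.inl 1) v := by
    rintro (a | ⟨⟨i, hi⟩, q⟩)
    · exact hinl a
    · obtain ⟨a, rfl⟩ := QuotientGroup.mk_surjective q
      have h1 := hedge i a
      rw [freeProdEnd_of_not_letter hi] at h1
      exact (hinl a).trans _ _ _ h1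
  exact (hall v).symm.trans _ _ _ (hall w)

/-- The tree of a free product: its vertices are the elements of the group and the cosets of the
factors that are not generated by a letter, and the quotient of the Cayley graph by the letters. -/
theorem IsFreeProd.nonempty_edgeTree (hA : IsFreeProd A) (x : ι → H)
    (hx : ∀ i, Z i → Subgroup.zpowers (x i) = A i ∧ ¬ IsOfFinOrder (x i)) :
    Nonempty (EdgeTree H (FreeProdVertex A Z) (FreeProdEdge ι H)) := by
  classical
  let : DistribMulAction H (FreeProdEdge ι H →₀ ℤ) := Finsupp.comapDistribMulAction
  have hsingle : ∀ (g : H) (i : ι) (h : H), g • (Finsupp.single ⟨i, h⟩ 1 : FreeProdEdge ι H →₀ ℤ) =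
      Finsupp.single ⟨i, g * h⟩ 1 := fun g i h => Finsupp.comapSMul_single g _ _
  have hc : ∀ i, ∃ c : A i → (FreeProdEdge ι H →₀ ℤ),
      (∀ a b, c (a * b) = c a + (a : H) • c b) ∧
      (¬ Z i → ∀ a : A i, c a = Finsupp.single ⟨i, 1⟩ 1 - Finsupp.single ⟨i, (a : H)⟩ 1) ∧
      (Z i → ∀ a : A i, (a : H) = x i → c a = Finsupp.single ⟨i, 1⟩ 1) := by
    intro i
    by_cases hi : Z i
    · obtain ⟨h1, h2⟩ := hx i hi
      have hxi : x i ∈ A i := h1 ▸ Subgroup.mem_zpowers (x i)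
      have h3 : Subgroup.zpowers (⟨x i, hxi⟩ : A i) = ⊤ := by
        rw [eq_top_iff]
        rintro ⟨a, ha⟩ -
        obtain ⟨n, hn⟩ : a ∈ Subgroup.zpowers (x i) := h1.symm ▸ ha
        exact ⟨n, Subtype.ext (by simpa using hn)⟩
      have h4 : ¬ IsOfFinOrder (⟨x i, hxi⟩ : A i) := fun h =>
        h2 ((A i).subtype.isOfFinOrder h)
      obtain ⟨c, hc, hcx⟩ := exists_derivation_of_zpowers h3 h4
        (Finsupp.single ⟨i, 1⟩ 1 : FreeProdEdge ι H →₀ ℤ)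
      refine ⟨c, hc, fun h => absurd hi h, ?_⟩
      rintro - ⟨a, ha⟩ rfl
      exact hcx
    · refine ⟨fun a => Finsupp.single ⟨i, 1⟩ 1 - Finsupp.single ⟨i, (a : H)⟩ 1, ?_, fun _ _ => rfl,
        fun h => absurd h hi⟩
      intro a b
      simp only [smul_sub, hsingle, mul_one, Subgroup.coe_mul]
      abel
  choose c hc1 hc2 hc3 using hc
  obtain ⟨δ, hδ, hδc⟩ := hA.exists_derivation c hc1
  have hwd : ∀ (i : {i // ¬ Z i}) (a b : H), QuotientGroup.leftRel (A i) a b →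
      δ a + Finsupp.single ⟨i, a⟩ 1 = δ b + Finsupp.single ⟨i, b⟩ 1 := by
    intro i a b hab
    rw [QuotientGroup.leftRel_apply] at hab
    have h1 : b = a * (a⁻¹ * b) := by group
    have h2 : δ b = δ a + (Finsupp.single ⟨i, a⟩ 1 - Finsupp.single ⟨i, b⟩ 1) := by
      rw [h1, hδ, hδc i ⟨_, hab⟩, hc2 i i.2, smul_sub, hsingle, hsingle, mul_one]
    rw [h2]
    abel
  let pot : FreeProdVertex A Z → FreeProdEdge ι H →₀ ℤ := Sum.elim δ fun y =>
    Quotient.lift (fun a : H => δ a + Finsupp.single ⟨y.1, a⟩ 1) (hwd y.1) y.2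
  exact ⟨{
    src := fun e => Sum.inl e.2
    tgt := fun e => freeProdEnd A Z x e.1 e.2
    src_smul := fun _ _ => rfl
    tgt_smul := fun g e => smul_freeProdEnd g e.1 e.2
    free := by
      rintro g ⟨i, h⟩ he
      have h1 := eq_of_heq (Sigma.mk.inj_iff.1 he).2
      exact mul_eq_right.1 h1
    pot := pot
    pot_edge := by
      rintro ⟨i, h⟩
      by_cases hi : Z i
      · rw [freeProdEnd_of_letter hi]
        change δ (h * x i) - δ h = _
        have hxi : x i ∈ A i := (hx i hi).1 ▸ Subgroup.mem_zpowers (x i)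
        rw [hδ, hδc i ⟨x i, hxi⟩, hc3 i hi _ rfl, hsingle, mul_one]
        abel
      · rw [freeProdEnd_of_not_letter hi]
        change δ h + Finsupp.single ⟨i, h⟩ 1 - δ h = _
        abel
    conn := hA.eqvGen fun i hi => (hx i hi).1 }⟩

theorem orbitBound_freeProdEdge [Fintype ι] : OrbitBound H (FreeProdEdge ι H) (Fintype.card ι) := by
  intro m r hr
  have hinj : Function.Injective fun j => (r j).1 := by
    intro j j' h
    refine hr j j' ((r j').2 * (r j).2⁻¹) ?_
    refine Sigma.ext h (heq_of_eq ?_)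
    exact inv_mul_cancel_right _ _
  simpa using Fintype.card_le_of_injective _ hinj

theorem isFreeProd_range_of (G : ι → Type) [∀ i, Group (G i)] :
    IsFreeProd fun i => (CoprodI.of : G i →* CoprodI G).range := by
  constructor
  · rw [← CoprodI.range_eq_iSup, CoprodI.lift_of', MonoidHom.range_eq_top]
    exact Function.surjective_id
  · intro K _ ψ
    refine ⟨CoprodI.lift fun i => (ψ i).comp (CoprodI.of : G i →* CoprodI G).rangeRestrict, ?_⟩
    rintro i ⟨_, a, rfl⟩
    rw [CoprodI.lift_of]
    rfl

end FreeProdTree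

theorem mem_fixedSubgroup {G : Type*} [Group G] {φ : G →* G} {g : G} :
    g ∈ fixedSubgroup φ ↔ φ g = g := Iff.rfl

theorem Subgroup.GenBy.of_map {G G' : Type*} [Group G] [Group G'] {K : Subgroup G} {n : ℕ}
    {f : G →* G'} (hf : Function.Injective f) (h : (K.map f).GenBy n) : K.GenBy n := by
  classical
  obtain ⟨S, hS, hSK⟩ := h
  have hrange : (S : Set G') ⊆ Set.range f := fun s hs => by
    have h1 : s ∈ K.map f := hSK ▸ Subgroup.subset_closure hs
    obtain ⟨k, -, rfl⟩ := h1
    exact ⟨k, rfl⟩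
  refine ⟨S.preimage f hf.injOn, ?_, Subgroup.map_injective hf ?_⟩
  · refine le_trans ?_ hS
    exact Finset.card_le_card_of_injOn f (fun a ha => Finset.mem_preimage.1 ha) hf.injOn
  · rw [MonoidHom.map_closure, Finset.coe_preimage, Set.image_preimage_eq_of_subset hrange, hSK]

theorem Subgroup.GenBy.one_le {G : Type*} [Group G] {K : Subgroup G} {n : ℕ}
    (h : (⊤ : Subgroup K).GenBy n) (hK : K ≠ ⊥) : 1 ≤ n := by
  rw [Nat.one_le_iff_ne_zero]
  rintro rfl
  obtain ⟨S, hS, hSK⟩ := h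
  rw [Nat.le_zero, Finset.card_eq_zero] at hS
  rw [hS, Finset.coe_empty, Subgroup.closure_empty] at hSK
  refine hK ?_
  rw [← Subgroup.range_subtype K, MonoidHom.range_eq_map, ← hSK, Subgroup.map_bot]

/-- The fixed subgroups of the injective endomorphisms of a group are generated by at most `L`
elements. -/
def FixBound (C : Type) [Group C] (L : ℕ) : Prop :=
  ∀ ψ : C →* C, Function.Injective ψ → (fixedSubgroup ψ).GenBy L

namespace FixBound

variable {C C' : Type} [Group C] [Group C']

theorem mono {L L' : ℕ} (h : FixBound C L) (hL : L ≤ L') : FixBound C L' :=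
  fun ψ hψ => (h ψ hψ).mono hL

theorem of_mulEquiv {L : ℕ} (h : FixBound C L) (e : C ≃* C') : FixBound C' L := by
  intro ψ hψ
  let ψ' : C →* C := (e.symm.toMonoidHom.comp ψ).comp e.toMonoidHom
  have h1 := (h ψ' (e.symm.injective.comp (hψ.comp e.injective))).map e.toMonoidHom
  convert h1
  ext c
  constructor
  · intro hc
    refine ⟨e.symm c, ?_, e.apply_symm_apply c⟩
    change e.symm (ψ (e (e.symm c))) = _
    rw [e.apply_symm_apply, mem_fixedSubgroup.1 hc]
  · rintro ⟨c, hc, rfl⟩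
    have h2 : e.symm (ψ (e c)) = c := hc
    exact (e.symm_apply_eq.1 h2)

theorem of_injective {M : Type} [Group M] {ℓ : ℝ}
    (hM : ∀ (K : Subgroup M) (hK : Group.FG K) (f : K →* K), Function.Injective f →
      ∃ h : Group.FG (fixedSubgroup f), (@Group.rank _ _ h : ℝ) ≤ ℓ * @Group.rank _ _ hK)
    (hℓ : 0 ≤ ℓ) {m : ℕ} (hm : (⊤ : Subgroup C).GenBy m) (σ : C →* M)
    (hσ : Function.Injective σ) : FixBound C ⌊ℓ * m⌋₊ := by
  refine of_mulEquiv (C := σ.range) (fun f hf => ?_) (MonoidHom.ofInjective hσ).symm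
  have h1 : (⊤ : Subgroup σ.range).GenBy m := by
    have := hm.map (MonoidHom.ofInjective hσ).toMonoidHom
    rwa [Subgroup.map_top_of_surjective (MonoidHom.ofInjective hσ).toMonoidHom
      (MonoidHom.ofInjective hσ).surjective] at this
  obtain ⟨hK, hKm⟩ := h1.exists_fg_rank_le
  obtain ⟨h, hr⟩ := hM _ hK f hf
  have h2 := (Subgroup.GenBy.of_rank (fixedSubgroup f)).map (fixedSubgroup f).subtype
  rw [← MonoidHom.range_eq_map, Subgroup.range_subtype] at h2
  refine h2.mono (Nat.le_floor (hr.trans ?_))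
  gcongr

end FixBound

section

variable {Γ V E : Type} [Group Γ] [MulAction Γ V] [MulAction Γ E]

theorem EdgeTree.exists_fixed_or_isFreeProd_of_injective (T : EdgeTree Γ V E) [Nonempty V]
    {Δ : Type} [Group Δ] [Group.FG Δ] {f : Δ →* Γ} (hf : Function.Injective f) :
    (∃ v : V, ∀ a, f a • v = v) ∨
      (∃ t : Δ, Subgroup.zpowers t = ⊤ ∧ ¬ IsOfFinOrder t) ∨
      ∃ B : Bool → Subgroup Δ, (∀ b, B b ≠ ⊥) ∧ IsFreeProd B := by
  let : MulAction Δ V := MulAction.compHom V f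
  let : MulAction Δ E := MulAction.compHom E f
  let T' : EdgeTree Δ V E :=
    { src := T.src
      tgt := T.tgt
      src_smul := fun g e => T.src_smul (f g) e
      tgt_smul := fun g e => T.tgt_smul (f g) e
      free := fun g e h => hf ((T.free (f g) e h).trans f.map_one.symm)
      pot := T.pot
      pot_edge := T.pot_edge
      conn := T.conn }
  exact T'.exists_fixed_or_isFreeProd

end

/-- A finitely generated group is a free product of finitely many freely indecomposable groups. -/
theorem Subgroup.GenBy.exists_isFreeProd {H : Type} [Group H] {r : ℕ}
    (hr : (⊤ : Subgroup H).GenBy r) :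
    ∃ (ι : Type) (_ : Fintype ι) (A : ι → Subgroup H), IsFreeProd A ∧ (∀ i, A i ≠ ⊥) ∧
      ∀ i, ¬ ∃ B : Bool → Subgroup (A i), (∀ b, B b ≠ ⊥) ∧ IsFreeProd B := by
  classical
  by_contra! hcon
  have hstep : ∀ n, ∃ (ι : Type) (_ : Fintype ι) (A : ι → Subgroup H), IsFreeProd A ∧
      (∀ i, A i ≠ ⊥) ∧ n ≤ Fintype.card ι := by
    intro n
    induction n with
    | zero =>
      by_cases hH : (⊤ : Subgroup H) = ⊥
      · refine ⟨Empty, inferInstance, fun i => i.elim, ⟨?_, fun K _ ψ => ⟨1, fun i => i.elim⟩⟩,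
          fun i => i.elim, Nat.zero_le _⟩
        rw [iSup_of_empty, hH]
      · exact ⟨Unit, inferInstance, fun _ => ⊤, IsFreeProd.top, fun _ => hH, Nat.zero_le _⟩
    | succ n ih =>
      obtain ⟨ι, _, A, hA, hA1, hn⟩ := ih
      obtain ⟨i₀, B, hB, hB1⟩ := hcon ι inferInstance A hA hA1
      have hex : ∀ i, ∃ (κ : Type) (_ : Fintype κ) (D : κ → Subgroup (A i)), IsFreeProd D ∧
          (∀ j, D j ≠ ⊥) ∧ 1 ≤ Fintype.card κ ∧ (i = i₀ → 2 ≤ Fintype.card κ) := by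
        intro i
        by_cases hi : i = i₀
        · subst hi
          exact ⟨Bool, inferInstance, B, hB1, hB, by simp, by simp⟩
        · refine ⟨Unit, inferInstance, fun _ => ⊤, IsFreeProd.top, fun _ h => hA1 i ?_, by simp,
            fun h => absurd h hi⟩
          rw [← Subgroup.range_subtype (A i), MonoidHom.range_eq_map,
            show (⊤ : Subgroup (A i)) = ⊥ from h, Subgroup.map_bot]
      choose κ hκ D hD hD1 hc1 hc2 using hex
      refine ⟨Σ i, κ i, inferInstance, _, hA.sigma hD, fun y h => hD1 y.1 y.2 ?_, ?_⟩
      · rwa [Subgroup.map_eq_bot_iff_of_injective _ (Subgroup.subtype_injective _)] at h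
      · rw [Fintype.card_sigma]
        have hlt : ∑ _i : ι, 1 < ∑ i, Fintype.card (κ i) :=
          Finset.sum_lt_sum (fun i _ => hc1 i) ⟨i₀, Finset.mem_univ _, hc2 i₀ rfl⟩
        rw [Finset.sum_const, Finset.card_univ, smul_eq_mul, mul_one] at hlt
        omega
  obtain ⟨ι, _, A, hA, hA1, hn⟩ := hstep (r + 1)
  obtain ⟨N, hN, hN1⟩ := hA.exists_genBy hr
  have hpos : ∀ i, 1 ≤ N i := fun i => (hN1 i).one_le (hA1 i)
  have := Finset.sum_le_sum fun i (_ : i ∈ Finset.univ) => hpos i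
  rw [Finset.sum_const, Finset.card_univ, smul_eq_mul, mul_one] at this
  omega

section

variable {ι H : Type} [Group H] {A : ι → Subgroup H} {Z : ι → Prop}

theorem IsFreeProd.fixedSubgroup_genBy [Fintype ι] (hA : IsFreeProd A) {x : ι → H}
    (hx : ∀ i, Z i → Subgroup.zpowers (x i) = A i ∧ ¬ IsOfFinOrder (x i)) {φ : H →* H}
    (hφ : Function.Injective φ)
    (hfix : ∀ i, ¬ Z i → ∃ v : FreeProdVertex A Z, ∀ a ∈ A i, φ a • v = v)
    {L : ℕ} (hL : 0 < L) (hAL : ∀ i, ¬ Z i → FixBound (A i) L) :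
    (fixedSubgroup φ).GenBy (Fintype.card ι * L) := by
  obtain ⟨T⟩ := hA.nonempty_edgeTree x hx
  choose ω hω using hfix
  have hwd : ∀ (i : {i // ¬ Z i}) (a b : H), QuotientGroup.leftRel (A i) a b →
      φ a • ω i i.2 = φ b • ω i i.2 := by
    intro i a b hab
    rw [QuotientGroup.leftRel_apply] at hab
    rw [← hω i i.2 _ hab, ← mul_smul, ← map_mul, mul_inv_cancel_left, hω i i.2 _ hab]
  let f : FreeProdVertex A Z → FreeProdVertex A Z := Sum.elim (fun a => Sum.inl (φ a)) fun y =>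
    Quotient.lift (fun a : H => φ a • ω y.1 y.1.2) (hwd y.1) y.2
  have hf : ∀ (h : H) v, f (h • v) = φ h • f v := by
    rintro h (a | ⟨i, q⟩)
    · change Sum.inl (φ (h * a)) = Sum.inl (φ h * φ a)
      rw [map_mul]
    · obtain ⟨a, rfl⟩ := QuotientGroup.mk_surjective q
      change φ (h * a) • ω i i.2 = φ h • φ a • ω i i.2
      rw [map_mul, mul_smul]
  have hv₀ : f (Sum.inl 1) = Sum.inl 1 := congrArg Sum.inl φ.map_one
  obtain ⟨Q, Y, _, _, ⟨P⟩⟩ := exists_fixedPair φ f hf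
  obtain ⟨E, _, T', hT'⟩ := T.hasTree_of_fixedPair orbitBound_freeProdEdge φ hφ f hf _ hv₀ P
  have hjφ : ∀ q, φ (P.j q) = P.j q := fun q => (P.j_range _).1 ⟨q, rfl⟩
  have hinl : ∀ (a h : H), h • (Sum.inl a : FreeProdVertex A Z) = Sum.inl a → h = 1 :=
    fun a h hh => mul_eq_right.1 (Sum.inl_injective hh)
  have hbound : ∀ v : FreeProdVertex A Z, FixBound (MulAction.stabilizer H v) L := by
    rintro (a | ⟨i, q⟩)
    · have h1 : MulAction.stabilizer H (Sum.inl a : FreeProdVertex A Z) = ⊥ := by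
        rw [eq_bot_iff]
        exact fun h hh => hinl a h hh
      rw [h1]
      intro ψ _
      rw [Subsingleton.elim (fixedSubgroup ψ) ⊥]
      exact Subgroup.GenBy.bot.mono (Nat.zero_le _)
    · obtain ⟨a, rfl⟩ := QuotientGroup.mk_surjective q
      have h1 : MulAction.stabilizer H (Sum.inr ⟨i, ((1 : H) : H ⧸ A i)⟩ : FreeProdVertex A Z) =
          A i := by
        ext h
        have hmem : h ∈ A i ↔ ((1 : H) : H ⧸ A i) = h := by simp [QuotientGroup.eq]
        rw [hmem]
        change (Sum.inr ⟨i, ((h * 1 : H) : H ⧸ A i)⟩ : FreeProdVertex A Z) = _ ↔ _ = _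
        rw [mul_one, eq_comm (a := ((1 : H) : H ⧸ A i))]
        constructor
        · exact fun hh => eq_of_heq (Sigma.mk.inj_iff.1 (Sum.inr_injective hh)).2
        · exact fun hh => by rw [hh]
      have h2 : (Sum.inr ⟨i, (a : H ⧸ A i)⟩ : FreeProdVertex A Z) =
          a • (Sum.inr ⟨i, ((1 : H) : H ⧸ A i)⟩ : FreeProdVertex A Z) := by
        change _ = (Sum.inr ⟨i, ((a * 1 : H) : H ⧸ A i)⟩ : FreeProdVertex A Z)
        rw [mul_one]
      rw [h2, MulAction.stabilizer_smul_eq_stabilizer_map_conj, h1]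
      exact (hAL i i.2).of_mulEquiv ((A i).equivMapOfInjective _ (MulAut.conj a).injective)
  obtain ⟨y₀, hy₀⟩ := (P.i_range _).2 hv₀
  have hstab : ∀ y : Y, (MulAction.stabilizer Q y).GenBy L := by
    intro y
    have hy : f (P.i y) = P.i y := (P.i_range _).1 ⟨y, rfl⟩
    set C := MulAction.stabilizer H (P.i y) with hC
    have hφC : ∀ c ∈ C, φ c ∈ C := by
      intro c hc
      rw [MulAction.mem_stabilizer_iff] at hc ⊢
      conv_lhs => rw [← hy, ← hf, hc, hy]
    let ψ : C →* C := (φ.comp C.subtype).codRestrict C fun c => hφC c c.2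
    have hψ : Function.Injective ψ := fun a b h =>
      Subtype.ext (hφ (congrArg Subtype.val h))
    refine Subgroup.GenBy.of_map P.j_inj ?_
    convert (hbound _ ψ hψ).map C.subtype
    ext h
    constructor
    · rintro ⟨q, hq, rfl⟩
      have h1 : P.j q ∈ C := by
        rw [MulAction.mem_stabilizer_iff, ← P.i_smul, MulAction.mem_stabilizer_iff.1 hq]
      exact ⟨⟨_, h1⟩, Subtype.ext (hjφ q), rfl⟩
    · rintro ⟨c, hc, rfl⟩
      obtain ⟨q, hq⟩ := (P.j_range c).2 (congrArg Subtype.val hc)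
      refine ⟨q, ?_, hq⟩
      refine P.i_inj ?_
      rw [P.i_smul, hq]
      exact c.2
  have htop := T'.genBy_top hT' hL y₀ (fun q hq => by
    refine P.j_inj ?_
    rw [map_one]
    refine hinl 1 _ ?_
    rw [← hy₀, ← P.i_smul, hq]) hstab
  convert htop.map P.j
  rw [← MonoidHom.range_eq_map]
  ext h
  exact (P.j_range h).symm

end

/-- A finitely generated subgroup of a free product that is neither infinite cyclic nor
a nontrivial free product embeds into one of the factors. -/
theorem exists_injective_to_factor {ι : Type} (G : ι → Type) [∀ i, Group (G i)] {C : Type} [Group C]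
    [Group.FG C] [Nontrivial C] {θ : C →* Monoid.CoprodI G} (hθ : Function.Injective θ)
    (hZ : ¬ ∃ t : C, Subgroup.zpowers t = ⊤ ∧ ¬ IsOfFinOrder t)
    (hB : ¬ ∃ B : Bool → Subgroup C, (∀ b, B b ≠ ⊥) ∧ IsFreeProd B) :
    ∃ i, ∃ σ : C →* G i, Function.Injective σ := by
  obtain ⟨T⟩ := (isFreeProd_range_of G).nonempty_edgeTree (Z := fun _ => False) (fun _ => 1)
    fun _ h => h.elim
  obtain ⟨v, hv⟩ := ((T.exists_fixed_or_isFreeProd_of_injective hθ).resolve_right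
    (not_or.2 ⟨hZ, hB⟩))
  rcases v with g | ⟨i, q⟩
  · obtain ⟨c, hc⟩ := exists_ne (1 : C)
    exact absurd (hθ ((mul_eq_right.1 (Sum.inl_injective (hv c))).trans θ.map_one.symm)) hc
  · obtain ⟨g, rfl⟩ := QuotientGroup.mk_surjective q
    let θ' : C →* Monoid.CoprodI G := (MulAut.conj g⁻¹).toMonoidHom.comp θ
    have hθ' : ∀ c, θ' c ∈ Set.range (Monoid.CoprodI.of : G i →* Monoid.CoprodI G) := by
      intro c
      have h1 := eq_of_heq (Sigma.mk.inj_iff.1 (Sum.inr_injective (hv c))).2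
      have h2 := QuotientGroup.eq.1 h1.symm
      change g⁻¹ * θ c * g⁻¹⁻¹ ∈ (Monoid.CoprodI.of : G i →* Monoid.CoprodI G).range
      rw [inv_inv, mul_assoc]
      exact h2
    obtain ⟨σ, hσ⟩ := MonoidHom.exists_lift_of_injective
      (Monoid.CoprodI.of_injective (M := G) i.1) θ' hθ'
    refine ⟨i, σ, fun a b hab => hθ ((MulAut.conj g⁻¹).injective ?_)⟩
    change θ' a = θ' b
    rw [← hσ, ← hσ, hab]

/-- If each factor `Gᵢ` of the free product `G = G₁ ∗ ⋯ ∗ G_n` has UFP degree at most `ℓᵢ`,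
i.e. `rk(Fix(f)) ≤ ℓᵢ·rk(K)` for every finitely generated subgroup `K ≤ Gᵢ` and every
injective endomorphism `f` of `K`, then for every finitely generated subgroup `H ≤ G` and
every injective endomorphism `φ` of `H`, the fixed subgroup is finitely generated with
`rk(Fix(φ)) ≤ (1/4)·ℓ·(rk(H)+1)²` where `ℓ = maxᵢ ℓᵢ`
(stated as `4·rk(Fix(φ)) ≤ ℓ·(rk(H)+1)²`). -/
theorem fixedSubgroup_of_monomorphism_of_subgroup_of_freeProduct
    (n : ℕ) (hn : 0 < n) (G : Fin n → Type) [∀ i, Group (G i)]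
    (l : Fin n → ℝ) (hl : ∀ i, 1 ≤ l i)
    (hufp : ∀ (i : Fin n) (K : Subgroup (G i)) (hK : Group.FG ↥K)
      (f : ↥K →* ↥K), Function.Injective f →
      ∃ h : Group.FG ↥(fixedSubgroup f),
        (@Group.rank _ _ h : ℝ) ≤ l i * @Group.rank _ _ hK)
    (H : Subgroup (Monoid.CoprodI G)) (hH : Group.FG ↥H)
    (φ : ↥H →* ↥H) (hφ : Function.Injective φ) :
    ∃ h : Group.FG ↥(fixedSubgroup φ),
      4 * (@Group.rank _ _ h : ℝ) ≤
        (Finset.univ.sup' (Finset.univ_nonempty_iff.mpr ⟨⟨0, hn⟩⟩) l) *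
          ((@Group.rank _ _ hH : ℝ) + 1) ^ 2 := by
  classical
  set ℓ := Finset.univ.sup' (Finset.univ_nonempty_iff.mpr ⟨⟨0, hn⟩⟩) l
  have hlℓ : ∀ i, l i ≤ ℓ := fun i => Finset.le_sup' l (Finset.mem_univ i)
  have hℓ : 1 ≤ ℓ := (hl ⟨0, hn⟩).trans (hlℓ _)
  set r := Group.rank H
  have hr : (⊤ : Subgroup H).GenBy r := Subgroup.GenBy.of_rank H
  obtain ⟨ι, _, A, hA, hA1, hAB⟩ := hr.exists_isFreeProd
  obtain ⟨N, hN, hN1⟩ := hA.exists_genBy hr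
  have hpos : ∀ i, 1 ≤ N i := fun i => (hN1 i).one_le (hA1 i)
  set k := Fintype.card ι
  have hsum : ∑ i, (N i - 1) + k = ∑ i, N i := by
    have h1 : k = ∑ _i : ι, 1 := by simp [k]
    rw [h1, ← Finset.sum_add_distrib]
    exact Finset.sum_congr rfl fun i _ => Nat.sub_add_cancel (hpos i)
  obtain ⟨m, hm⟩ : ∃ m, r + 1 = k + m := ⟨r + 1 - k, by omega⟩
  have hm1 : 1 ≤ m := by omega
  have hNm : ∀ i, N i ≤ m := fun i => by
    have := Finset.single_le_sum (f := fun i => N i - 1) (fun _ _ => Nat.zero_le _)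
      (Finset.mem_univ i)
    omega
  let Z : ι → Prop := fun i => ∃ t : A i, Subgroup.zpowers t = ⊤ ∧ ¬ IsOfFinOrder t
  have hx : ∀ i, ∃ x : H, Z i → Subgroup.zpowers x = A i ∧ ¬ IsOfFinOrder x := by
    intro i
    by_cases hi : Z i
    · obtain ⟨t, ht, ht'⟩ := hi
      refine ⟨t, fun _ => ⟨?_, fun h => ht' (Submonoid.isOfFinOrder_coe.1 h)⟩⟩
      have := congrArg (Subgroup.map (A i).subtype) ht
      rwa [MonoidHom.map_zpowers, ← MonoidHom.range_eq_map, Subgroup.range_subtype] at this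
    · exact ⟨1, fun h => absurd h hi⟩
  choose x hx using hx
  obtain ⟨T⟩ := hA.nonempty_edgeTree x hx
  have hfg : ∀ i, Group.FG (A i) := fun i => (hN1 i).exists_fg_rank_le.1
  have hfix : ∀ i, ¬ Z i → ∃ v : FreeProdVertex A Z, ∀ a ∈ A i, φ a • v = v := by
    intro i hi
    obtain ⟨v, hv⟩ := (T.exists_fixed_or_isFreeProd_of_injective
      (f := φ.comp (A i).subtype) (hφ.comp (A i).subtype_injective)).resolve_right
      (not_or.2 ⟨hi, hAB i⟩)
    exact ⟨v, fun a ha => hv ⟨a, ha⟩⟩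
  have hAL : ∀ i, ¬ Z i → FixBound (A i) ⌊ℓ * m⌋₊ := by
    intro i hi
    have : Nontrivial (A i) := (Subgroup.nontrivial_iff_ne_bot _).2 (hA1 i)
    obtain ⟨j, σ, hσ⟩ := exists_injective_to_factor G (C := A i) (θ := H.subtype.comp (A i).subtype)
      (H.subtype_injective.comp (A i).subtype_injective) hi (hAB i)
    refine (FixBound.of_injective (hufp j) (zero_le_one.trans (hl j)) (hN1 i) σ hσ).mono ?_
    refine Nat.floor_mono ?_
    have := hlℓ j
    have : (N i : ℝ) ≤ m := by exact_mod_cast hNm i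
    gcongr
  have hm1' : (1 : ℝ) ≤ m := by exact_mod_cast hm1
  have hL : 0 < ⌊ℓ * m⌋₊ := Nat.floor_pos.2 (one_le_mul_of_one_le_of_one_le hℓ hm1')
  have hgen := hA.fixedSubgroup_genBy hx hφ hfix hL hAL
  have htop : (⊤ : Subgroup (fixedSubgroup φ)).GenBy (k * ⌊ℓ * m⌋₊) := by
    refine Subgroup.GenBy.of_map (fixedSubgroup φ).subtype_injective ?_
    rwa [← MonoidHom.range_eq_map, Subgroup.range_subtype]
  obtain ⟨h, hrank⟩ := htop.exists_fg_rank_le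
  refine ⟨h, ?_⟩
  have h1 : (@Group.rank _ _ h : ℝ) ≤ k * (ℓ * m) := by
    refine (Nat.cast_le.2 hrank).trans ?_
    rw [Nat.cast_mul]
    gcongr
    exact Nat.floor_le (by positivity)
  have h2 : (r : ℝ) + 1 = k + m := by exact_mod_cast hm
  rw [h2]
  nlinarith [mul_nonneg (zero_le_one.trans hℓ) (sq_nonneg ((k : ℝ) - m))]
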